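/- Piecewise Korn inequality up to a small exceptional set (Theorem 4.1). Let p ∈ [1,2) and θ > 0. Then there exist a universal constant c > 0 and a constant C = C(p,θ) > 0 such that for every μ > 0 and every u ∈ W(Q_μ) with jump set Γ_u the following holds: there are a Borel set E ⊆ Q_μ with |E| ≤ c·μ·θ²·H¹(Γ_u) and H¹(∂E) ≤ C·H¹(Γ_u), a finite partition (P_j)_{j=1}^n of Q_μ into pairwise disjoint open sets covering Q_μ up to a Lebesgue-null set, skew-symmetric matrices A_j ∈ ℝ^{2×2} and vectors b_j ∈ ℝ², such that the function v := u − Σ_{j=1}^n (A_j·x + b_j)·χ_{P_j} satisfies (i) H¹((⋃_{j=1}^n ∂P_j) ∩ Q_μ) ≤ C·H¹((⋃_{j=1}^n ∂P_j) ∩ Γ_u) and (ii) ‖∇v‖_{L^p(Q_μ \ E)} ≤ C·μ^{2/p−1}·‖e(u)‖_{L²(Q_μ)}. Moreover, E, (P_j), (A_j), (b_j) can be chosen so that additionally ‖v‖_{L^∞(Q_μ)} ≤ C·‖u‖_{L^∞(Q_μ)}. -/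

import Mathlib

open MeasureTheory Set
open scoped ENNReal NNReal

noncomputable section

/-- The Euclidean plane. -/
abbrev E2 := EuclideanSpace ℝ (Fin 2)

/-- The open square `Q_μ = (-μ, μ)²`. -/
def Qsq (μ : ℝ) : Set E2 := {x | ∀ i : Fin 2, |x i| < μ}

/-- Frobenius norm of a `2 × 2` real matrix. -/
def matNorm (A : Matrix (Fin 2) (Fin 2) ℝ) : ℝ :=
  Real.sqrt (∑ i : Fin 2, ∑ j : Fin 2, (A i j) ^ 2)

/-- The (a.e.) gradient of `u` as a matrix, defined via `fderiv`
(it vanishes at points of non-differentiability). -/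
def mgrad (u : E2 → E2) (x : E2) : Matrix (Fin 2) (Fin 2) ℝ :=
  fun i j => fderiv ℝ u x (EuclideanSpace.single j (1 : ℝ)) i

/-- The symmetrized gradient `e(u) = (∇u + (∇u)ᵀ)/2`. -/
def symGrad (u : E2 → E2) (x : E2) : Matrix (Fin 2) (Fin 2) ℝ :=
  fun i j => (mgrad u x i j + mgrad u x j i) / 2

/-- `Γ` is a finite union of closed line segments. -/
def FinSegUnion (Γ : Set E2) : Prop :=
  ∃ (n : ℕ) (a b : Fin n → E2), Γ = ⋃ i : Fin n, segment ℝ (a i) (b i)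

/-- `u ∈ W(Q_μ)` with jump set `Γ`: `u` is bounded on `Q_μ`, `Γ` is a finite union of
closed segments, and `u` is locally Lipschitz on `Q_μ \ Γ` with essentially bounded
a.e. gradient there. -/
def IsW (μ : ℝ) (u : E2 → E2) (Γ : Set E2) : Prop :=
  (∃ M : ℝ, ∀ x ∈ Qsq μ, ‖u x‖ ≤ M) ∧
  FinSegUnion Γ ∧
  (∀ x ∈ Qsq μ \ Γ, ∃ t ∈ nhds x, ∃ L : ℝ≥0, LipschitzOnWith L u t) ∧
  (∃ K : ℝ, ∀ᵐ x ∂volume, x ∈ Qsq μ \ Γ → matNorm (mgrad u x) ≤ K)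

/-- The infinitesimal rigid motion `x ↦ A x + b`. -/
def rigid (A : Matrix (Fin 2) (Fin 2) ℝ) (b : E2) : E2 → E2 :=
  fun x => Matrix.toEuclideanLin A x + b

namespace PiecewiseKorn

/-- Rotation by a right angle. -/
def rot : E2 →L[ℝ] E2 :=
  LinearMap.toContinuousLinearMap
    { toFun := fun x => !₂[-x 1, x 0]
      map_add' := by
        intro x y; ext i; fin_cases i <;> simp [add_comm]
      map_smul' := by
        intro c x; ext i; fin_cases i <;> simp }

@[simp] lemma rot_zero (x : E2) : rot x 0 = -x 1 := by simp [rot]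
@[simp] lemma rot_one (x : E2) : rot x 1 = x 0 := by simp [rot]

lemma inner_eq (x y : E2) : inner ℝ x y = x 0 * y 0 + x 1 * y 1 := by
  simp [PiLp.inner_apply, Fin.sum_univ_two, mul_comm]

lemma norm_sq_eq (x : E2) : ‖x‖ ^ 2 = x 0 ^ 2 + x 1 ^ 2 := by
  rw [EuclideanSpace.norm_sq_eq]; simp [Fin.sum_univ_two]

lemma inner_rot (x : E2) : inner ℝ (rot x) x = 0 := by
  rw [inner_eq]; simp; ring

lemma norm_rot (x : E2) : ‖rot x‖ = ‖x‖ := by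
  have h : ‖rot x‖ ^ 2 = ‖x‖ ^ 2 := by rw [norm_sq_eq, norm_sq_eq]; simp; ring
  exact (sq_eq_sq₀ (norm_nonneg _) (norm_nonneg _)).1 h

lemma abs_coord_le (x : E2) (c : Fin 2) : |x c| ≤ ‖x‖ := by
  simpa using PiLp.norm_apply_le x c

lemma norm_le_coord (x : E2) {m : ℝ} (h : ∀ c, |x c| ≤ m) : ‖x‖ ≤ 2 * m := by
  have h0 := h 0
  have h1 := h 1
  have hm : 0 ≤ m := (abs_nonneg _).trans h0
  have : ‖x‖ ^ 2 ≤ (2 * m) ^ 2 := by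
    rw [norm_sq_eq, ← sq_abs (x 0), ← sq_abs (x 1)]
    nlinarith [abs_nonneg (x 0), abs_nonneg (x 1)]
  exact (sq_le_sq₀ (norm_nonneg _) (by positivity)).1 this

/-- The infinitesimal rigid motion with angular velocity `a.1` and translation `a.2`. -/
def rg (a : ℝ × E2) (x : E2) : E2 := a.1 • rot x + a.2

/-- The gradient of `rg a`. -/
def rgD (a : ℝ × E2) : E2 →L[ℝ] E2 := a.1 • rot

lemma rg_sub_rg (a : ℝ × E2) (x y : E2) : rg a x - rg a y = rgD a (x - y) := by
  simp [rg, rgD, smul_sub]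

lemma rg_hasFDerivAt (a : ℝ × E2) (x : E2) : HasFDerivAt (rg a) (rgD a) x :=
  (rot.hasFDerivAt.const_smul a.1).add_const a.2

lemma rg_sub (a b : ℝ × E2) (x : E2) : rg (a - b) x = rg a x - rg b x := by
  simp only [rg, Prod.fst_sub, Prod.snd_sub, sub_smul]; abel

lemma norm_rgD_le (a : ℝ × E2) : ‖rgD a‖ ≤ |a.1| := by
  refine ContinuousLinearMap.opNorm_le_bound _ (abs_nonneg _) fun x => ?_
  simp [rgD, norm_smul, norm_rot]

lemma norm_rgD_apply (a : ℝ × E2) (x : E2) : ‖rgD a x‖ = |a.1| * ‖x‖ := by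
  simp [rgD, norm_smul, norm_rot]

lemma inner_rgD (a : ℝ × E2) (x : E2) : inner ℝ (rgD a x) x = 0 := by
  simp [rgD, inner_smul_left, inner_rot]

/-- The open square with lower left corner `p` and side length `r`. -/
def win (p : E2) (r : ℝ) : Set E2 := {x | ∀ c, p c < x c ∧ x c < p c + r}

/-- The closed square with centre `p` and half side length `r`. -/
def cube (p : E2) (r : ℝ) : Set E2 := {x | ∀ c, |x c - p c| ≤ r}

lemma continuous_coord (c : Fin 2) : Continuous fun x : E2 => x c := by fun_prop

lemma isOpen_win (p : E2) (r : ℝ) : IsOpen (win p r) := by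
  have : win p r = ⋂ c, {x : E2 | p c < x c ∧ x c < p c + r} := by ext; simp [win]
  rw [this]
  refine isOpen_iInter_of_finite fun c => ?_
  exact (isOpen_lt continuous_const (continuous_coord c)).inter
    (isOpen_lt (continuous_coord c) continuous_const)

lemma isClosed_cube (p : E2) (r : ℝ) : IsClosed (cube p r) := by
  have : cube p r = ⋂ c, {x : E2 | |x c - p c| ≤ r} := by ext; simp [cube]
  rw [this]
  exact isClosed_iInter fun c =>
    isClosed_le ((continuous_coord c).sub continuous_const).abs continuous_const

lemma convex_win (p : E2) (r : ℝ) : Convex ℝ (win p r) := by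
  intro x hx y hy a b ha hb hab c
  exact (convex_Ioo (p c) (p c + r)) (hx c) (hy c) ha hb hab

/-- The plane as a product. -/
def prodEquiv : E2 ≃ᵐ ℝ × ℝ :=
  (MeasurableEquiv.toLp 2 (Fin 2 → ℝ)).symm.trans MeasurableEquiv.finTwoArrow

lemma prodEquiv_apply (x : E2) : prodEquiv x = (x 0, x 1) := rfl

lemma volume_preserving_prodEquiv : MeasurePreserving prodEquiv volume volume :=
  (volume_preserving_finTwoArrow ℝ).comp (PiLp.volume_preserving_ofLp (Fin 2))

lemma volume_shear_le (a r c : ℝ) (S : Set ℝ) :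
    volume {x : E2 | (a < x 0 ∧ x 0 < a + r) ∧ x 1 - c * x 0 ∈ S} ≤
      ENNReal.ofReal r * volume S := by
  set S' := toMeasurable volume S
  have hS' : MeasurableSet S' := measurableSet_toMeasurable _ _
  set T : Set (ℝ × ℝ) := {x | (a < x.1 ∧ x.1 < a + r) ∧ x.2 - c * x.1 ∈ S'} with hT
  have hTm : MeasurableSet T := by
    have h1 : MeasurableSet {x : ℝ × ℝ | a < x.1 ∧ x.1 < a + r} :=
      (measurableSet_lt measurable_const measurable_fst).inter
        (measurableSet_lt measurable_fst measurable_const)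
    have h2 : Measurable fun x : ℝ × ℝ => x.2 - c * x.1 := by fun_prop
    exact h1.inter (h2 hS')
  have hle : {x : E2 | (a < x 0 ∧ x 0 < a + r) ∧ x 1 - c * x 0 ∈ S} ⊆ prodEquiv ⁻¹' T := by
    intro x hx
    exact ⟨hx.1, subset_toMeasurable _ _ hx.2⟩
  refine (measure_mono hle).trans ?_
  rw [volume_preserving_prodEquiv.measure_preimage hTm.nullMeasurableSet, Measure.volume_eq_prod,
    Measure.prod_apply hTm]
  calc ∫⁻ x, volume (Prod.mk x ⁻¹' T)
      ≤ ∫⁻ x, (Ioo a (a + r)).indicator (fun _ => volume S) x := by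
        refine lintegral_mono fun x => ?_
        by_cases hx : x ∈ Ioo a (a + r)
        · rw [indicator_of_mem hx]
          have : Prod.mk x ⁻¹' T ⊆ (fun y => y + (-(c * x))) ⁻¹' S' := by
            intro y hy
            simpa [sub_eq_add_neg] using hy.2
          refine (measure_mono this).trans ?_
          rw [measure_preimage_add_right]
          exact (measure_toMeasurable _).le
        · have : Prod.mk x ⁻¹' T = ∅ := by
            ext y
            simp only [mem_preimage, hT, mem_ofPred_eq, mem_empty_iff_false, iff_false]
            intro h
            exact hx h.1
          simp [this]
    _ = ENNReal.ofReal r * volume S := by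
        rw [lintegral_indicator measurableSet_Ioo, lintegral_const, Measure.restrict_apply
          MeasurableSet.univ, univ_inter, Real.volume_Ioo, mul_comm]
        congr 2; ring

lemma volume_rect_le (a r b t : ℝ) :
    volume {x : E2 | (a < x 0 ∧ x 0 < a + r) ∧ x 1 ∈ Icc b (b + t)} ≤
      ENNReal.ofReal r * ENNReal.ofReal t := by
  have := volume_shear_le a r 0 (Icc b (b + t))
  simpa using this

lemma volume_win (p : E2) {r : ℝ} (hr : 0 ≤ r) : volume (win p r) = ENNReal.ofReal (r ^ 2) := by
  have h : win p r = prodEquiv ⁻¹' (Ioo (p 0) (p 0 + r) ×ˢ Ioo (p 1) (p 1 + r)) := by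
    ext x
    simp [win, prodEquiv_apply, Fin.forall_fin_two]
  rw [h, volume_preserving_prodEquiv.measure_preimage
    (measurableSet_Ioo.prod measurableSet_Ioo).nullMeasurableSet, Measure.volume_eq_prod,
    Measure.prod_prod, Real.volume_Ioo, Real.volume_Ioo, ← ENNReal.ofReal_mul (by linarith)]
  congr 1; ring

lemma volume_cube (p : E2) {r : ℝ} (hr : 0 ≤ r) :
    volume (cube p r) = ENNReal.ofReal (4 * r ^ 2) := by
  have h : cube p r = prodEquiv ⁻¹' (Icc (p 0 - r) (p 0 + r) ×ˢ Icc (p 1 - r) (p 1 + r)) := by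
    ext x
    simp only [cube, mem_ofPred_eq, prodEquiv_apply, Fin.forall_fin_two, abs_le, mem_preimage,
      mem_prod, mem_Icc]
    constructor
    · rintro ⟨⟨_, _⟩, _, _⟩; refine ⟨⟨?_, ?_⟩, ?_, ?_⟩ <;> linarith
    · rintro ⟨⟨_, _⟩, _, _⟩; refine ⟨⟨?_, ?_⟩, ?_, ?_⟩ <;> linarith
  rw [h, volume_preserving_prodEquiv.measure_preimage
    (measurableSet_Icc.prod measurableSet_Icc).nullMeasurableSet, Measure.volume_eq_prod,
    Measure.prod_prod, Real.volume_Icc, Real.volume_Icc, ← ENNReal.ofReal_mul (by linarith)]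
  congr 1; ring

/-- A set of large measure contains two distant points. -/
lemma exists_dist_of_volume {T : Set E2} {d : ℝ} (hd : 0 < d)
    (hT : ENNReal.ofReal (4 * d ^ 2) < volume T) : ∃ x ∈ T, ∃ y ∈ T, d ≤ dist x y := by
  by_contra! hcon
  have hne : T.Nonempty := by
    by_contra h
    rw [not_nonempty_iff_eq_empty] at h
    simp [h] at hT
  obtain ⟨x, hx⟩ := hne
  have : T ⊆ cube x d := by
    intro y hy c
    have h1 := hcon y hy x hx
    rw [dist_eq_norm] at h1
    exact (abs_coord_le (y - x) c).trans h1.le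
  exact absurd (measure_mono this) (by rw [volume_cube x hd.le]; exact not_le.2 hT)

lemma volume_real_image_le {K : ℝ≥0} {f : E2 → ℝ} (hf : LipschitzWith K f) (S : Set E2) :
    volume (f '' S) ≤ K * μH[1] S := by
  have := hf.hausdorffMeasure_image_le (d := 1) zero_le_one S
  simpa [hausdorffMeasure_real] using this

end PiecewiseKorn

namespace PiecewiseKorn

/-- The Frobenius norm of the symmetric part of a linear map. -/
def eN (L : E2 →L[ℝ] E2) : ℝ :=
  matNorm fun i j => (L (EuclideanSpace.single j (1 : ℝ)) i +
    L (EuclideanSpace.single i (1 : ℝ)) j) / 2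

lemma eN_nonneg (L : E2 →L[ℝ] E2) : 0 ≤ eN L := Real.sqrt_nonneg _

lemma matNorm_sq (A : Matrix (Fin 2) (Fin 2) ℝ) :
    matNorm A ^ 2 = A 0 0 ^ 2 + A 0 1 ^ 2 + A 1 0 ^ 2 + A 1 1 ^ 2 := by
  rw [matNorm, Real.sq_sqrt (by positivity)]
  simp [Fin.sum_univ_two]; ring

lemma clm_apply (L : E2 →L[ℝ] E2) (h : E2) (i : Fin 2) :
    L h i = h 0 * L (EuclideanSpace.single 0 (1 : ℝ)) i +
      h 1 * L (EuclideanSpace.single 1 (1 : ℝ)) i := by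
  have : h = h 0 • EuclideanSpace.single 0 (1 : ℝ) + h 1 • EuclideanSpace.single 1 (1 : ℝ) := by
    ext j; fin_cases j <;> simp
  conv_lhs => rw [this]
  simp

lemma eN_sq (L : E2 →L[ℝ] E2) : eN L ^ 2 = L (EuclideanSpace.single 0 (1 : ℝ)) 0 ^ 2 +
    2 * ((L (EuclideanSpace.single 0 (1 : ℝ)) 1 + L (EuclideanSpace.single 1 (1 : ℝ)) 0) / 2) ^ 2 +
    L (EuclideanSpace.single 1 (1 : ℝ)) 1 ^ 2 := by
  refine (matNorm_sq _).trans ?_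
  ring

lemma abs_inner_le_eN (L : E2 →L[ℝ] E2) (h : E2) : |inner ℝ (L h) h| ≤ eN L * ‖h‖ ^ 2 := by
  have h1 : 0 ≤ eN L * ‖h‖ ^ 2 := mul_nonneg (eN_nonneg L) (sq_nonneg _)
  refine abs_le_of_sq_le_sq ?_ h1
  rw [mul_pow, eN_sq, norm_sq_eq, inner_eq, clm_apply L h 0, clm_apply L h 1]
  generalize L (EuclideanSpace.single 0 (1 : ℝ)) 0 = a
  generalize L (EuclideanSpace.single 0 (1 : ℝ)) 1 = b
  generalize L (EuclideanSpace.single 1 (1 : ℝ)) 0 = c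
  generalize L (EuclideanSpace.single 1 (1 : ℝ)) 1 = d
  generalize h 0 = x
  generalize h 1 = y
  have key : ∀ s : ℝ, (a * x ^ 2 + 2 * s * (x * y) + d * y ^ 2) ^ 2 ≤
      (a ^ 2 + 2 * s ^ 2 + d ^ 2) * (x ^ 2 + y ^ 2) ^ 2 := by
    intro s
    nlinarith [sq_nonneg (a * y ^ 2 - d * x ^ 2), sq_nonneg (a * (x * y) - s * x ^ 2),
      sq_nonneg (s * y ^ 2 - d * (x * y))]
  calc _ = (a * x ^ 2 + 2 * ((b + c) / 2) * (x * y) + d * y ^ 2) ^ 2 := by ring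
    _ ≤ _ := key ((b + c) / 2)

/-- The squared symmetrized gradient. -/
def gE (u : E2 → E2) (x : E2) : ℝ≥0∞ := ENNReal.ofReal (eN (fderiv ℝ u x) ^ 2)

open Classical in
/-- The squared symmetrized gradient, infinite at points of non-differentiability. -/
def gD (u : E2 → E2) (x : E2) : ℝ≥0∞ := if DifferentiableAt ℝ u x then gE u x else ⊤

lemma measurable_mgrad (u : E2 → E2) (i j : Fin 2) : Measurable fun x => mgrad u x i j := by
  have h : Measurable (fderiv ℝ u) := measurable_fderiv ℝ u
  have : Measurable fun x => fderiv ℝ u x (EuclideanSpace.single j (1 : ℝ)) :=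
    (ContinuousLinearMap.measurable_apply _).comp h
  exact (continuous_coord i).measurable.comp this

lemma measurable_eN (u : E2 → E2) : Measurable fun x => eN (fderiv ℝ u x) := by
  have h : ∀ i j, Measurable fun x => (mgrad u x i j + mgrad u x j i) / 2 := fun i j =>
    ((measurable_mgrad u i j).add (measurable_mgrad u j i)).div_const 2
  unfold eN matNorm
  refine Real.continuous_sqrt.measurable.comp ?_
  exact Finset.measurable_sum _ fun i _ => Finset.measurable_sum _ fun j _ => (h i j).pow_const 2

lemma measurable_gE (u : E2 → E2) : Measurable (gE u) :=
  ((measurable_eN u).pow_const 2).ennreal_ofReal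

lemma measurable_gD (u : E2 → E2) : Measurable (gD u) :=
  Measurable.ite (measurableSet_of_differentiableAt ℝ u) (measurable_gE u) measurable_const

/-- The energy along the segment from `p` to `p + h`. -/
def segE (u : E2 → E2) (z : E2 × E2) : ℝ≥0∞ := ∫⁻ t in Ioc (0 : ℝ) 1, gD u (z.1 + t • z.2)

lemma measurable_segE (u : E2 → E2) : Measurable (segE u) := by
  have : Measurable fun w : (E2 × E2) × ℝ => gD u (w.1.1 + w.2 • w.1.2) :=
    (measurable_gD u).comp (by fun_prop)
  exact this.lintegral_prod_right'

/-- Local Lipschitz continuity at a point. -/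
def LipAt (u : E2 → E2) (x : E2) : Prop := ∃ t ∈ nhds x, ∃ L : ℝ≥0, LipschitzOnWith L u t

lemma abs_le_mul_sqrt {y A T : ℝ} (hA : 0 ≤ A) (hT : 0 ≤ T)
    (h : ∀ l : ℝ, 0 < l → y ≤ A * (T / l + l) / 2) : y ≤ A * √T := by
  rcases hT.eq_or_lt with rfl | hT
  · simp only [Real.sqrt_zero, mul_zero]
    refine le_of_forall_pos_le_add fun e he => ?_
    have := h (e / (A + 1)) (by positivity)
    have h2 : A * (e / (A + 1)) ≤ e := by
      rw [mul_div_assoc', div_le_iff₀ (by positivity)]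
      nlinarith
    simp only [zero_div, zero_add] at this
    linarith
  · have := h (√T) (Real.sqrt_pos.2 hT)
    rw [Real.div_sqrt] at this
    linarith

lemma inner_sub_le_of_segE {u : E2 → E2} {p h : E2}
    (hlip : ∀ t ∈ Icc (0 : ℝ) 1, LipAt u (p + t • h)) {T : ℝ} (hT : 0 ≤ T)
    (hseg : segE u (p, h) ≤ ENNReal.ofReal T) :
    |inner ℝ (u (p + h) - u p) h| ≤ ‖h‖ ^ 2 * √T := by
  set φ : ℝ → ℝ := fun t => inner ℝ (u (p + t • h)) h with hφ
  have hloc : LocallyLipschitzOn (Icc (0 : ℝ) 1) φ := by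
    intro t ht
    obtain ⟨s, hs, L, hL⟩ := hlip t ht
    have hcont : Continuous fun t : ℝ => p + t • h := by fun_prop
    refine ⟨‖h‖₊ * (L * ‖h‖₊), (fun t : ℝ => p + t • h) ⁻¹' s,
      mem_nhdsWithin_of_mem_nhds (hcont.continuousAt.preimage_mem_nhds hs), ?_⟩
    refine LipschitzOnWith.of_dist_le_mul fun a ha b hb => ?_
    rw [Real.dist_eq, hφ]
    simp only
    rw [← inner_sub_left]
    have h1 := hL.dist_le_mul _ ha _ hb
    have h2 : dist (p + a • h) (p + b • h) = dist a b * ‖h‖ := by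
      rw [dist_add_left, dist_eq_norm, ← sub_smul, norm_smul, ← dist_eq_norm]
    rw [h2, dist_eq_norm] at h1
    refine (abs_real_inner_le_norm _ _).trans ?_
    simp only [NNReal.coe_mul, coe_nnnorm]
    nlinarith [norm_nonneg h]
  obtain ⟨K, hK⟩ := hloc.exists_lipschitzOnWith_of_compact isCompact_Icc
  have hac : AbsolutelyContinuousOnInterval φ 0 1 := by
    apply LipschitzOnWith.absolutelyContinuousOnInterval (K := K)
    rwa [uIcc_of_le zero_le_one]
  have hint := hac.integral_deriv_eq_sub
  have hval : φ 1 - φ 0 = inner ℝ (u (p + h) - u p) h := by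
    simp [hφ, inner_sub_left]
  rw [← hval]
  refine abs_le_mul_sqrt (sq_nonneg _) hT fun l hl => ?_
  have hfin : ∀ᵐ t ∂volume.restrict (Ioc (0 : ℝ) 1), gD u (p + t • h) < ⊤ := by
    refine ae_lt_top ((measurable_gD u).comp (by fun_prop)) ?_
    exact (hseg.trans_lt ENNReal.ofReal_lt_top).ne
  have hb : ENNReal.ofReal |φ 1 - φ 0| ≤ ENNReal.ofReal (‖h‖ ^ 2 * (T / l + l) / 2) := by
    rw [← hint, intervalIntegral.integral_of_le zero_le_one, ← Real.norm_eq_abs,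
      ofReal_norm]
    refine (enorm_integral_le_lintegral_enorm _).trans ?_
    have hpt : ∀ᵐ t ∂volume.restrict (Ioc (0 : ℝ) 1), ‖deriv φ t‖ₑ ≤
        ENNReal.ofReal (‖h‖ ^ 2 / (2 * l)) * gD u (p + t • h) +
          ENNReal.ofReal (‖h‖ ^ 2 * l / 2) := by
      filter_upwards [hfin] with t ht
      have hd : DifferentiableAt ℝ u (p + t • h) := by
        by_contra hcon
        simp [gD, hcon] at ht
      have hline : HasDerivAt (fun t : ℝ => p + t • h) h t := by
        simpa using ((hasDerivAt_id t).smul_const h).const_add p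
      have hder : HasDerivAt φ (inner ℝ (fderiv ℝ u (p + t • h) h) h) t := by
        have h1 := hd.hasFDerivAt.comp_hasDerivAt t hline
        simpa using h1.inner ℝ (hasDerivAt_const t h)
      rw [hder.deriv, ← ofReal_norm, Real.norm_eq_abs]
      simp only [gD, if_pos hd, gE]
      rw [← ENNReal.ofReal_mul (by positivity), ← ENNReal.ofReal_add (by positivity)
        (by positivity)]
      refine ENNReal.ofReal_le_ofReal ((abs_inner_le_eN _ _).trans ?_)
      set e := eN (fderiv ℝ u (p + t • h))
      have : e ≤ (e ^ 2 / l + l) / 2 := by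
        rw [le_div_iff₀ two_pos, ← sub_le_iff_le_add, le_div_iff₀ hl]
        nlinarith [sq_nonneg (e - l)]
      calc e * ‖h‖ ^ 2 ≤ (e ^ 2 / l + l) / 2 * ‖h‖ ^ 2 := by gcongr
        _ = _ := by field_simp
    refine (lintegral_mono_ae hpt).trans ?_
    rw [lintegral_add_right _ measurable_const, lintegral_const_mul' _ _ ENNReal.ofReal_ne_top,
      lintegral_const, Measure.restrict_apply MeasurableSet.univ, univ_inter, Real.volume_Ioc]
    simp only [sub_zero, ENNReal.ofReal_one, mul_one]
    calc _ ≤ ENNReal.ofReal (‖h‖ ^ 2 / (2 * l)) * ENNReal.ofReal T +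
          ENNReal.ofReal (‖h‖ ^ 2 * l / 2) := by gcongr; exact hseg
      _ = _ := by
        rw [← ENNReal.ofReal_mul (by positivity), ← ENNReal.ofReal_add (by positivity)
          (by positivity)]
        congr 1
        field_simp
  exact (ENNReal.ofReal_le_ofReal_iff (by positivity)).1 hb

end PiecewiseKorn

namespace PiecewiseKorn

lemma ae_differentiableAt_of_lipAt {u : E2 → E2} {S : Set E2} (h : ∀ x ∈ S, LipAt u x) :
    ∀ᵐ x, x ∈ S → DifferentiableAt ℝ u x := by
  rw [ae_iff]
  simp only [Classical.not_imp]
  refine measure_null_of_locally_null _ fun x hx => ?_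
  obtain ⟨t, ht, L, hL⟩ := h x hx.1
  obtain ⟨o, hot, ho, hxo⟩ := mem_nhds_iff.1 ht
  refine ⟨{x | x ∈ S ∧ ¬ DifferentiableAt ℝ u x} ∩ o,
    Filter.inter_mem self_mem_nhdsWithin (mem_nhdsWithin_of_mem_nhds (ho.mem_nhds hxo)), ?_⟩
  have h2 := (hL.mono hot).ae_differentiableWithinAt_of_mem (μ := volume)
  rw [ae_iff] at h2
  refine measure_mono_null ?_ h2
  rintro y ⟨hy, hyo⟩ hcon
  exact hy.2 ((hcon hyo).differentiableAt (ho.mem_nhds hyo))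

/-- The energy of `u` on `S`. -/
def En (u : E2 → E2) (S : Set E2) : ℝ≥0∞ := ∫⁻ x in S, gE u x

lemma lintegral_gD {u : E2 → E2} {S : Set E2} (hS : MeasurableSet S)
    (h : ∀ᵐ x, x ∈ S → DifferentiableAt ℝ u x) : ∫⁻ x in S, gD u x = En u S := by
  refine setLIntegral_congr_fun_ae hS ?_
  filter_upwards [h] with x hx hxS
  rw [gD, if_pos (hx hxS)]

/-- Pairs of points of a window for which the segment joining them crosses `Γ` or carries too
much energy. -/
def badPair (u : E2 → E2) (Γ q : Set E2) (m : ℝ) (T : ℝ≥0∞) : Set (E2 × E2) :=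
  {z | z.1 ∈ q ∧ z.2 ∈ q ∧ m ≤ |z.2 0 - z.1 0| ∧
    ((∃ t ∈ Icc (0 : ℝ) 1, z.1 + t • (z.2 - z.1) ∈ Γ) ∨ T < segE u (z.1, z.2 - z.1))}

/-- The same set in terms of a point and a displacement. -/
def badDisp (u : E2 → E2) (Γ q : Set E2) (m : ℝ) (T : ℝ≥0∞) : Set (E2 × E2) :=
  {z | z.1 ∈ q ∧ z.1 + z.2 ∈ q ∧ m ≤ |z.2 0| ∧
    ((∃ t ∈ Icc (0 : ℝ) 1, z.1 + t • z.2 ∈ Γ) ∨ T < segE u z)}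

lemma isClosed_hit {Γ : Set E2} (hΓ : IsClosed Γ) :
    IsClosed {z : E2 × E2 | ∃ t ∈ Icc (0 : ℝ) 1, z.1 + t • z.2 ∈ Γ} := by
  have h1 : IsClosed {w : (Icc (0 : ℝ) 1) × (E2 × E2) | w.2.1 + (w.1 : ℝ) • w.2.2 ∈ Γ} :=
    hΓ.preimage (by fun_prop)
  have h2 := isClosedMap_snd_of_compactSpace _ h1
  convert h2 using 1
  ext z
  simp only [mem_ofPred_eq, mem_image, Prod.exists, Subtype.exists]
  constructor
  · rintro ⟨t, ht, h⟩
    exact ⟨t, ht, z.1, z.2, h, rfl⟩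
  · rintro ⟨t, ht, a, b, h, rfl⟩
    exact ⟨t, ht, h⟩

lemma measurableSet_badDisp (u : E2 → E2) {Γ : Set E2} (hΓ : IsClosed Γ) {q : Set E2}
    (hq : MeasurableSet q) (m : ℝ) (T : ℝ≥0∞) : MeasurableSet (badDisp u Γ q m T) := by
  have h1 : MeasurableSet {z : E2 × E2 | z.1 ∈ q} := measurable_fst hq
  have h2 : MeasurableSet {z : E2 × E2 | z.1 + z.2 ∈ q} :=
    (measurable_fst.add measurable_snd) hq
  have h3 : MeasurableSet {z : E2 × E2 | m ≤ |z.2 0|} :=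
    (isClosed_le continuous_const (by fun_prop)).measurableSet
  have h4 := (isClosed_hit hΓ).measurableSet
  have h5 : MeasurableSet {z : E2 × E2 | T < segE u z} :=
    measurableSet_lt measurable_const (measurable_segE u)
  exact h1.inter (h2.inter (h3.inter (h4.union h5)))

lemma measurableSet_badPair (u : E2 → E2) {Γ : Set E2} (hΓ : IsClosed Γ) {q : Set E2}
    (hq : MeasurableSet q) (m : ℝ) (T : ℝ≥0∞) : MeasurableSet (badPair u Γ q m T) := by
  have : badPair u Γ q m T = (fun z : E2 × E2 => (z.1, z.2 - z.1)) ⁻¹' badDisp u Γ q m T := by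
    ext z; simp [badPair, badDisp]
  rw [this]
  exact (measurable_fst.prodMk (measurable_snd.sub measurable_fst))
    (measurableSet_badDisp u hΓ hq m T)

lemma volume_hit_le {Γ : Set E2} {p : E2} {r κ H : ℝ} (hr : 0 < r) (hκ : 0 < κ)
    (hH : μH[1] (Γ ∩ win p r) ≤ ENNReal.ofReal H) {h : E2} (h0 : κ * r ≤ |h 0|)
    (h1 : |h 1| ≤ r) :
    volume {x : E2 | x ∈ win p r ∧ x + h ∈ win p r ∧ ∃ t ∈ Icc (0 : ℝ) 1, x + t • h ∈ Γ} ≤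
      ENNReal.ofReal (r * ((1 + 1 / κ) * H)) := by
  set c := h 1 / h 0 with hc
  have hh0 : 0 < |h 0| := (mul_pos hκ hr).trans_le h0
  have hc' : |c| ≤ 1 / κ := by
    rw [hc, abs_div, div_le_div_iff₀ hh0 hκ]
    nlinarith
  set f : E2 → ℝ := fun x => x 1 - c * x 0 with hf
  have hlip : LipschitzWith (Real.toNNReal (1 + 1 / κ)) f := by
    refine LipschitzWith.of_dist_le_mul fun x y => ?_
    rw [Real.coe_toNNReal _ (by positivity), Real.dist_eq, dist_eq_norm]
    have e : f x - f y = (x - y) 1 - c * (x - y) 0 := by simp [hf]; ring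
    rw [e]
    have a1 := abs_coord_le (x - y) 0
    have a2 := abs_coord_le (x - y) 1
    calc |(x - y) 1 - c * (x - y) 0| ≤ |(x - y) 1| + |c| * |(x - y) 0| := by
          rw [← abs_mul]; exact abs_sub _ _
      _ ≤ ‖x - y‖ + 1 / κ * ‖x - y‖ := by gcongr
      _ = _ := by ring
  have hsub : {x : E2 | x ∈ win p r ∧ x + h ∈ win p r ∧ ∃ t ∈ Icc (0 : ℝ) 1, x + t • h ∈ Γ} ⊆
      {x : E2 | (p 0 < x 0 ∧ x 0 < p 0 + r) ∧ x 1 - c * x 0 ∈ f '' (Γ ∩ win p r)} := by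
    rintro x ⟨hx, hxh, t, ht, hΓ⟩
    refine ⟨hx 0, x + t • h, ⟨hΓ, ?_⟩, ?_⟩
    · have e : x + t • h = (1 - t) • x + t • (x + h) := by
        rw [smul_add, ← add_assoc, ← add_smul]; simp
      rw [e]
      exact convex_win p r hx hxh (by linarith [ht.2]) ht.1 (by ring)
    · have : h 0 ≠ 0 := abs_pos.1 hh0
      simp only [hf, hc, PiLp.add_apply, PiLp.smul_apply, smul_eq_mul]
      field_simp
      ring
  refine (measure_mono hsub).trans ((volume_shear_le _ _ _ _).trans ?_)
  rw [ENNReal.ofReal_mul hr.le, ENNReal.ofReal_mul (by positivity)]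
  gcongr
  refine (volume_real_image_le hlip _).trans ?_
  rw [ENNReal.ofReal]
  gcongr

lemma lintegral_segE_le (u : E2 → E2) {q : Set E2} (hq : MeasurableSet q) (hconv : Convex ℝ q)
    (h : E2) :
    ∫⁻ x in q ∩ {x | x + h ∈ q}, segE u (x, h) ≤ ∫⁻ x in q, gD u x := by
  set S := q ∩ {x | x + h ∈ q} with hS
  have hSm : MeasurableSet S := hq.inter ((measurable_id.add_const h) hq)
  have hm : Measurable fun w : E2 × ℝ => gD u (w.1 + w.2 • h) :=
    (measurable_gD u).comp (by fun_prop)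
  simp only [segE]
  rw [lintegral_lintegral_swap hm.aemeasurable]
  calc ∫⁻ t in Ioc (0 : ℝ) 1, ∫⁻ x in S, gD u (x + t • h)
      ≤ ∫⁻ t in Ioc (0 : ℝ) 1, ∫⁻ x in q, gD u x := by
        refine setLIntegral_mono measurable_const fun t ht => ?_
        rw [← lintegral_indicator hSm, ← lintegral_indicator hq,
          ← lintegral_add_right_eq_self (μ := volume) (fun x => q.indicator (gD u) x) (t • h)]
        refine lintegral_mono fun x => ?_
        by_cases hx : x ∈ S
        · have e : x + t • h = (1 - t) • x + t • (x + h) := by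
            rw [smul_add, ← add_assoc, ← add_smul]; simp
          have : x + t • h ∈ q := by
            rw [e]
            exact hconv hx.1 hx.2 (by linarith [ht.2]) ht.1.le (by ring)
          rw [indicator_of_mem hx, indicator_of_mem this]
        · rw [indicator_of_notMem hx]; exact zero_le
    _ = ∫⁻ x in q, gD u x := by
        rw [lintegral_const, Measure.restrict_apply MeasurableSet.univ, univ_inter,
          Real.volume_Ioc]
        simp

lemma measure_gt_mul_le {α : Type*} [MeasurableSpace α] {ν : Measure α} {f : α → ℝ≥0∞}
    (hf : Measurable f) {G : ℝ≥0∞} (hG : ∫⁻ x, f x ∂ν ≤ G) {l : ℝ} (hl : 0 < l) :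
    ν {x | ENNReal.ofReal l * G < f x} ≤ ENNReal.ofReal (1 / l) := by
  rcases eq_or_ne G 0 with rfl | hG0
  · have h0 : ∫⁻ x, f x ∂ν = 0 := le_antisymm hG zero_le
    rw [lintegral_eq_zero_iff hf] at h0
    have : ν {x | ENNReal.ofReal l * 0 < f x} = 0 := by
      rw [mul_zero]
      have := ae_iff.1 h0
      refine measure_mono_null (fun x hx => ?_) this
      exact (ne_of_gt hx)
    rw [this]; exact zero_le
  rcases eq_or_ne G ⊤ with rfl | hGt
  · have : {x | ENNReal.ofReal l * ⊤ < f x} = ∅ := by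
      rw [ENNReal.mul_top (by simpa using hl)]
      ext; simp
    rw [this]; simp
  have hl0 : ENNReal.ofReal l ≠ 0 := by simpa using hl
  have hne : ENNReal.ofReal l * G ≠ 0 := mul_ne_zero hl0 hG0
  have hnt : ENNReal.ofReal l * G ≠ ⊤ := ENNReal.mul_ne_top ENNReal.ofReal_ne_top hGt
  calc ν {x | ENNReal.ofReal l * G < f x} ≤ ν {x | ENNReal.ofReal l * G ≤ f x} :=
        measure_mono fun x hx => by
          simp only [mem_ofPred_eq] at hx ⊢
          exact hx.le
    _ ≤ (∫⁻ x, f x ∂ν) / (ENNReal.ofReal l * G) :=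
        meas_ge_le_lintegral_div hf.aemeasurable hne hnt
    _ ≤ G / (ENNReal.ofReal l * G) := by gcongr
    _ = ENNReal.ofReal (1 / l) := by
        rw [ENNReal.ofReal_div_of_pos hl, ENNReal.ofReal_one]
        rw [ENNReal.div_eq_div_iff hl0 ENNReal.ofReal_ne_top hne hnt]
        simp

lemma volume_badPair_le {u : E2 → E2} {Γ : Set E2} (hΓ : IsClosed Γ) {p : E2} {r κ H l : ℝ}
    (hr : 0 < r) (hκ : 0 < κ) (hl : 0 < l) (hH : μH[1] (Γ ∩ win p r) ≤ ENNReal.ofReal H)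
    (hd : ∀ᵐ x, x ∈ win p r → DifferentiableAt ℝ u x) :
    volume (badPair u Γ (win p r) (κ * r) (ENNReal.ofReal l * En u (win p r))) ≤
      ENNReal.ofReal (r * ((1 + 1 / κ) * max H 0) + 1 / l) * ENNReal.ofReal (4 * r ^ 2) := by
  have hq : MeasurableSet (win p r) := (isOpen_win p r).measurableSet
  set T := ENNReal.ofReal l * En u (win p r) with hT
  have hBm := measurableSet_badDisp u hΓ hq (κ * r) T
  have hH' : μH[1] (Γ ∩ win p r) ≤ ENNReal.ofReal (max H 0) :=
    hH.trans (ENNReal.ofReal_le_ofReal (le_max_left _ _))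
  have e : badPair u Γ (win p r) (κ * r) T =
      (fun z : E2 × E2 => (z.1, z.2 - z.1)) ⁻¹' badDisp u Γ (win p r) (κ * r) T := by
    ext z; simp [badPair, badDisp]
  rw [e, Measure.volume_eq_prod,
    (measurePreserving_prod_sub (volume : Measure E2) (volume : Measure E2)).measure_preimage
      hBm.nullMeasurableSet, Measure.prod_apply_symm hBm]
  have hsec : ∀ h : E2, volume ((fun x => (x, h)) ⁻¹' badDisp u Γ (win p r) (κ * r) T) ≤
      (cube 0 r).indicator
        (fun _ => ENNReal.ofReal (r * ((1 + 1 / κ) * max H 0) + 1 / l)) h := by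
    intro h
    rcases (((fun x => (x, h)) ⁻¹' badDisp u Γ (win p r) (κ * r) T)).eq_empty_or_nonempty with
      hemp | ⟨x, hx⟩
    · rw [hemp]; simp
    have hc : h ∈ cube 0 r := by
      intro c
      have h1 := hx.1 c
      have h2 := hx.2.1 c
      simp only [PiLp.add_apply] at h2
      simp only [PiLp.zero_apply, sub_zero]
      rw [abs_le]
      constructor <;> linarith
    rw [indicator_of_mem hc]
    have h0 : κ * r ≤ |h 0| := hx.2.2.1
    have h1 : |h 1| ≤ r := by simpa using hc 1
    rw [ENNReal.ofReal_add (by positivity) (by positivity)]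
    have hsub : (fun x => (x, h)) ⁻¹' badDisp u Γ (win p r) (κ * r) T ⊆
        {x : E2 | x ∈ win p r ∧ x + h ∈ win p r ∧ ∃ t ∈ Icc (0 : ℝ) 1, x + t • h ∈ Γ} ∪
        ({x | T < segE u (x, h)} ∩ (win p r ∩ {x | x + h ∈ win p r})) := by
      rintro y ⟨hy1, hy2, -, hy3 | hy3⟩
      · exact Or.inl ⟨hy1, hy2, hy3⟩
      · exact Or.inr ⟨hy3, hy1, hy2⟩
    refine (measure_mono hsub).trans ((measure_union_le _ _).trans ?_)
    refine add_le_add (volume_hit_le hr hκ hH' h0 h1) ?_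
    have hmeas : Measurable fun x => segE u (x, h) :=
      (measurable_segE u).comp (measurable_id.prodMk measurable_const)
    have hset : MeasurableSet {x | T < segE u (x, h)} := measurableSet_lt measurable_const hmeas
    rw [← Measure.restrict_apply hset]
    refine measure_gt_mul_le hmeas ?_ hl
    refine (lintegral_segE_le u hq (convex_win p r) h).trans ?_
    rw [lintegral_gD hq hd]
  refine (lintegral_mono hsec).trans ?_
  rw [lintegral_indicator (isClosed_cube _ _).measurableSet, lintegral_const,
    Measure.restrict_apply MeasurableSet.univ, univ_inter, volume_cube _ hr.le]

end PiecewiseKorn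

namespace PiecewiseKorn

lemma inner_le_of_notMem_badPair {u : E2 → E2} {Γ : Set E2} {p : E2} {r m T : ℝ}
    (hlip : ∀ x ∈ win p r \ Γ, LipAt u x) (hT : 0 ≤ T) {x y : E2} (hx : x ∈ win p r)
    (hy : y ∈ win p r) (hm : m ≤ |y 0 - x 0|)
    (hb : (x, y) ∉ badPair u Γ (win p r) m (ENNReal.ofReal T)) :
    |inner ℝ (u y - u x) (y - x)| ≤ ‖y - x‖ ^ 2 * √T := by
  have h : ¬ ((∃ t ∈ Icc (0 : ℝ) 1, x + t • (y - x) ∈ Γ) ∨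
      ENNReal.ofReal T < segE u (x, y - x)) := fun h => hb ⟨hx, hy, hm, h⟩
  push Not at h
  have := inner_sub_le_of_segE (u := u) (p := x) (h := y - x) (fun t ht => hlip _ ⟨?_, h.1 t ht⟩)
    hT h.2
  · simpa using this
  · have e : x + t • (y - x) = (1 - t) • x + t • y := by
      rw [smul_sub, sub_smul, one_smul]; abel
    rw [e]
    exact convex_win p r hx hy (by linarith [ht.2]) ht.1 (by ring)

/-- The admissible relative length of the jump set in the weak Korn inequality. -/
def etaW : ℝ := 1 / 10 ^ 9

/-- The constant of the weak Korn inequality. -/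
def cW : ℝ := 10 ^ 8

lemma norm_le_of_inner_le {w d e : E2} {r s : ℝ} (hr : 0 < r) (hs : 0 ≤ s)
    (hd : ‖d‖ ≤ 2 * r) (he : ‖e‖ ≤ 2 * r) (hwd : |inner ℝ w d| ≤ 12 * r ^ 2 * s)
    (hwe : |inner ℝ w e| ≤ 4 * r ^ 2 * s) (hdet : r ^ 2 / 1000 ≤ |d 0 * e 1 - d 1 * e 0|) :
    ‖w‖ ≤ 10 ^ 5 * r * s := by
  set D := d 0 * e 1 - d 1 * e 0 with hD
  have hcoord : ∀ c, |w c| ≤ 32000 * r * s := by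
    intro c
    have d0 := (abs_coord_le d 0).trans hd
    have d1 := (abs_coord_le d 1).trans hd
    have e0 := (abs_coord_le e 0).trans he
    have e1 := (abs_coord_le e 1).trans he
    have key : |w c| * |D| ≤ 32 * r ^ 3 * s := by
      rw [← abs_mul]
      have hc : ∃ α β : ℝ, |α| ≤ 2 * r ∧ |β| ≤ 2 * r ∧
          w c * D = inner ℝ w d * α - inner ℝ w e * β := by
        rw [inner_eq, inner_eq, hD]
        fin_cases c
        · exact ⟨e 1, d 1, e1, d1, by simp; ring⟩
        · exact ⟨-e 0, -d 0, by rwa [abs_neg], by rwa [abs_neg], by simp; ring⟩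
      obtain ⟨α, β, hα, hβ, h⟩ := hc
      rw [h]
      calc |inner ℝ w d * α - inner ℝ w e * β| ≤ |inner ℝ w d| * |α| + |inner ℝ w e| * |β| := by
            rw [← abs_mul, ← abs_mul]; exact abs_sub _ _
        _ ≤ 12 * r ^ 2 * s * (2 * r) + 4 * r ^ 2 * s * (2 * r) := by gcongr
        _ = _ := by ring
    have h2 : |w c| * (r ^ 2 / 1000) ≤ 32 * r ^ 3 * s :=
      (mul_le_mul_of_nonneg_left hdet (abs_nonneg _)).trans key
    have hr2 : 0 < r ^ 2 := by positivity
    have h3 : |w c| * r ^ 2 ≤ (32000 * r * s) * r ^ 2 := by nlinarith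
    exact le_of_mul_le_mul_right h3 hr2
  have := norm_le_coord w hcoord
  have h0 : 0 ≤ r * s := by positivity
  nlinarith

lemma norm_mul_norm_sq (w d : E2) :
    ‖w‖ ^ 2 * ‖d‖ ^ 2 = inner ℝ w d ^ 2 + inner ℝ w (rot d) ^ 2 := by
  rw [norm_sq_eq, norm_sq_eq, inner_eq, inner_eq]; simp; ring

lemma measure_section_gt_le {B : Set (E2 × E2)} (hB : MeasurableSet B) {b m : ℝ} (hm : 0 < m)
    (hvol : volume B ≤ ENNReal.ofReal b) :
    volume {x : E2 | ENNReal.ofReal m ≤ volume (Prod.mk x ⁻¹' B)} ≤ ENNReal.ofReal (b / m) := by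
  have hm0 : ENNReal.ofReal m ≠ 0 := by simpa using hm
  refine (meas_ge_le_lintegral_div (measurable_measure_prodMk_left hB).aemeasurable hm0
    ENNReal.ofReal_ne_top).trans ?_
  rw [← Measure.prod_apply hB, ← Measure.volume_eq_prod, ENNReal.ofReal_div_of_pos hm]
  gcongr

set_option maxHeartbeats 1000000 in
theorem weak_korn {u : E2 → E2} {Γ : Set E2} {p : E2} {r : ℝ} (hr : 0 < r) (hΓ : IsClosed Γ)
    (hΓ0 : volume Γ = 0) (hlip : ∀ x ∈ win p r \ Γ, LipAt u x)
    (hH : μH[1] (Γ ∩ win p r) ≤ ENNReal.ofReal (etaW * r)) (hG : En u (win p r) ≠ ⊤) :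
    ∃ a : ℝ × E2, volume {x | x ∈ win p r ∧ cW * √(En u (win p r)).toReal < ‖u x - rg a x‖} ≤
      ENNReal.ofReal (r ^ 2 / 100) := by
  have hq : MeasurableSet (win p r) := (isOpen_win p r).measurableSet
  set G := (En u (win p r)).toReal with hGdef
  have hG0 : 0 ≤ G := ENNReal.toReal_nonneg
  have hGe : En u (win p r) = ENNReal.ofReal G := (ENNReal.ofReal_toReal hG).symm
  have hd : ∀ᵐ x, x ∈ win p r → DifferentiableAt ℝ u x := by
    have h1 := ae_differentiableAt_of_lipAt hlip
    have h2 : ∀ᵐ x, x ∉ Γ := measure_eq_zero_iff_ae_notMem.1 hΓ0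
    filter_upwards [h1, h2] with x hx1 hx2 hx
    exact hx1 ⟨hx, hx2⟩
  set l : ℝ := 10 ^ 6 / r ^ 2 with hl
  have hlpos : 0 < l := by positivity
  set T : ℝ := l * G with hT
  have hTnn : 0 ≤ T := by positivity
  set B := badPair u Γ (win p r) (1 / 1000 * r) (ENNReal.ofReal T) with hB
  have hBm : MeasurableSet B := measurableSet_badPair u hΓ hq _ _
  have hBv : volume B ≤ ENNReal.ofReal (r ^ 4 / 10 ^ 5) := by
    have h := volume_badPair_le (κ := 1 / 1000) hΓ hr (by norm_num) hlpos hH hd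
    rw [hGe, ← ENNReal.ofReal_mul hlpos.le] at h
    refine h.trans ?_
    rw [← ENNReal.ofReal_mul' (by positivity)]
    refine ENNReal.ofReal_le_ofReal ?_
    have e1 : max (etaW * r) 0 = etaW * r := max_eq_left (by rw [etaW]; positivity)
    have e2 : 1 / l = r ^ 2 / 10 ^ 6 := by rw [hl]; field_simp
    rw [e1, e2, etaW]
    have : 0 < r ^ 4 := by positivity
    ring_nf
    nlinarith
  set Z : Set E2 := {x | ENNReal.ofReal (r ^ 2 / 1000) ≤ volume (Prod.mk x ⁻¹' B)} with hZ
  have hZv : volume Z ≤ ENNReal.ofReal (r ^ 2 / 100) := by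
    have := measure_section_gt_le hBm (show 0 < r ^ 2 / 1000 by positivity) hBv
    refine this.trans (ENNReal.ofReal_le_ofReal ?_)
    rw [div_le_iff₀ (by positivity)]
    apply le_of_eq; ring
  have hZsec : ∀ x ∉ Z, volume (Prod.mk x ⁻¹' B) ≤ ENNReal.ofReal (r ^ 2 / 1000) := by
    intro x hx
    simp only [hZ, mem_ofPred_eq, not_le] at hx
    exact hx.le
  have hr4 : (0 : ℝ) ≤ r / 4 := by positivity
  obtain ⟨p₁, hp₁, hp₁Z⟩ : ∃ x ∈ win p (r / 4), x ∉ Z := by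
    by_contra! hcon
    have := (measure_mono (μ := volume) hcon).trans hZv
    rw [volume_win p hr4, ENNReal.ofReal_le_ofReal_iff (by positivity)] at this
    nlinarith [sq_nonneg r, pow_pos hr 2]
  set p' : E2 := p + !₂[3 * r / 4, 0] with hp'
  obtain ⟨p₂, hp₂, hp₂Z⟩ : ∃ x ∈ win p' (r / 4), x ∉ Z ∪ Prod.mk p₁ ⁻¹' B := by
    by_contra! hcon
    have h1 := (measure_mono (μ := volume) hcon).trans
      ((measure_union_le _ _).trans (add_le_add hZv (hZsec _ hp₁Z)))
    rw [volume_win p' hr4, ← ENNReal.ofReal_add (by positivity) (by positivity),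
      ENNReal.ofReal_le_ofReal_iff (by positivity)] at h1
    nlinarith [sq_nonneg r, pow_pos hr 2]
  have hp₂Z' : p₂ ∉ Z := fun h => hp₂Z (Or.inl h)
  have hp₁₂ : (p₁, p₂) ∉ B := fun h => hp₂Z (Or.inr h)
  have h10 := hp₁ 0
  have h11 := hp₁ 1
  have h20 := hp₂ 0
  have h21 := hp₂ 1
  simp only [hp', PiLp.add_apply, Matrix.cons_val_zero, Matrix.cons_val_one,
    add_zero] at h20 h21
  have hp₁q : p₁ ∈ win p r := by
    rw [win, mem_ofPred_eq, Fin.forall_fin_two]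
    refine ⟨⟨?_, ?_⟩, ?_, ?_⟩ <;> linarith
  have hp₂q : p₂ ∈ win p r := by
    rw [win, mem_ofPred_eq, Fin.forall_fin_two]
    refine ⟨⟨?_, ?_⟩, ?_, ?_⟩ <;> linarith
  have hdiff : ∀ x ∈ win p r, ∀ y ∈ win p r, ‖x - y‖ ≤ 2 * r := by
    intro x hx y hy
    refine norm_le_coord _ fun c => ?_
    have := hx c
    have := hy c
    rw [PiLp.sub_apply, abs_le]
    constructor <;> linarith
  set d := p₂ - p₁ with hddef
  have hd0 : r / 2 ≤ d 0 := by
    simp only [hddef, PiLp.sub_apply]; linarith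
  have hd0' : 0 < d 0 := by linarith
  have hd1 : |d 1| ≤ r / 4 := by
    simp only [hddef, PiLp.sub_apply]; rw [abs_le]; constructor <;> linarith
  have hdn : ‖d‖ ≤ 2 * r := hdiff _ hp₂q _ hp₁q
  have hdpos : 0 < ‖d‖ := by
    refine lt_of_lt_of_le hd0' ((le_abs_self _).trans (abs_coord_le d 0))
  set s := √T with hs
  have hsnn : 0 ≤ s := Real.sqrt_nonneg _
  set α : ℝ := inner ℝ (u p₂ - u p₁) (rot d) / ‖d‖ ^ 2 with hα
  set a : ℝ × E2 := (α, u p₁ - α • rot p₁) with ha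
  set w : E2 → E2 := fun x => u x - rg a x with hw
  have hw₁ : w p₁ = 0 := by simp [hw, rg, ha]
  have hwd : ∀ x y, w x - w y = (u x - u y) - rgD a (x - y) := by
    intro x y
    rw [← rg_sub_rg]; simp only [hw]; abel
  have hgood : ∀ x ∈ win p r, ∀ y ∈ win p r, 1 / 1000 * r ≤ |y 0 - x 0| → (x, y) ∉ B →
      |inner ℝ (w y - w x) (y - x)| ≤ ‖y - x‖ ^ 2 * s := by
    intro x hx y hy hxy hxyB
    rw [hwd, inner_sub_left, inner_rgD, sub_zero]
    exact inner_le_of_notMem_badPair hlip hTnn hx hy hxy hxyB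
  have hw₂ : ‖w p₂‖ ≤ 2 * r * s := by
    have h1 := hgood p₁ hp₁q p₂ hp₂q ?_ hp₁₂
    · rw [hw₁, sub_zero] at h1
      have h2 : inner ℝ (w p₂) (rot d) = 0 := by
        have : w p₂ = (u p₂ - u p₁) - rgD a d := by rw [← hwd, hw₁, sub_zero]
        rw [this, inner_sub_left, rgD, smul_apply, inner_smul_left,
          real_inner_self_eq_norm_sq, norm_rot]
        simp only [ha, hα, conj_trivial]
        field_simp
        ring
      have h3 := norm_mul_norm_sq (w p₂) d
      rw [h2] at h3
      have h4 : ‖w p₂‖ * ‖d‖ ≤ ‖d‖ ^ 2 * s := by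
        refine le_trans (le_of_eq ?_) h1
        rw [← abs_of_nonneg (show 0 ≤ ‖w p₂‖ * ‖d‖ by positivity), ← sq_eq_sq_iff_abs_eq_abs]
        rw [mul_pow, h3]; simp [hddef]
      have h5 : ‖w p₂‖ ≤ ‖d‖ * s := by
        refine le_of_mul_le_mul_right ?_ hdpos
        linarith
      exact h5.trans (by gcongr)
    · rw [show p₂ 0 - p₁ 0 = d 0 by simp [hddef], abs_of_pos hd0']
      linarith
  set c := d 1 / d 0 with hc
  set X1 := {x : E2 | (p₁ 0 - 1 / 1000 * r < x 0 ∧ x 0 < p₁ 0 - 1 / 1000 * r + 2 / 1000 * r) ∧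
    x 1 ∈ Icc (p 1) (p 1 + r)} with hX1
  set X2 := {x : E2 | (p₂ 0 - 1 / 1000 * r < x 0 ∧ x 0 < p₂ 0 - 1 / 1000 * r + 2 / 1000 * r) ∧
    x 1 ∈ Icc (p 1) (p 1 + r)} with hX2
  set β := p₁ 1 - c * p₁ 0 with hβ
  set X3 := {x : E2 | (p 0 < x 0 ∧ x 0 < p 0 + r) ∧
    x 1 - c * x 0 ∈ Icc (β - 2 / 1000 * r) (β + 2 / 1000 * r)} with hX3
  refine ⟨a, ?_⟩
  have hsub : {x | x ∈ win p r ∧ cW * √G < ‖u x - rg a x‖} ⊆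
      ((Prod.mk p₁ ⁻¹' B ∪ Prod.mk p₂ ⁻¹' B) ∪ (X1 ∪ X2)) ∪ X3 := by
    rintro x ⟨hx, hxw⟩
    by_contra hcon
    simp only [mem_union, not_or] at hcon
    obtain ⟨⟨⟨hB1, hB2⟩, hx1, hx2⟩, hx3⟩ := hcon
    refine absurd hxw (not_lt.2 ?_)
    have hxy : x 1 ∈ Icc (p 1) (p 1 + r) := ⟨(hx 1).1.le, (hx 1).2.le⟩
    have hs1 : 1 / 1000 * r ≤ |x 0 - p₁ 0| := by
      by_contra! h
      rw [abs_lt] at h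
      exact hx1 ⟨⟨by linarith, by linarith⟩, hxy⟩
    have hs2 : 1 / 1000 * r ≤ |x 0 - p₂ 0| := by
      by_contra! h
      rw [abs_lt] at h
      exact hx2 ⟨⟨by linarith, by linarith⟩, hxy⟩
    have hs3 : 2 / 1000 * r ≤ |x 1 - c * x 0 - β| := by
      by_contra! h
      rw [abs_lt] at h
      exact hx3 ⟨hx 0, by constructor <;> linarith⟩
    have g1 := hgood p₁ hp₁q x hx hs1 hB1
    have g2 := hgood p₂ hp₂q x hx hs2 hB2
    have n1 := hdiff x hx p₁ hp₁q
    have n2 := hdiff x hx p₂ hp₂q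
    have g1' : |inner ℝ (w x) (x - p₁)| ≤ 4 * r ^ 2 * s := by
      rw [hw₁, sub_zero] at g1
      refine g1.trans ?_
      calc ‖x - p₁‖ ^ 2 * s ≤ (2 * r) ^ 2 * s := by gcongr
        _ = _ := by ring
    have g2' : |inner ℝ (w x) (x - p₂)| ≤ 8 * r ^ 2 * s := by
      have e : inner ℝ (w x) (x - p₂) =
          inner ℝ (w x - w p₂) (x - p₂) + inner ℝ (w p₂) (x - p₂) := by
        rw [← inner_add_left]; congr 1; abel
      rw [e]
      calc _ ≤ |inner ℝ (w x - w p₂) (x - p₂)| + |inner ℝ (w p₂) (x - p₂)| := abs_add_le _ _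
        _ ≤ ‖x - p₂‖ ^ 2 * s + ‖w p₂‖ * ‖x - p₂‖ := add_le_add g2 (abs_real_inner_le_norm _ _)
        _ ≤ (2 * r) ^ 2 * s + (2 * r * s) * (2 * r) := by gcongr
        _ = _ := by ring
    have g3 : |inner ℝ (w x) d| ≤ 12 * r ^ 2 * s := by
      have e : inner ℝ (w x) d = inner ℝ (w x) (x - p₁) - inner ℝ (w x) (x - p₂) := by
        rw [← inner_sub_right]; congr 1; simp only [hddef]; abel
      rw [e]
      refine (abs_sub _ _).trans ?_
      linarith
    have hdet : r ^ 2 / 1000 ≤ |d 0 * (x - p₁) 1 - d 1 * (x - p₁) 0| := by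
      have e : d 0 * (x - p₁) 1 - d 1 * (x - p₁) 0 = d 0 * (x 1 - c * x 0 - β) := by
        simp only [hβ, hc, PiLp.sub_apply]; field_simp; ring
      rw [e, abs_mul, abs_of_pos hd0']
      calc r ^ 2 / 1000 = r / 2 * (2 / 1000 * r) := by ring
        _ ≤ _ := by gcongr
    have := norm_le_of_inner_le hr hsnn hdn n1 g3 g1' hdet
    refine this.trans ?_
    have hs' : r * s = 1000 * √G := by
      rw [hs, hT, hl, Real.sqrt_mul (by positivity), Real.sqrt_div (by positivity),
        Real.sqrt_sq hr.le, show (10 : ℝ) ^ 6 = 1000 ^ 2 by norm_num, Real.sqrt_sq (by norm_num)]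
      field_simp
    rw [mul_assoc, hs', cW]
    linarith
  refine (measure_mono hsub).trans ?_
  have v1 : volume X1 ≤ ENNReal.ofReal (2 / 1000 * r ^ 2) := by
    refine (volume_rect_le _ _ _ _).trans ?_
    rw [← ENNReal.ofReal_mul (by positivity)]
    apply le_of_eq; congr 1; ring
  have v2 : volume X2 ≤ ENNReal.ofReal (2 / 1000 * r ^ 2) := by
    refine (volume_rect_le _ _ _ _).trans ?_
    rw [← ENNReal.ofReal_mul (by positivity)]
    apply le_of_eq; congr 1; ring
  have v3 : volume X3 ≤ ENNReal.ofReal (4 / 1000 * r ^ 2) := by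
    refine (volume_shear_le _ _ _ _).trans ?_
    rw [Real.volume_Icc, ← ENNReal.ofReal_mul (by positivity)]
    apply le_of_eq; congr 1; ring
  refine (measure_union_le _ _).trans ((add_le_add ((measure_union_le _ _).trans (add_le_add
    ((measure_union_le _ _).trans (add_le_add (hZsec _ hp₁Z) (hZsec _ hp₂Z')))
    ((measure_union_le _ _).trans (add_le_add v1 v2)))) v3).trans ?_)
  rw [← ENNReal.ofReal_add (by positivity) (by positivity),
    ← ENNReal.ofReal_add (by positivity) (by positivity),
    ← ENNReal.ofReal_add (by positivity) (by positivity),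
    ← ENNReal.ofReal_add (by positivity) (by positivity)]
  refine ENNReal.ofReal_le_ofReal ?_
  linarith

end PiecewiseKorn

namespace PiecewiseKorn

/-- `rg a` is within `m` of `u` on most of the window `win p r`. -/
def Near (u : E2 → E2) (a : ℝ × E2) (m : ℝ) (p : E2) (r : ℝ) : Prop :=
  volume {x | x ∈ win p r ∧ m < ‖u x - rg a x‖} ≤ ENNReal.ofReal (r ^ 2 / 100)

lemma norm_rg_sub_le {a b : ℝ × E2} {δ t : ℝ} (ht : 0 < t) {y₀ y₁ : E2} (hy : t ≤ dist y₀ y₁)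
    (h₀ : ‖rg a y₀ - rg b y₀‖ ≤ δ) (h₁ : ‖rg a y₁ - rg b y₁‖ ≤ δ) :
    |(a - b).1| ≤ 2 * δ / t := by
  have e : rgD (a - b) (y₀ - y₁) = (rg a y₀ - rg b y₀) - (rg a y₁ - rg b y₁) := by
    rw [← rg_sub_rg, rg_sub, rg_sub]
  have h : |(a - b).1| * ‖y₀ - y₁‖ ≤ 2 * δ := by
    rw [← norm_rgD_apply, e]
    refine (norm_sub_le _ _).trans ?_
    linarith
  rw [dist_eq_norm] at hy
  rw [le_div_iff₀ ht]
  exact (mul_le_mul_of_nonneg_left hy (abs_nonneg _)).trans h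

/-- Two rigid motions that approximate `u` on overlapping windows are close. -/
lemma near_compare {u : E2 → E2} {a b : ℝ × E2} {m m' : ℝ} {p p' o : E2} {r r' t : ℝ}
    (ht : 0 < t) (hr0 : 0 ≤ r) (hr0' : 0 ≤ r') (hr : r ≤ 4 * t) (hr' : r' ≤ 4 * t)
    (ha : Near u a m p r) (hb : Near u b m' p' r')
    (hsub : win o t ⊆ win p r) (hsub' : win o t ⊆ win p' r') :
    |(a - b).1| ≤ 8 * (m + m') / t ∧
      ∃ y ∈ win o t, ‖rg a y - rg b y‖ ≤ m + m' := by
  set X := {x | x ∈ win p r ∧ m < ‖u x - rg a x‖} with hX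
  set X' := {x | x ∈ win p' r' ∧ m' < ‖u x - rg b x‖} with hX'
  have hv : ENNReal.ofReal (4 * (t / 4) ^ 2) < volume (win o t \ (X ∪ X')) := by
    have h1 : volume (win o t) ≤ volume (win o t \ (X ∪ X')) + volume (X ∪ X') := by
      refine (measure_mono ?_).trans (measure_union_le _ _)
      rw [sdiff_union_self]; exact subset_union_left
    have h2 : volume (X ∪ X') ≤ ENNReal.ofReal (32 / 100 * t ^ 2) := by
      refine (measure_union_le _ _).trans ((add_le_add ha hb).trans ?_)
      rw [← ENNReal.ofReal_add (by positivity) (by positivity)]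
      refine ENNReal.ofReal_le_ofReal ?_
      have q1 : r ^ 2 ≤ (4 * t) ^ 2 := by gcongr
      have q2 : r' ^ 2 ≤ (4 * t) ^ 2 := by gcongr
      linarith
    by_contra! hcon
    have h3 := h1.trans (add_le_add hcon h2)
    rw [volume_win o ht.le, ← ENNReal.ofReal_add (by positivity) (by positivity),
      ENNReal.ofReal_le_ofReal_iff (by positivity)] at h3
    nlinarith [pow_pos ht 2]
  obtain ⟨y₀, hy₀, y₁, hy₁, hd⟩ := exists_dist_of_volume (by positivity) hv
  have hgood : ∀ y ∈ win o t \ (X ∪ X'), ‖rg a y - rg b y‖ ≤ m + m' := by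
    rintro y ⟨hy, hyX⟩
    simp only [mem_union, not_or, hX, hX', mem_ofPred_eq, not_and, not_lt] at hyX
    have h1 := hyX.1 (hsub hy)
    have h2 := hyX.2 (hsub' hy)
    have e : rg a y - rg b y = (u y - rg b y) - (u y - rg a y) := by abel
    rw [e]
    exact (norm_sub_le _ _).trans (by linarith)
  refine ⟨?_, y₀, hy₀.1, hgood _ hy₀⟩
  have := norm_rg_sub_le (by positivity) hd (hgood _ hy₀) (hgood _ hy₁)
  refine this.trans (le_of_eq ?_)
  field_simp; ring

/-- The one-dimensional bump. -/
def hat (t : ℝ) : ℝ := Real.smoothTransition t - Real.smoothTransition (t - 1)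

lemma monotone_smoothTransition : Monotone Real.smoothTransition :=
  Real.smoothTransition.monotone

lemma hat_nonneg (t : ℝ) : 0 ≤ hat t :=
  sub_nonneg.2 (monotone_smoothTransition (by linarith))

lemma hat_le_one (t : ℝ) : hat t ≤ 1 := by
  have h1 := Real.smoothTransition.le_one t
  have h2 := Real.smoothTransition.nonneg (t - 1)
  rw [hat]; linarith

lemma hat_eq_zero {t : ℝ} (h : t ≤ 0 ∨ 2 ≤ t) : hat t = 0 := by
  rcases h with h | h
  · rw [hat, Real.smoothTransition.zero_of_nonpos h,
      Real.smoothTransition.zero_of_nonpos (by linarith), sub_zero]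
  · rw [hat, Real.smoothTransition.one_of_one_le (by linarith),
      Real.smoothTransition.one_of_one_le (by linarith), sub_self]

lemma hat_add_hat (t : ℝ) :
    hat t + hat (t - 1) = Real.smoothTransition t - Real.smoothTransition (t - 2) := by
  rw [hat, hat, show t - 1 - 1 = t - 2 by ring]; ring

lemma hat_add_hat_le (t : ℝ) : hat t + hat (t - 1) ≤ 1 := by
  rw [hat_add_hat]
  have h1 := Real.smoothTransition.le_one t
  have h2 := Real.smoothTransition.nonneg (t - 2)
  linarith

lemma hat_add_hat_eq {t : ℝ} (h1 : 1 ≤ t) (h2 : t ≤ 2) : hat t + hat (t - 1) = 1 := by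
  rw [hat_add_hat, Real.smoothTransition.one_of_one_le h1,
    Real.smoothTransition.zero_of_nonpos (by linarith), sub_zero]

lemma contDiff_hat : ContDiff ℝ 2 hat := by
  have h : ContDiff ℝ 2 Real.smoothTransition := Real.smoothTransition.contDiff
  exact h.sub (h.comp (contDiff_id.sub contDiff_const))

lemma exists_deriv_hat_le : ∃ C : ℝ, 0 < C ∧ ∀ t, |deriv hat t| ≤ C := by
  have hc : Continuous (deriv hat) := contDiff_hat.continuous_deriv (by norm_num)
  obtain ⟨C, hC⟩ := isCompact_Icc.exists_bound_of_continuousOn (s := Icc (0 : ℝ) 2) hc.continuousOn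
  refine ⟨max C 1, by positivity, fun t => ?_⟩
  by_cases ht : t ∈ Icc (0 : ℝ) 2
  · exact (hC t ht).trans (le_max_left _ _)
  · have h0 : hat t = 0 := hat_eq_zero (by
      rw [mem_Icc, not_and_or, not_le, not_le] at ht
      exact ht.imp le_of_lt le_of_lt)
    have hmin : IsLocalMin hat t := by
      refine Filter.Eventually.of_forall fun y => ?_
      rw [h0]; exact hat_nonneg y
    rw [hmin.deriv_eq_zero]
    simp

/-- A bound for the slope of the bump. -/
def cH : ℝ := Classical.choose exists_deriv_hat_le

lemma cH_pos : 0 < cH := (Classical.choose_spec exists_deriv_hat_le).1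

lemma abs_deriv_hat_le (t : ℝ) : |deriv hat t| ≤ cH :=
  (Classical.choose_spec exists_deriv_hat_le).2 t

/-- The bump at scale `ℓ` with base point `z + ℓ i`. -/
def bump (z : E2) (ℓ : ℝ) (i : Fin 2 → ℤ) (x : E2) : ℝ := ∏ c, hat ((x c - z c) / ℓ - i c)

/-- The indices of the bumps that are active at `x`. -/
def nb (z : E2) (ℓ : ℝ) (x : E2) : Finset (Fin 2 → ℤ) :=
  Fintype.piFinset fun c => {⌊(x c - z c) / ℓ⌋ - 1, ⌊(x c - z c) / ℓ⌋}

lemma mem_nb {z : E2} {ℓ : ℝ} {x : E2} {i : Fin 2 → ℤ} :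
    i ∈ nb z ℓ x ↔ ∀ c, (i c : ℝ) ≤ (x c - z c) / ℓ ∧ (x c - z c) / ℓ < i c + 2 := by
  simp only [nb, Fintype.mem_piFinset, Finset.mem_insert, Finset.mem_singleton]
  refine forall_congr' fun c => ?_
  set t := (x c - z c) / ℓ
  have e : (i c = ⌊t⌋ - 1 ∨ i c = ⌊t⌋) ↔ (i c ≤ ⌊t⌋ ∧ ⌊t⌋ < i c + 2) := by omega
  rw [e, Int.le_floor, Int.floor_lt]
  push_cast
  rfl

lemma bump_nonneg (z : E2) (ℓ : ℝ) (i : Fin 2 → ℤ) (x : E2) : 0 ≤ bump z ℓ i x :=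
  Finset.prod_nonneg fun _ _ => hat_nonneg _

lemma bump_eq_zero {z : E2} {ℓ : ℝ} {i : Fin 2 → ℤ} {x : E2} (h : i ∉ nb z ℓ x) :
    bump z ℓ i x = 0 := by
  rw [mem_nb] at h
  push Not at h
  obtain ⟨c, hc⟩ := h
  refine Finset.prod_eq_zero (Finset.mem_univ c) (hat_eq_zero ?_)
  by_cases h1 : (i c : ℝ) ≤ (x c - z c) / ℓ
  · right; linarith [hc h1]
  · left; linarith

lemma contDiff_bump (z : E2) (ℓ : ℝ) (i : Fin 2 → ℤ) : ContDiff ℝ 2 (bump z ℓ i) := by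
  unfold bump
  refine contDiff_prod fun c _ => contDiff_hat.comp ?_
  fun_prop

lemma fderiv_bump_eq_zero {z : E2} {ℓ : ℝ} {i : Fin 2 → ℤ} {x : E2} (h : i ∉ nb z ℓ x) :
    fderiv ℝ (bump z ℓ i) x = 0 := by
  have hmin : IsLocalMin (bump z ℓ i) x := by
    refine Filter.Eventually.of_forall fun y => ?_
    rw [bump_eq_zero h]; exact bump_nonneg _ _ _ y
  exact hmin.fderiv_eq_zero

lemma sum_bump (z : E2) (ℓ : ℝ) (x y : E2) : ∑ i ∈ nb z ℓ x, bump z ℓ i y =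
    ∏ c, (hat ((y c - z c) / ℓ - (⌊(x c - z c) / ℓ⌋ - 1)) +
      hat ((y c - z c) / ℓ - (⌊(x c - z c) / ℓ⌋ - 1) - 1)) := by
  simp only [nb, bump]
  rw [← Finset.prod_univ_sum _ (fun (c : Fin 2) (n : ℤ) => hat ((y c - z c) / ℓ - n))]
  refine Finset.prod_congr rfl fun c _ => ?_
  rw [Finset.sum_pair (by omega)]
  push_cast
  congr 2
  ring

lemma sum_bump_eq_one (z : E2) (ℓ : ℝ) (x : E2) : ∑ i ∈ nb z ℓ x, bump z ℓ i x = 1 := by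
  rw [sum_bump]
  refine Finset.prod_eq_one fun c _ => hat_add_hat_eq ?_ ?_
  · linarith [Int.floor_le ((x c - z c) / ℓ)]
  · linarith [Int.lt_floor_add_one ((x c - z c) / ℓ)]

lemma sum_fderiv_bump (z : E2) (ℓ : ℝ) (x : E2) :
    ∑ i ∈ nb z ℓ x, fderiv ℝ (bump z ℓ i) x = 0 := by
  have hmax : IsLocalMax (fun y => ∑ i ∈ nb z ℓ x, bump z ℓ i y) x := by
    refine Filter.Eventually.of_forall fun y => ?_
    simp only
    rw [sum_bump_eq_one, sum_bump]
    exact Finset.prod_le_one (fun _ _ => add_nonneg (hat_nonneg _) (hat_nonneg _))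
      fun _ _ => hat_add_hat_le _
  have h := hmax.fderiv_eq_zero
  rwa [fderiv_fun_sum] at h
  intro i _
  exact ((contDiff_bump z ℓ i).differentiable (by norm_num)) x

lemma norm_fderiv_bump_le (z : E2) {ℓ : ℝ} (hℓ : 0 < ℓ) (i : Fin 2 → ℤ) (x : E2) :
    ‖fderiv ℝ (bump z ℓ i) x‖ ≤ 2 * cH / ℓ := by
  have hf : ∀ c : Fin 2, HasFDerivAt (fun y : E2 => hat ((y c - z c) / ℓ - i c))
      ((deriv hat ((x c - z c) / ℓ - i c) / ℓ) • (EuclideanSpace.proj c : E2 →L[ℝ] ℝ)) x := by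
    intro c
    have h1 : HasFDerivAt (fun y : E2 => (y c - z c) / ℓ - i c)
        ((1 / ℓ) • (EuclideanSpace.proj c : E2 →L[ℝ] ℝ)) x := by
      have h0 : HasFDerivAt (fun y : E2 => y c) (EuclideanSpace.proj c : E2 →L[ℝ] ℝ) x :=
        (EuclideanSpace.proj c : E2 →L[ℝ] ℝ).hasFDerivAt
      have := ((h0.sub_const (z c)).const_mul (1 / ℓ)).sub_const (i c : ℝ)
      have e : (fun y : E2 => (y c - z c) / ℓ - i c) = fun y => 1 / ℓ * (y c - z c) - i c := by
        funext y; ring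
      rw [e]
      exact this
    have h2 : HasDerivAt hat (deriv hat ((x c - z c) / ℓ - i c)) ((x c - z c) / ℓ - i c) :=
      (contDiff_hat.differentiable (by norm_num) _).hasDerivAt
    have := h2.comp_hasFDerivAt x h1
    rw [smul_smul, mul_one_div] at this
    exact this
  have hp : ∀ c : Fin 2, ‖(EuclideanSpace.proj c : E2 →L[ℝ] ℝ)‖ ≤ 1 := fun c =>
    ContinuousLinearMap.opNorm_le_bound _ zero_le_one fun y => by
      simpa using abs_coord_le y c
  have hb : bump z ℓ i = fun y => hat ((y 0 - z 0) / ℓ - i 0) * hat ((y 1 - z 1) / ℓ - i 1) := by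
    ext y; simp [bump, Fin.prod_univ_two]
  rw [hb, ((hf 0).fun_mul (hf 1)).fderiv]
  have hn : ∀ c d : Fin 2, ‖hat ((x c - z c) / ℓ - i c) •
      (deriv hat ((x d - z d) / ℓ - i d) / ℓ) • (EuclideanSpace.proj d : E2 →L[ℝ] ℝ)‖ ≤
        cH / ℓ := by
    intro c d
    rw [norm_smul, norm_smul, Real.norm_eq_abs, Real.norm_eq_abs, abs_of_nonneg (hat_nonneg _),
      abs_div, abs_of_pos hℓ]
    have h3 := abs_deriv_hat_le ((x d - z d) / ℓ - i d)
    calc _ ≤ 1 * (cH / ℓ * 1) := by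
          gcongr
          · exact hat_le_one _
          · exact div_nonneg cH_pos.le hℓ.le
          · exact hp d
      _ = cH / ℓ := by ring
  refine (norm_add_le _ _).trans ((add_le_add (hn 0 1) (hn 1 0)).trans (le_of_eq ?_))
  ring

end PiecewiseKorn

namespace PiecewiseKorn

/-- A map on a square with a short jump set. -/
structure Setup where
  u : E2 → E2
  Γ : Set E2
  z : E2
  s : ℝ
  s_pos : 0 < s
  closed : IsClosed Γ
  null : volume Γ = 0
  lip : ∀ x ∈ win z s \ Γ, LipAt u x
  fin : En u (win z s) ≠ ⊤
  small : μH[1] (Γ ∩ win z s) ≤ ENNReal.ofReal (etaW * (s / 2))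

namespace Setup

variable (D : Setup)

/-- The mesh size at level `k`. -/
def ell (k : ℕ) : ℝ := D.s / 2 ^ (k + 2)

/-- The largest index of a window at level `k`. -/
def nn (k : ℕ) : ℤ := 2 ^ (k + 2) - 2

/-- The rescaled coordinate at level `k`. -/
def tt (k : ℕ) (x : E2) (c : Fin 2) : ℝ := (x c - D.z c) / D.ell k

/-- The grid points at level `k`. -/
def pos (k : ℕ) (i : Fin 2 → ℤ) : E2 := WithLp.toLp 2 fun c => D.z c + D.ell k * i c

/-- The windows at level `k`. -/
def W (k : ℕ) (i : Fin 2 → ℤ) : Set E2 := win (D.pos k i) (2 * D.ell k)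

/-- Clamping of indices to the interior of the grid. -/
def cl (k : ℕ) (i : Fin 2 → ℤ) : Fin 2 → ℤ := fun c => max 1 (min (i c) (nn k - 1))

/-- Windows that contain a long piece of the jump set. -/
def Bad (k : ℕ) (b : Fin 2 → ℤ) : Prop :=
  (∀ c, 0 ≤ b c ∧ b c ≤ nn k) ∧ ENNReal.ofReal (etaW * (2 * D.ell k)) < μH[1] (D.Γ ∩ D.W k b)

/-- Indices that stay away from all bad windows of the same or coarser scale. -/
def Good (k : ℕ) (i : Fin 2 → ℤ) : Prop :=
  (∀ c, -3 ≤ i c ∧ i c ≤ nn k + 3) ∧ ∀ j ≤ k, ∀ b, D.Bad j b →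
    ∃ c, 32 * (2 * D.ell j - D.ell k) < |D.ell k * i c - D.ell j * b c|

lemma ell_pos (k : ℕ) : 0 < D.ell k := div_pos D.s_pos (by positivity)

lemma ell_succ (k : ℕ) : D.ell k = 2 * D.ell (k + 1) := by
  have h : (2 : ℝ) ^ (k + 1 + 2) = 2 * 2 ^ (k + 2) := by ring
  rw [ell, ell, h]
  field_simp

lemma ell_anti {j k : ℕ} (h : j ≤ k) : D.ell k ≤ D.ell j := by
  unfold ell
  have := D.s_pos
  gcongr
  norm_num

lemma ell_zero : D.ell 0 = D.s / 4 := by rw [ell]; norm_num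

lemma nn_succ (k : ℕ) : nn (k + 1) = 2 * nn k + 2 := by simp only [nn]; ring

lemma two_le_nn (k : ℕ) : 2 ≤ nn k := by
  induction k with
  | zero => simp [nn]
  | succ k ih => rw [nn_succ]; omega

lemma ell_mul_nn (k : ℕ) : D.ell k * ((nn k : ℝ) + 2) = D.s := by
  simp only [ell, nn]; push_cast; field_simp; ring

lemma tt_succ (k : ℕ) (x : E2) (c : Fin 2) : D.tt (k + 1) x c = 2 * D.tt k x c := by
  rw [tt, tt, D.ell_succ k]
  have := D.ell_pos (k + 1)
  field_simp

lemma ell_mul_tt (k : ℕ) (x : E2) (c : Fin 2) : D.ell k * D.tt k x c = x c - D.z c := by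
  rw [tt, mul_div_cancel₀ _ (D.ell_pos k).ne']

lemma mem_nb_tt {k : ℕ} {x : E2} {i : Fin 2 → ℤ} :
    i ∈ nb D.z (D.ell k) x ↔ ∀ c, (i c : ℝ) ≤ D.tt k x c ∧ D.tt k x c < i c + 2 := mem_nb

lemma mem_win_pos {k : ℕ} {i : Fin 2 → ℤ} {m : ℝ} {y : E2} :
    y ∈ win (D.pos k i) (m * D.ell k) ↔ ∀ c, (i c : ℝ) < D.tt k y c ∧ D.tt k y c < i c + m := by
  refine forall_congr' fun c => ?_
  have h := D.ell_pos k
  have e := D.ell_mul_tt k y c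
  simp only [pos]
  constructor
  · rintro ⟨h1, h2⟩
    constructor <;> refine lt_of_mul_lt_mul_left ?_ h.le <;> linarith
  · rintro ⟨h1, h2⟩
    have h1' := mul_lt_mul_of_pos_left h1 h
    have h2' := mul_lt_mul_of_pos_left h2 h
    constructor <;> linarith

lemma mem_W {k : ℕ} {i : Fin 2 → ℤ} {y : E2} :
    y ∈ D.W k i ↔ ∀ c, (i c : ℝ) < D.tt k y c ∧ D.tt k y c < i c + 2 := D.mem_win_pos

lemma mem_S (k : ℕ) {y : E2} :
    y ∈ win D.z D.s ↔ ∀ c, 0 < D.tt k y c ∧ D.tt k y c < (nn k : ℝ) + 2 := by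
  refine forall_congr' fun c => ?_
  have h := D.ell_pos k
  have e := D.ell_mul_tt k y c
  have e2 := D.ell_mul_nn k
  constructor
  · rintro ⟨h1, h2⟩
    constructor <;> refine lt_of_mul_lt_mul_left ?_ h.le <;> linarith
  · rintro ⟨h1, h2⟩
    have h1' := mul_lt_mul_of_pos_left h1 h
    have h2' := mul_lt_mul_of_pos_left h2 h
    constructor <;> linarith

lemma W_subset {k : ℕ} {i : Fin 2 → ℤ} (h : ∀ c, 0 ≤ i c ∧ i c ≤ nn k) :
    D.W k i ⊆ win D.z D.s := by
  intro y hy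
  rw [D.mem_S k]
  rw [mem_W] at hy
  intro c
  have h1 : (0 : ℝ) ≤ i c := by exact_mod_cast (h c).1
  have h2 : (i c : ℝ) ≤ nn k := by exact_mod_cast (h c).2
  have := hy c
  constructor <;> linarith

lemma cl_range (k : ℕ) (i : Fin 2 → ℤ) (c : Fin 2) : 1 ≤ cl k i c ∧ cl k i c ≤ nn k - 1 := by
  have := two_le_nn k
  simp only [cl]
  omega

lemma W_cl_subset (k : ℕ) (i : Fin 2 → ℤ) : D.W k (cl k i) ⊆ win D.z D.s :=
  D.W_subset fun c => by have := cl_range k i c; omega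

lemma nb_close {k : ℕ} {x : E2} {i i' : Fin 2 → ℤ} (hi : i ∈ nb D.z (D.ell k) x)
    (hi' : i' ∈ nb D.z (D.ell k) x) (c : Fin 2) : i c ≤ i' c + 1 := by
  have h1 := (D.mem_nb_tt.1 hi c).1
  have h2 := (D.mem_nb_tt.1 hi' c).2
  have : (i c : ℝ) < i' c + 2 := by linarith
  have : i c < i' c + 2 := by exact_mod_cast this
  omega

lemma nb_close_succ {k : ℕ} {x : E2} {i j : Fin 2 → ℤ} (hi : i ∈ nb D.z (D.ell (k + 1)) x)
    (hj : j ∈ nb D.z (D.ell k) x) (c : Fin 2) : -1 ≤ i c - 2 * j c ∧ i c - 2 * j c ≤ 3 := by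
  have h1 := D.mem_nb_tt.1 hi c
  have h2 := D.mem_nb_tt.1 hj c
  rw [tt_succ] at h1
  have a1 : (i c : ℝ) < 2 * j c + 4 := by linarith
  have a2 : (2 * j c : ℝ) < i c + 2 := by linarith
  have b1 : i c < 2 * j c + 4 := by exact_mod_cast a1
  have b2 : 2 * j c < i c + 2 := by exact_mod_cast a2
  omega

lemma cl_close {k : ℕ} {x : E2} {i i' : Fin 2 → ℤ} (hi : i ∈ nb D.z (D.ell k) x)
    (hi' : i' ∈ nb D.z (D.ell k) x) (c : Fin 2) : cl k i c ≤ cl k i' c + 1 := by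
  have := D.nb_close hi hi' c
  simp only [cl]
  omega

lemma cl_close_succ {k : ℕ} {x : E2} {i j : Fin 2 → ℤ} (hi : i ∈ nb D.z (D.ell (k + 1)) x)
    (hj : j ∈ nb D.z (D.ell k) x) (c : Fin 2) :
    -1 ≤ cl (k + 1) i c - 2 * cl k j c ∧ cl (k + 1) i c - 2 * cl k j c ≤ 3 := by
  have := D.nb_close_succ hi hj c
  have h2 := two_le_nn k
  simp only [cl, nn_succ]
  omega

lemma good_cl {k : ℕ} {i : Fin 2 → ℤ} (h : D.Good k i) : ¬ D.Bad k (cl k i) := by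
  intro hb
  obtain ⟨c, hc⟩ := h.2 k le_rfl _ hb
  have hr := h.1 c
  have h2 := two_le_nn k
  have h3 : |(i c : ℝ) - cl k i c| ≤ 4 := by
    have : |i c - cl k i c| ≤ 4 := by
      simp only [cl]
      rw [abs_le]
      omega
    exact_mod_cast this
  rw [← mul_sub, abs_mul, abs_of_pos (D.ell_pos k)] at hc
  nlinarith [D.ell_pos k]

lemma not_bad_zero (b : Fin 2 → ℤ) : ¬ D.Bad 0 b := by
  rintro ⟨h, hlt⟩
  refine absurd hlt (not_lt.2 ?_)
  refine (measure_mono (inter_subset_inter_right _ (D.W_subset h))).trans (D.small.trans ?_)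
  rw [ell_zero]
  apply le_of_eq; congr 2; ring

lemma good_down {k : ℕ} {x : E2} {i j : Fin 2 → ℤ} (hg : D.Good (k + 1) i)
    (hi : i ∈ nb D.z (D.ell (k + 1)) x) (hj : j ∈ nb D.z (D.ell k) x) : D.Good k j := by
  have hc := D.nb_close_succ hi hj
  refine ⟨fun c => ?_, fun j' hj' b hb => ?_⟩
  · have h1 := hg.1 c
    have h2 := hc c
    rw [nn_succ] at h1
    omega
  · obtain ⟨c, h⟩ := hg.2 j' (by omega) b hb
    refine ⟨c, ?_⟩
    have h2 : |(i c : ℝ) - 2 * j c| ≤ 3 := by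
      have : |i c - 2 * j c| ≤ 3 := by
        have := hc c
        rw [abs_le]; omega
      exact_mod_cast this
    have h3 := D.ell_succ k
    have h4 := D.ell_pos (k + 1)
    have h5 : |D.ell (k + 1) * i c - D.ell k * j c| ≤ 3 * D.ell (k + 1) := by
      have e : D.ell (k + 1) * i c - D.ell k * j c = D.ell (k + 1) * (i c - 2 * j c) := by
        rw [h3]; ring
      rw [e, abs_mul, abs_of_pos h4, mul_comm]
      gcongr
    have h6 := abs_sub_abs_le_abs_sub (D.ell (k + 1) * i c - D.ell j' * b c)
      (D.ell (k + 1) * i c - D.ell k * j c)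
    have e : (D.ell (k + 1) * i c - D.ell j' * b c) - (D.ell (k + 1) * i c - D.ell k * j c) =
        D.ell k * j c - D.ell j' * b c := by ring
    rw [e] at h6
    linarith

/-- Points near a good point of a much finer scale are good. -/
lemma good_transfer {k k' : ℕ} (hk : k + 2 ≤ k') {x x' : E2} {i' : Fin 2 → ℤ}
    (hg : D.Good k' i') (hi' : i' ∈ nb D.z (D.ell k') x')
    (hxx : ∀ c, |x c - x' c| ≤ 4 * D.ell k + 4 * D.ell k')
    (hx : ∀ c, 0 ≤ D.tt k x c ∧ D.tt k x c ≤ (nn k : ℝ) + 2) :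
    ∃ i ∈ nb D.z (D.ell (k + 1)) x, D.Good (k + 1) i := by
  refine ⟨fun c => ⌊D.tt (k + 1) x c⌋, ?_, ?_, ?_⟩
  · rw [mem_nb_tt]
    intro c
    refine ⟨Int.floor_le _, ?_⟩
    linarith [Int.lt_floor_add_one (D.tt (k + 1) x c)]
  · intro c
    have h := hx c
    have e := D.tt_succ k x c
    have h1 : 0 ≤ ⌊D.tt (k + 1) x c⌋ := Int.floor_nonneg.2 (by linarith)
    have h2 : ⌊D.tt (k + 1) x c⌋ ≤ nn (k + 1) + 2 := by
      have : D.tt (k + 1) x c ≤ ((nn (k + 1) + 2 : ℤ) : ℝ) := by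
        rw [nn_succ]; push_cast; linarith
      have := Int.floor_le_floor this
      rwa [Int.floor_intCast] at this
    show -3 ≤ ⌊D.tt (k + 1) x c⌋ ∧ ⌊D.tt (k + 1) x c⌋ ≤ nn (k + 1) + 3
    omega
  · intro j hj b hb
    obtain ⟨c, h⟩ := hg.2 j (by omega) b hb
    refine ⟨c, ?_⟩
    show _ < |D.ell (k + 1) * (⌊D.tt (k + 1) x c⌋ : ℝ) - _|
    set m := ⌊D.tt (k + 1) x c⌋
    have h1 := D.ell_mul_tt (k + 1) x c
    have h2 := D.ell_mul_tt k' x' c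
    have p1 := D.ell_pos (k + 1)
    have p2 := D.ell_pos k'
    have f1 := mul_le_mul_of_nonneg_left (Int.floor_le (D.tt (k + 1) x c)) p1.le
    have f2 := mul_le_mul_of_nonneg_left (Int.lt_floor_add_one (D.tt (k + 1) x c)).le p1.le
    have g1 := mul_le_mul_of_nonneg_left (D.mem_nb_tt.1 hi' c).1 p2.le
    have g2 := mul_le_mul_of_nonneg_left (D.mem_nb_tt.1 hi' c).2.le p2.le
    have hs := D.ell_succ k
    have hs' := D.ell_succ (k + 1)
    have ha : D.ell k' ≤ D.ell (k + 1 + 1) := D.ell_anti hk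
    have h5 : |D.ell k' * i' c - D.ell (k + 1) * m| ≤ 13 * D.ell (k + 1) := by
      have hx := hxx c
      rw [abs_le] at hx ⊢
      constructor <;> linarith
    have h6 := abs_sub_abs_le_abs_sub (D.ell k' * i' c - D.ell j * b c)
      (D.ell k' * i' c - D.ell (k + 1) * m)
    have e : (D.ell k' * i' c - D.ell j * b c) - (D.ell k' * i' c - D.ell (k + 1) * m) =
        D.ell (k + 1) * m - D.ell j * b c := by ring
    rw [e] at h6
    linarith

/-- The error of the rigid motion on a window. -/
def amp (k : ℕ) (i : Fin 2 → ℤ) : ℝ := cW * √(En D.u (D.W k i)).toReal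

open Classical in
/-- A rigid motion that approximates `u` on a window. -/
def mot (k : ℕ) (i : Fin 2 → ℤ) : ℝ × E2 :=
  if h : ∃ a, Near D.u a (D.amp k i) (D.pos k i) (2 * D.ell k) then Classical.choose h else 0

lemma En_mono {u : E2 → E2} {S T : Set E2} (h : S ⊆ T) : En u S ≤ En u T :=
  lintegral_mono_set h

lemma near_mot {k : ℕ} {i : Fin 2 → ℤ} (hr : ∀ c, 0 ≤ i c ∧ i c ≤ nn k) (hb : ¬ D.Bad k i) :
    Near D.u (D.mot k i) (D.amp k i) (D.pos k i) (2 * D.ell k) := by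
  have hsub := D.W_subset hr
  have hex : ∃ a, Near D.u a (D.amp k i) (D.pos k i) (2 * D.ell k) := by
    refine weak_korn (by have := D.ell_pos k; positivity) D.closed D.null
      (fun x hx => D.lip x ⟨hsub hx.1, hx.2⟩) ?_
      (ne_top_of_le_ne_top D.fin (En_mono hsub))
    by_contra! hcon
    exact hb ⟨hr, hcon⟩
  rw [mot, dif_pos hex]
  exact Classical.choose_spec hex

lemma near_mot_cl {k : ℕ} {i : Fin 2 → ℤ} (h : D.Good k i) :
    Near D.u (D.mot k (cl k i)) (D.amp k (cl k i)) (D.pos k (cl k i)) (2 * D.ell k) :=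
  D.near_mot (fun c => by have := cl_range k i c; omega) (D.good_cl h)

/-- The part of the square that is seen from `x` at level `k`. -/
def Rel (k : ℕ) (x : E2) : Set E2 := ⋃ i ∈ nb D.z (D.ell k) x, D.W k (cl k i)

lemma Rel_subset (k : ℕ) (x : E2) : D.Rel k x ⊆ win D.z D.s :=
  iUnion₂_subset fun i _ => D.W_cl_subset k i

/-- The energy seen from `x` at levels `k` and `k + 1`. -/
def Phi (k : ℕ) (x : E2) : ℝ≥0∞ := En D.u (D.Rel (k + 1) x) + En D.u (D.Rel k x)

lemma Phi_ne_top (k : ℕ) (x : E2) : D.Phi k x ≠ ⊤ :=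
  ENNReal.add_ne_top.2 ⟨ne_top_of_le_ne_top D.fin (En_mono (D.Rel_subset _ x)),
    ne_top_of_le_ne_top D.fin (En_mono (D.Rel_subset _ x))⟩

lemma amp_le {k : ℕ} {x : E2} {j : Fin 2 → ℤ} {m : ℕ} (hm : m = k ∨ m = k + 1)
    (hj : j ∈ nb D.z (D.ell m) x) : D.amp m (cl m j) ≤ cW * √(D.Phi k x).toReal := by
  have hc : 0 ≤ cW := by rw [cW]; norm_num
  unfold amp
  gcongr
  · exact D.Phi_ne_top k x
  · have h1 : D.W m (cl m j) ⊆ D.Rel m x := subset_biUnion_of_mem (u := fun i => D.W m (cl m i)) hj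
    refine (En_mono h1).trans ?_
    rcases hm with rfl | rfl
    · exact le_add_self
    · exact le_self_add

end Setup

end PiecewiseKorn

namespace PiecewiseKorn

lemma rgD_sub_eq (a b : ℝ × E2) : rgD (a - b) = rgD a - rgD b := by
  rw [rgD, rgD, rgD, Prod.fst_sub]
  exact sub_smul a.1 b.1 rot

lemma hasFDerivAt_blend {f : E2 → E2} {f' : E2 →L[ℝ] E2} {x : E2} (hf : HasFDerivAt f f' x)
    {ι : Type*} (G : Finset ι) {φ : ι → E2 → ℝ} {φ' : ι → E2 →L[ℝ] ℝ} {w : ι → E2 → E2}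
    {w' : ι → E2 →L[ℝ] E2} (hφ : ∀ i ∈ G, HasFDerivAt (φ i) (φ' i) x)
    (hw : ∀ i ∈ G, HasFDerivAt (w i) (w' i) x) :
    HasFDerivAt (fun y => f y + ∑ i ∈ G, φ i y • (w i y - f y))
      (f' + ∑ i ∈ G, (φ i x • (w' i - f') + (φ' i).smulRight (w i x - f x))) x :=
  hf.add (HasFDerivAt.fun_sum fun i hi => (hφ i hi).smul ((hw i hi).sub hf))

lemma norm_blend_le {F : Type*} [NormedAddCommGroup F] [NormedSpace ℝ F] {ι : Type*}
    {G : Finset ι} {φ : ι → ℝ} (h0 : ∀ i ∈ G, 0 ≤ φ i) (h1 : ∑ i ∈ G, φ i ≤ 1) {v : ι → F}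
    {δ : ℝ} (hδ : 0 ≤ δ) (hv : ∀ i ∈ G, ‖v i‖ ≤ δ) : ‖∑ i ∈ G, φ i • v i‖ ≤ δ := by
  refine (norm_sum_le _ _).trans ?_
  calc ∑ i ∈ G, ‖φ i • v i‖ ≤ ∑ i ∈ G, φ i * δ := by
        refine Finset.sum_le_sum fun i hi => ?_
        rw [norm_smul, Real.norm_of_nonneg (h0 i hi)]
        exact mul_le_mul_of_nonneg_left (hv i hi) (h0 i hi)
    _ = (∑ i ∈ G, φ i) * δ := (Finset.sum_mul _ _ _).symm
    _ ≤ 1 * δ := by gcongr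
    _ = δ := one_mul δ

lemma blend_sub_eq {F : Type*} [AddCommGroup F] [Module ℝ F] {ι : Type*} (G : Finset ι)
    (φ : ι → ℝ) (v : ι → F) (f L : F) : f + ∑ i ∈ G, φ i • (v i - f) - L =
      (1 - ∑ i ∈ G, φ i) • (f - L) + ∑ i ∈ G, φ i • (v i - L) := by
  simp only [smul_sub, Finset.sum_sub_distrib, ← Finset.sum_smul, sub_smul, one_smul]
  abel

lemma blend_sub_eq_of_sum {F : Type*} [AddCommGroup F] [Module ℝ F] {ι : Type*} {G : Finset ι}
    {φ : ι → ℝ} (h : ∑ i ∈ G, φ i = 1) (v : ι → F) (f L : F) :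
    f + ∑ i ∈ G, φ i • (v i - f) - L = ∑ i ∈ G, φ i • (v i - L) := by
  rw [blend_sub_eq, h, sub_self, zero_smul, zero_add]

lemma norm_blend_sub_le {F : Type*} [NormedAddCommGroup F] [NormedSpace ℝ F] {ι : Type*}
    {G : Finset ι} {φ : ι → ℝ} (h0 : ∀ i ∈ G, 0 ≤ φ i) (h1 : ∑ i ∈ G, φ i ≤ 1) {v : ι → F}
    {δ : ℝ} (hδ : 0 ≤ δ) {f L : F} (hv : ∀ i ∈ G, ‖v i - L‖ ≤ δ) :
    ‖f + ∑ i ∈ G, φ i • (v i - f) - L‖ ≤ ‖f - L‖ + δ := by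
  rw [blend_sub_eq]
  refine (norm_add_le _ _).trans (add_le_add ?_ (norm_blend_le h0 h1 hδ hv))
  have := Finset.sum_nonneg h0
  rw [norm_smul, Real.norm_of_nonneg (by linarith)]
  exact mul_le_of_le_one_left (norm_nonneg _) (by linarith)

lemma norm_sum_smulRight_le {ι : Type*} {G : Finset ι} {φ' : ι → E2 →L[ℝ] ℝ} {v : ι → E2}
    {c δ : ℝ} (hc : 0 ≤ c) (hδ : 0 ≤ δ) (hcard : G.card ≤ 4) (hφ : ∀ i ∈ G, ‖φ' i‖ ≤ c)
    (hv : ∀ i ∈ G, ‖v i‖ ≤ δ) : ‖∑ i ∈ G, (φ' i).smulRight (v i)‖ ≤ 4 * (c * δ) := by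
  refine (norm_sum_le_of_le G (f := fun i => (φ' i).smulRight (v i)) (n := fun _ => c * δ)
    fun i hi => ?_).trans ?_
  · rw [ContinuousLinearMap.norm_smulRight_apply]
    have := hφ i hi
    have := hv i hi
    gcongr
  · rw [Finset.sum_const, nsmul_eq_mul]
    have : (G.card : ℝ) ≤ 4 := by exact_mod_cast hcard
    gcongr

lemma card_nb_le (z : E2) (ℓ : ℝ) (x : E2) : (nb z ℓ x).card ≤ 4 := by
  rw [nb, Fintype.card_piFinset, Fin.prod_univ_two]
  exact Nat.mul_le_mul Finset.card_le_two Finset.card_le_two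

namespace Setup

variable (D : Setup)

/-- The reference rigid motion. -/
def a0 : ℝ × E2 := D.mot 0 fun _ => 1

open Classical in
/-- The finite set of good indices. -/
def GG (k : ℕ) : Finset (Fin 2 → ℤ) :=
  (Fintype.piFinset fun _ => Finset.Icc (-3) (nn k + 3)).filter fun i => D.Good k i

lemma mem_GG {k : ℕ} {i : Fin 2 → ℤ} : i ∈ D.GG k ↔ D.Good k i := by
  simp only [GG, Finset.mem_filter, Fintype.mem_piFinset, Finset.mem_Icc]
  exact ⟨fun h => h.2, fun h => ⟨h.1, h⟩⟩

/-- The rigid motion attached to an index. -/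
def am (k : ℕ) (i : Fin 2 → ℤ) : ℝ × E2 := D.mot k (cl k i)

/-- The successive smooth approximations. -/
def V : ℕ → E2 → E2
  | 0 => rg D.a0
  | k + 1 => fun x => V k x +
      ∑ i ∈ D.GG (k + 1), bump D.z (D.ell (k + 1)) i x • (rg (D.am (k + 1) i) x - V k x)

lemma contDiff_rg (a : ℝ × E2) : ContDiff ℝ 2 (rg a) := by
  unfold rg; fun_prop

lemma contDiff_V (k : ℕ) : ContDiff ℝ 2 (D.V k) := by
  induction k with
  | zero => exact contDiff_rg _
  | succ k ih =>
    have h : ContDiff ℝ 2 fun x => ∑ i ∈ D.GG (k + 1),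
        bump D.z (D.ell (k + 1)) i x • (rg (D.am (k + 1) i) x - D.V k x) :=
      ContDiff.sum fun i _ => (contDiff_bump _ _ _).smul ((contDiff_rg _).sub ih)
    exact ih.add h

lemma differentiable_V (k : ℕ) : Differentiable ℝ (D.V k) :=
  (D.contDiff_V k).differentiable (by norm_num)

lemma hasFDerivAt_bump (z : E2) (ℓ : ℝ) (i : Fin 2 → ℤ) (x : E2) :
    HasFDerivAt (bump z ℓ i) (fderiv ℝ (bump z ℓ i) x) x :=
  (((contDiff_bump z ℓ i).differentiable (by norm_num)) x).hasFDerivAt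

/-- The good indices that are active at a point. -/
def act (k : ℕ) (x : E2) : Finset (Fin 2 → ℤ) := D.GG k ∩ nb D.z (D.ell k) x

lemma mem_act {k : ℕ} {x : E2} {i : Fin 2 → ℤ} :
    i ∈ D.act k x ↔ D.Good k i ∧ i ∈ nb D.z (D.ell k) x := by
  rw [act, Finset.mem_inter, mem_GG]

lemma V_succ (k : ℕ) (x : E2) : D.V (k + 1) x = D.V k x +
    ∑ i ∈ D.act (k + 1) x, bump D.z (D.ell (k + 1)) i x •
      (rg (D.am (k + 1) i) x - D.V k x) := by
  have e : D.V (k + 1) x = D.V k x + ∑ i ∈ D.GG (k + 1),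
      bump D.z (D.ell (k + 1)) i x • (rg (D.am (k + 1) i) x - D.V k x) := rfl
  rw [e]
  refine congrArg (D.V k x + ·) ?_
  refine (Finset.sum_subset Finset.inter_subset_left fun i hi hi' => ?_).symm
  have : i ∉ nb D.z (D.ell (k + 1)) x := fun h => hi' (Finset.mem_inter.2 ⟨hi, h⟩)
  rw [bump_eq_zero this, zero_smul]

lemma fderiv_V_succ (k : ℕ) (x : E2) : fderiv ℝ (D.V (k + 1)) x = fderiv ℝ (D.V k) x +
    ∑ i ∈ D.act (k + 1) x, (bump D.z (D.ell (k + 1)) i x •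
      (rgD (D.am (k + 1) i) - fderiv ℝ (D.V k) x) +
      (fderiv ℝ (bump D.z (D.ell (k + 1)) i) x).smulRight
        (rg (D.am (k + 1) i) x - D.V k x)) := by
  have h := hasFDerivAt_blend (D.differentiable_V k x).hasFDerivAt (D.GG (k + 1))
    (fun i _ => hasFDerivAt_bump D.z (D.ell (k + 1)) i x)
    (fun i _ => rg_hasFDerivAt (D.am (k + 1) i) x)
  have e : fderiv ℝ (D.V (k + 1)) x = _ := h.fderiv
  rw [e]
  congr 1
  refine (Finset.sum_subset Finset.inter_subset_left fun i hi hi' => ?_).symm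
  have : i ∉ nb D.z (D.ell (k + 1)) x := fun h => hi' (Finset.mem_inter.2 ⟨hi, h⟩)
  rw [bump_eq_zero this, fderiv_bump_eq_zero this]
  refine ContinuousLinearMap.ext fun y => ?_
  simp

lemma sum_act_le (k : ℕ) (x : E2) : ∑ i ∈ D.act k x, bump D.z (D.ell k) i x ≤ 1 := by
  rw [← sum_bump_eq_one D.z (D.ell k) x]
  exact Finset.sum_le_sum_of_subset_of_nonneg Finset.inter_subset_right
    fun i _ _ => bump_nonneg _ _ _ _

lemma card_act_le (k : ℕ) (x : E2) : (D.act k x).card ≤ 4 :=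
  (Finset.card_le_card Finset.inter_subset_right).trans (card_nb_le _ _ _)

lemma cl_zero (i : Fin 2 → ℤ) : cl 0 i = fun _ => 1 := by
  funext c; simp [cl, nn]

lemma full_bound {k : ℕ} {x : E2} (hfull : ∀ j ∈ nb D.z (D.ell k) x, D.Good k j)
    {L : E2 →L[ℝ] E2} {w : E2} {δ : ℝ} (hδ : 0 ≤ δ)
    (hw : ∀ j ∈ nb D.z (D.ell k) x, ‖rg (D.am k j) x - w‖ ≤ δ)
    (hL : ∀ j ∈ nb D.z (D.ell k) x, ‖rgD (D.am k j) - L‖ ≤ δ / D.ell k) :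
    ‖D.V k x - w‖ ≤ δ ∧ ‖fderiv ℝ (D.V k) x - L‖ ≤ (1 + 8 * cH) * δ / D.ell k := by
  have hc := cH_pos
  have hℓ := D.ell_pos k
  have hle : δ / D.ell k ≤ (1 + 8 * cH) * δ / D.ell k := by
    gcongr
    nlinarith
  obtain rfl | ⟨k, rfl⟩ : k = 0 ∨ ∃ m, k = m + 1 := by
    cases k <;> simp
  · have hne : (nb D.z (D.ell 0) x).Nonempty := by
      by_contra h
      have h1 := sum_bump_eq_one D.z (D.ell 0) x
      rw [Finset.not_nonempty_iff_eq_empty.1 h] at h1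
      simp at h1
    obtain ⟨j, hj⟩ := hne
    have e : D.am 0 j = D.a0 := by rw [am, cl_zero, a0]
    have h1 := hw j hj
    have h2 := hL j hj
    rw [e] at h1 h2
    refine ⟨h1, ?_⟩
    have e2 : fderiv ℝ (D.V 0) x = rgD D.a0 := (rg_hasFDerivAt _ _).fderiv
    rw [e2]
    exact h2.trans hle
  · have hact : D.act (k + 1) x = nb D.z (D.ell (k + 1)) x := by
      ext i
      rw [mem_act]
      exact ⟨fun h => h.2, fun h => ⟨hfull i h, h⟩⟩
    have s1 := sum_bump_eq_one D.z (D.ell (k + 1)) x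
    have s2 := sum_fderiv_bump D.z (D.ell (k + 1)) x
    have hV := D.V_succ k x
    have hV' := D.fderiv_V_succ k x
    rw [hact] at hV hV'
    set N := nb D.z (D.ell (k + 1)) x
    set φ := fun i => bump D.z (D.ell (k + 1)) i x
    have b0 : ∀ i ∈ N, 0 ≤ φ i := fun i _ => bump_nonneg _ _ _ _
    constructor
    · have e : D.V (k + 1) x - w = ∑ i ∈ N, φ i • (rg (D.am (k + 1) i) x - w) := by
        rw [hV]
        exact blend_sub_eq_of_sum s1 _ _ _
      rw [e]
      exact norm_blend_le b0 s1.le hδ hw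
    · have e : fderiv ℝ (D.V (k + 1)) x - L = ∑ i ∈ N, φ i • (rgD (D.am (k + 1) i) - L) +
          ∑ i ∈ N, (fderiv ℝ (bump D.z (D.ell (k + 1)) i) x).smulRight
            (rg (D.am (k + 1) i) x - w) := by
        have e3 : ∀ v : E2, ∑ i ∈ N,
            (fderiv ℝ (bump D.z (D.ell (k + 1)) i) x).smulRight (rg (D.am (k + 1) i) x - v) =
            ∑ i ∈ N, (fderiv ℝ (bump D.z (D.ell (k + 1)) i) x).smulRight
              (rg (D.am (k + 1) i) x) := by
          intro v
          refine ContinuousLinearMap.ext fun y => ?_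
          simp only [_root_.sum_apply, ContinuousLinearMap.smulRight_apply, smul_sub,
            Finset.sum_sub_distrib, ← Finset.sum_smul]
          rw [← _root_.sum_apply, s2]
          simp
        rw [hV', Finset.sum_add_distrib, e3, e3, ← add_assoc, add_sub_right_comm]
        congr 1
        exact blend_sub_eq_of_sum s1 (fun i => rgD (D.am (k + 1) i)) (fderiv ℝ (D.V k) x) L
      rw [e]
      refine (norm_add_le _ _).trans ?_
      have h1 := norm_blend_le b0 s1.le (div_nonneg hδ hℓ.le) hL
      have h2 := norm_sum_smulRight_le (G := N) (c := 2 * cH / D.ell (k + 1)) (by positivity) hδ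
        (card_nb_le _ _ _) (fun i _ => norm_fderiv_bump_le D.z hℓ i x) hw
      refine (add_le_add h1 h2).trans (le_of_eq ?_)
      field_simp
      ring

/-- The comparison error at a point. -/
def del (k : ℕ) (x : E2) : ℝ := 194 * cW * √(D.Phi k x).toReal

lemma cW_pos : 0 < cW := by rw [cW]; norm_num

lemma del_nonneg (k : ℕ) (x : E2) : 0 ≤ D.del k x := by
  have := cW_pos
  unfold del; positivity

lemma compare_at {k m m' : ℕ} (hm : m = k ∨ m = k + 1) (hm' : m' = k ∨ m' = k + 1) {x : E2}
    {i i' o : Fin 2 → ℤ}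
    (hi : i ∈ nb D.z (D.ell m) x) (hg : D.Good m i)
    (hi' : i' ∈ nb D.z (D.ell m') x) (hg' : D.Good m' i')
    (ho : win (D.pos (k + 1) o) (D.ell (k + 1)) ⊆ D.W m (cl m i))
    (ho' : win (D.pos (k + 1) o) (D.ell (k + 1)) ⊆ D.W m' (cl m' i'))
    (hx : ∀ y ∈ win (D.pos (k + 1) o) (D.ell (k + 1)), ∀ c, |x c - y c| ≤ 6 * D.ell (k + 1)) :
    ‖rg (D.am m i) x - rg (D.am m' i') x‖ ≤ D.del k x ∧
      ‖rgD (D.am m i) - rgD (D.am m' i')‖ ≤ D.del k x / D.ell (k + 1) := by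
  have hℓ := D.ell_pos (k + 1)
  have hr : ∀ m, m = k ∨ m = k + 1 → 0 ≤ 2 * D.ell m ∧ 2 * D.ell m ≤ 4 * D.ell (k + 1) := by
    intro m hm
    have h1 := D.ell_pos m
    have h2 := D.ell_succ k
    rcases hm with rfl | rfl <;> constructor <;> linarith
  obtain ⟨h1, y, hy, h2⟩ := near_compare hℓ (hr m hm).1 (hr m' hm').1 (hr m hm).2 (hr m' hm').2
    (D.near_mot_cl hg) (D.near_mot_cl hg') ho ho'
  have a1 := D.amp_le hm hi
  have a2 := D.amp_le hm' hi'
  set q := D.amp m (cl m i) + D.amp m' (cl m' i')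
  have hq0 : 0 ≤ q := (norm_nonneg _).trans h2
  have hq : 97 * q ≤ D.del k x := by
    unfold del; linarith
  have hd : ‖x - y‖ ≤ 12 * D.ell (k + 1) := by
    refine (norm_le_coord (m := 6 * D.ell (k + 1)) _ fun c => ?_).trans (by linarith)
    exact hx y hy c
  constructor
  · have e : rg (D.am m i) x - rg (D.am m' i') x =
        (rg (D.am m i) y - rg (D.am m' i') y) + rgD (D.am m i - D.am m' i') (x - y) := by
      rw [rgD_sub_eq, sub_apply, ← rg_sub_rg, ← rg_sub_rg]; abel
    rw [e]
    refine (norm_add_le _ _).trans ?_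
    rw [norm_rgD_apply]
    have h3 : |(D.am m i - D.am m' i').1| * ‖x - y‖ ≤
        8 * q / D.ell (k + 1) * (12 * D.ell (k + 1)) := by
      gcongr
      exact h1
    have e4 : 8 * q / D.ell (k + 1) * (12 * D.ell (k + 1)) = 96 * q := by field_simp; ring
    have h2' : ‖rg (D.am m i) y - rg (D.am m' i') y‖ ≤ q := h2
    linarith
  · rw [← rgD_sub_eq]
    refine (norm_rgD_le _).trans (h1.trans ?_)
    gcongr
    linarith

lemma dist_of_nb {k : ℕ} {x y : E2} {i : Fin 2 → ℤ} (hi : i ∈ nb D.z (D.ell k) x)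
    (hr : ∀ c, -3 ≤ i c ∧ i c ≤ nn k + 3) (hy : y ∈ D.W k (cl k i)) (c : Fin 2) :
    |x c - y c| ≤ 6 * D.ell k := by
  have h1 := D.mem_nb_tt.1 hi c
  have h2 := D.mem_W.1 hy c
  have h3 : |i c - cl k i c| ≤ 4 := by
    have := hr c
    have := two_le_nn k
    simp only [cl]
    rw [abs_le]
    omega
  have h3' : |(i c : ℝ) - cl k i c| ≤ 4 := by exact_mod_cast h3
  have e : x c - y c = D.ell k * (D.tt k x c - D.tt k y c) := by
    rw [mul_sub, ell_mul_tt, ell_mul_tt]; ring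
  rw [e, abs_mul, abs_of_pos (D.ell_pos k), mul_comm]
  have h4 : |D.tt k x c - D.tt k y c| ≤ 6 := by
    rw [abs_le] at h3' ⊢
    constructor <;> linarith
  have := D.ell_pos k
  gcongr

lemma compare_same {k : ℕ} {x : E2} {i i' : Fin 2 → ℤ}
    (hi : i ∈ D.act (k + 1) x) (hi' : i' ∈ D.act (k + 1) x) :
    ‖rg (D.am (k + 1) i) x - rg (D.am (k + 1) i') x‖ ≤ D.del k x ∧
      ‖rgD (D.am (k + 1) i) - rgD (D.am (k + 1) i')‖ ≤ D.del k x / D.ell (k + 1) := by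
  rw [mem_act] at hi hi'
  have hc := D.cl_close hi.2 hi'.2
  have hc' := D.cl_close hi'.2 hi.2
  have sub : ∀ b : Fin 2 → ℤ, (∀ c, b c ≤ max (cl (k + 1) i c) (cl (k + 1) i' c) ∧
      max (cl (k + 1) i c) (cl (k + 1) i' c) ≤ b c + 1) →
      win (D.pos (k + 1) fun c => max (cl (k + 1) i c) (cl (k + 1) i' c)) (D.ell (k + 1)) ⊆
        D.W (k + 1) b := by
    intro b hb y hy
    rw [mem_W]
    rw [← one_mul (D.ell (k + 1)), mem_win_pos] at hy
    intro c
    have h1 := hy c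
    have h2 := hb c
    have h3 : (b c : ℝ) ≤ ((max (cl (k + 1) i c) (cl (k + 1) i' c) : ℤ) : ℝ) := by
      exact_mod_cast h2.1
    have h4 : ((max (cl (k + 1) i c) (cl (k + 1) i' c) : ℤ) : ℝ) ≤ b c + 1 := by
      exact_mod_cast h2.2
    constructor <;> linarith
  refine D.compare_at (Or.inr rfl) (Or.inr rfl) hi.2 hi.1 hi'.2 hi'.1
    (o := fun c => max (cl (k + 1) i c) (cl (k + 1) i' c)) (sub _ fun c => ?_) (sub _ fun c => ?_)
    fun y hy c => D.dist_of_nb hi.2 hi.1.1 (sub _ (fun c => ?_) hy) c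
  all_goals
    have := hc c
    have := hc' c
    omega

lemma compare_cross {k : ℕ} {x : E2} {i j : Fin 2 → ℤ}
    (hi : i ∈ D.act (k + 1) x) (hj : j ∈ nb D.z (D.ell k) x) :
    ‖rg (D.am k j) x - rg (D.am (k + 1) i) x‖ ≤ D.del k x ∧
      ‖rgD (D.am k j) - rgD (D.am (k + 1) i)‖ ≤ D.del k x / D.ell (k + 1) := by
  rw [mem_act] at hi
  have hc := D.cl_close_succ hi.2 hj
  have sub : win (D.pos (k + 1) fun c => max (cl (k + 1) i c) (2 * cl k j c)) (D.ell (k + 1)) ⊆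
      D.W (k + 1) (cl (k + 1) i) := by
    intro y hy
    rw [mem_W]
    rw [← one_mul (D.ell (k + 1)), mem_win_pos] at hy
    intro c
    have h1 := hy c
    have h2 := hc c
    have h3 : (cl (k + 1) i c : ℝ) ≤ ((max (cl (k + 1) i c) (2 * cl k j c) : ℤ) : ℝ) := by
      exact_mod_cast le_max_left _ _
    have h4 : ((max (cl (k + 1) i c) (2 * cl k j c) : ℤ) : ℝ) ≤ cl (k + 1) i c + 1 := by
      have : max (cl (k + 1) i c) (2 * cl k j c) ≤ cl (k + 1) i c + 1 := by omega
      exact_mod_cast this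
    constructor <;> linarith
  have sub' : win (D.pos (k + 1) fun c => max (cl (k + 1) i c) (2 * cl k j c))
      (D.ell (k + 1)) ⊆ D.W k (cl k j) := by
    intro y hy
    rw [mem_W]
    rw [← one_mul (D.ell (k + 1)), mem_win_pos] at hy
    intro c
    have h1 := hy c
    rw [tt_succ] at h1
    have h2 := hc c
    have h3 : 2 * (cl k j c : ℝ) ≤ ((max (cl (k + 1) i c) (2 * cl k j c) : ℤ) : ℝ) := by
      exact_mod_cast le_max_right _ _
    have h4 : ((max (cl (k + 1) i c) (2 * cl k j c) : ℤ) : ℝ) ≤ 2 * (cl k j c) + 3 := by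
      have : max (cl (k + 1) i c) (2 * cl k j c) ≤ 2 * cl k j c + 3 := by omega
      exact_mod_cast this
    constructor <;> linarith
  exact D.compare_at (Or.inl rfl) (Or.inr rfl) hj (D.good_down hi.1 hi.2 hj) hi.2 hi.1 sub' sub
    fun y hy c => D.dist_of_nb hi.2 hi.1.1 (sub hy) c

/-- The gradient of the approximations is close to the local rigid motions. -/
lemma fderiv_V_sub_le {k : ℕ} {x : E2} {i : Fin 2 → ℤ} (hi : i ∈ D.act (k + 1) x) :
    ‖fderiv ℝ (D.V (k + 1)) x - rgD (D.am (k + 1) i)‖ ≤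
      (2 + 32 * cH) * D.del k x / D.ell (k + 1) := by
  have hc := cH_pos
  have hℓ := D.ell_pos (k + 1)
  have hδ := D.del_nonneg k x
  have hs := D.ell_succ k
  have hi2 := D.mem_act.1 hi
  set L := rgD (D.am (k + 1) i)
  set w := rg (D.am (k + 1) i) x
  obtain ⟨f1, f2⟩ := D.full_bound (k := k) (x := x) (L := L) (w := w) (δ := 2 * D.del k x)
    (fun j hj => D.good_down hi2.1 hi2.2 hj) (by positivity)
    (fun j hj => (D.compare_cross hi hj).1.trans (by linarith))
    (fun j hj => (D.compare_cross hi hj).2.trans (le_of_eq (by rw [hs]; field_simp)))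
  have hV' := D.fderiv_V_succ k x
  rw [Finset.sum_add_distrib, ← add_assoc] at hV'
  have s1 := D.sum_act_le (k + 1) x
  set N := D.act (k + 1) x
  have g1 := norm_blend_sub_le (G := N) (φ := fun i => bump D.z (D.ell (k + 1)) i x)
    (v := fun i => rgD (D.am (k + 1) i)) (f := fderiv ℝ (D.V k) x) (L := L)
    (fun i _ => bump_nonneg _ _ _ _) s1 (div_nonneg hδ hℓ.le)
    (fun j hj => (D.compare_same hj hi).2)
  have g2 := norm_sum_smulRight_le (G := N) (c := 2 * cH / D.ell (k + 1))
    (δ := 3 * D.del k x) (φ' := fun i => fderiv ℝ (bump D.z (D.ell (k + 1)) i) x)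
    (v := fun i => rg (D.am (k + 1) i) x - D.V k x) (by positivity) (by positivity)
    (D.card_act_le (k + 1) x) (fun i _ => norm_fderiv_bump_le D.z hℓ i x) (fun j hj => by
      have e : rg (D.am (k + 1) j) x - D.V k x = (rg (D.am (k + 1) j) x - w) - (D.V k x - w) := by
        abel
      rw [e]
      refine (norm_sub_le _ _).trans ?_
      linarith [(D.compare_same hj hi).1])
  rw [hV', add_sub_right_comm]
  refine (norm_add_le _ _).trans ((add_le_add g1 g2).trans ?_)
  have f3 : (1 + 8 * cH) * (2 * D.del k x) / D.ell k = (1 + 8 * cH) * D.del k x / D.ell (k + 1) := by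
    rw [hs]; field_simp
  rw [f3] at f2
  refine (add_le_add (add_le_add f2 le_rfl) le_rfl).trans (le_of_eq ?_)
  field_simp
  ring

lemma fderiv_V_succ_of_empty {k : ℕ} {x : E2} (h : D.act (k + 1) x = ∅) :
    fderiv ℝ (D.V (k + 1)) x = fderiv ℝ (D.V k) x := by
  rw [fderiv_V_succ, h, Finset.sum_empty, add_zero]

end Setup

end PiecewiseKorn

namespace PiecewiseKorn

lemma card_le_two_of_close {T : Finset ℕ} (h : ∀ a ∈ T, ∀ b ∈ T, b ≤ a + 1) : T.card ≤ 2 := by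
  rcases T.eq_empty_or_nonempty with rfl | hne
  · simp
  · have hsub : T ⊆ {T.min' hne, T.min' hne + 1} := by
      intro b hb
      have h1 := T.min'_le b hb
      have h2 := h _ (T.min'_mem hne) b hb
      simp only [Finset.mem_insert, Finset.mem_singleton]
      omega
    exact (Finset.card_le_card hsub).trans Finset.card_le_two

namespace Setup

variable (D : Setup)

/-- The points whose last active level, among the levels up to `N`, is `k`. -/
def X (N k : ℕ) : Set E2 :=
  {x | (D.act k x).Nonempty ∧ (k < N → D.act (k + 1) x = ∅)}

lemma measurableSet_nb (k : ℕ) (i : Fin 2 → ℤ) : MeasurableSet {x | i ∈ nb D.z (D.ell k) x} := by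
  simp only [mem_nb]
  have h : ∀ c : Fin 2, Measurable fun x : E2 => (x c - D.z c) / D.ell k := fun c => by fun_prop
  have e : {x : E2 | ∀ c, (i c : ℝ) ≤ (x c - D.z c) / D.ell k ∧ (x c - D.z c) / D.ell k < i c + 2} =
      ⋂ c, ({x : E2 | (i c : ℝ) ≤ (x c - D.z c) / D.ell k} ∩
        {x : E2 | (x c - D.z c) / D.ell k < i c + 2}) := by
    ext x
    simp only [mem_ofPred_eq, mem_iInter, mem_inter_iff]
  rw [e]
  exact MeasurableSet.iInter fun c => (measurableSet_le measurable_const (h c)).inter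
    (measurableSet_lt (h c) measurable_const)

/-- The points at which level `k` is active. -/
def Om (k : ℕ) : Set E2 := {x | (D.act k x).Nonempty}

lemma measurableSet_Om (k : ℕ) : MeasurableSet (D.Om k) := by
  have e : D.Om k = ⋃ i ∈ D.GG k, {x | i ∈ nb D.z (D.ell k) x} := by
    ext x
    simp only [Om, Finset.Nonempty, act, Finset.mem_inter, mem_ofPred_eq, mem_iUnion, exists_prop]
  rw [e]
  exact (D.GG k).measurableSet_biUnion fun i _ => D.measurableSet_nb k i

lemma measurableSet_X (N k : ℕ) : MeasurableSet (D.X N k) := by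
  by_cases h : k < N
  · have e : D.X N k = D.Om k \ D.Om (k + 1) := by
      ext x
      simp only [X, Om, h, mem_ofPred_eq, mem_sdiff, forall_true_left,
        Finset.not_nonempty_iff_eq_empty]
    rw [e]
    exact (D.measurableSet_Om k).diff (D.measurableSet_Om (k + 1))
  · have e : D.X N k = D.Om k := by
      ext x
      simp only [X, Om, h, mem_ofPred_eq, false_imp_iff, and_true]
    rw [e]
    exact D.measurableSet_Om k

lemma measurableSet_W (k : ℕ) (i : Fin 2 → ℤ) : MeasurableSet (D.W k i) :=
  (isOpen_win _ _).measurableSet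

lemma isOpen_Rel (k : ℕ) (x : E2) : IsOpen (D.Rel k x) :=
  isOpen_biUnion fun _ _ => isOpen_win _ _

/-- The points seen from a set. -/
def See (m : ℕ) (A : Set E2) : Set E2 := ⋃ x ∈ A, D.Rel m x

lemma isOpen_See (m : ℕ) (A : Set E2) : IsOpen (D.See m A) :=
  isOpen_biUnion fun _ _ => D.isOpen_Rel _ _

lemma measurableSet_rel (m : ℕ) {A : Set E2} (hA : MeasurableSet A) :
    MeasurableSet {q : E2 × E2 | q.1 ∈ A ∧ q.2 ∈ D.Rel m q.1} := by
  have e : {q : E2 × E2 | q.1 ∈ A ∧ q.2 ∈ D.Rel m q.1} =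
      ⋃ i : Fin 2 → ℤ, (A ∩ {x | i ∈ nb D.z (D.ell m) x}) ×ˢ D.W m (cl m i) := by
    ext ⟨x, y⟩
    simp only [Rel, mem_ofPred_eq, mem_iUnion, exists_prop, mem_prod, mem_inter_iff]
    constructor
    · rintro ⟨h, i, hi, hy⟩; exact ⟨i, ⟨h, hi⟩, hy⟩
    · rintro ⟨i, ⟨h, hi⟩, hy⟩; exact ⟨h, i, hi, hy⟩
  rw [e]
  exact MeasurableSet.iUnion fun i => (hA.inter (D.measurableSet_nb m i)).prod
    (D.measurableSet_W m _)

lemma measurable_En_Rel (m : ℕ) : Measurable fun x => En D.u (D.Rel m x) := by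
  set R := {q : E2 × E2 | q.1 ∈ (univ : Set E2) ∧ q.2 ∈ D.Rel m q.1}
  have hR : MeasurableSet R := D.measurableSet_rel m MeasurableSet.univ
  have h : Measurable fun x => ∫⁻ y, R.indicator (fun q => gE D.u q.2) (x, y) :=
    Measurable.lintegral_prod_right' (((measurable_gE D.u).comp measurable_snd).indicator hR)
  convert h using 2 with x
  rw [En, ← lintegral_indicator (D.isOpen_Rel m x).measurableSet]
  refine lintegral_congr fun y => ?_
  by_cases hy : y ∈ D.Rel m x
  · rw [indicator_of_mem hy, indicator_of_mem (show (x, y) ∈ R from ⟨mem_univ _, hy⟩)]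
  · rw [indicator_of_notMem hy, indicator_of_notMem (show (x, y) ∉ R from fun q => hy q.2)]

lemma lintegral_En_Rel_le (m : ℕ) {A : Set E2} (hA : MeasurableSet A) {ρ : ℝ} (hρ : 0 ≤ ρ)
    (h : ∀ x ∈ A, ∀ y ∈ D.Rel m x, x ∈ cube y ρ) :
    ∫⁻ x in A, En D.u (D.Rel m x) ≤
      ENNReal.ofReal (4 * ρ ^ 2) * ∫⁻ y in win D.z D.s, (D.See m A).indicator (gE D.u) y := by
  set R := {q : E2 × E2 | q.1 ∈ A ∧ q.2 ∈ D.Rel m q.1} with hR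
  have hRm : MeasurableSet R := D.measurableSet_rel m hA
  have hgE : Measurable (gE D.u) := measurable_gE D.u
  have h1 : ∫⁻ x in A, En D.u (D.Rel m x) =
      ∫⁻ x, ∫⁻ y, R.indicator (fun q => gE D.u q.2) (x, y) := by
    rw [← lintegral_indicator hA]
    refine lintegral_congr fun x => ?_
    by_cases hx : x ∈ A
    · rw [indicator_of_mem hx, En, ← lintegral_indicator (D.isOpen_Rel m x).measurableSet]
      refine lintegral_congr fun y => ?_
      by_cases hy : y ∈ D.Rel m x
      · rw [indicator_of_mem hy, indicator_of_mem (show (x, y) ∈ R from ⟨hx, hy⟩)]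
      · rw [indicator_of_notMem hy, indicator_of_notMem (show (x, y) ∉ R from fun q => hy q.2)]
    · rw [indicator_of_notMem hx]
      symm
      rw [lintegral_eq_zero_iff']
      · exact Filter.Eventually.of_forall fun y =>
          indicator_of_notMem (show (x, y) ∉ R from fun q => hx q.1) _
      · exact (((hgE.comp measurable_snd).indicator hRm).comp
          measurable_prodMk_left).aemeasurable
  rw [h1, lintegral_lintegral_swap]
  swap
  · exact ((hgE.comp measurable_snd).indicator hRm).aemeasurable
  rw [← lintegral_const_mul _ (hgE.indicator (D.isOpen_See m A).measurableSet),
    ← lintegral_indicator (isOpen_win _ _).measurableSet]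
  refine lintegral_mono fun y => ?_
  by_cases hy : ∃ x ∈ A, y ∈ D.Rel m x
  · obtain ⟨x, hx, hxy⟩ := hy
    have hS : y ∈ win D.z D.s := D.Rel_subset m x hxy
    have hSee : y ∈ D.See m A := mem_biUnion hx hxy
    rw [indicator_of_mem hS, indicator_of_mem hSee]
    calc ∫⁻ x, R.indicator (fun q => gE D.u q.2) (x, y)
        ≤ ∫⁻ x, (cube y ρ).indicator (fun _ => gE D.u y) x := by
          refine lintegral_mono fun x => ?_
          by_cases hq : (x, y) ∈ R
          · rw [indicator_of_mem hq, indicator_of_mem (h x hq.1 y hq.2)]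
          · rw [indicator_of_notMem hq]; exact zero_le
      _ = gE D.u y * volume (cube y ρ) := by
          rw [lintegral_indicator (isClosed_cube _ _).measurableSet, setLIntegral_const]
      _ = ENNReal.ofReal (4 * ρ ^ 2) * gE D.u y := by rw [volume_cube y hρ, mul_comm]
  · have e : ∀ x, R.indicator (fun q => gE D.u q.2) (x, y) = 0 := fun x =>
      indicator_of_notMem (fun q => hy ⟨x, q.1, q.2⟩) _
    simp only [e, lintegral_zero]
    exact zero_le

lemma good_near {k : ℕ} {x : E2} (hx : (D.act k x).Nonempty) {i : Fin 2 → ℤ}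
    (hi : i ∈ nb D.z (D.ell k) x) (c : Fin 2) : -4 ≤ i c ∧ i c ≤ nn k + 4 := by
  obtain ⟨j, hj⟩ := hx
  rw [mem_act] at hj
  have h1 := hj.1.1 c
  have h2 := D.nb_close hi hj.2 c
  have h3 := D.nb_close hj.2 hi c
  omega

lemma mem_cube_of_range {m : ℕ} {x y : E2} {i : Fin 2 → ℤ}
    (hi : i ∈ nb D.z (D.ell m) x) (hr : ∀ c, -4 ≤ i c ∧ i c ≤ nn m + 4)
    (hy : y ∈ D.W m (cl m i)) : x ∈ cube y (8 * D.ell m) := by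
  intro c
  have h1 := D.mem_nb_tt.1 hi c
  have h2 := D.mem_W.1 hy c
  have h3 : |i c - cl m i c| ≤ 5 := by
    have := hr c
    have := two_le_nn m
    simp only [cl]
    rw [abs_le]
    omega
  have h3' : |(i c : ℝ) - cl m i c| ≤ 5 := by exact_mod_cast h3
  have e : x c - y c = D.ell m * (D.tt m x c - D.tt m y c) := by
    rw [mul_sub, ell_mul_tt, ell_mul_tt]; ring
  rw [e, abs_mul, abs_of_pos (D.ell_pos m), mul_comm]
  have h4 : |D.tt m x c - D.tt m y c| ≤ 8 := by
    rw [abs_le] at h3' ⊢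
    constructor <;> linarith
  have := D.ell_pos m
  gcongr

/-- Indices that are relevant for a point with an active level are close to the grid. -/
lemma range_of_act {k m : ℕ} (hm : m = k ∨ m = k + 1) {x : E2} (hx : (D.act (k + 1) x).Nonempty)
    {i : Fin 2 → ℤ} (hi : i ∈ nb D.z (D.ell m) x) (c : Fin 2) : -4 ≤ i c ∧ i c ≤ nn m + 4 := by
  rcases hm with rfl | rfl
  · obtain ⟨j, hj⟩ := hx
    rw [mem_act] at hj
    have := (D.good_down hj.1 hj.2 hi).1 c
    omega
  · exact D.good_near hx hi c

lemma tt_scale {m m' : ℕ} (y : E2) (c : Fin 2) :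
    D.ell m * D.tt m y c = D.ell m' * D.tt m' y c := by
  rw [ell_mul_tt, ell_mul_tt]

lemma le_succ_of_ell {m m' : ℕ} {v v' : ℝ} (h : D.ell m * v = D.ell m' * v')
    (hv : 1 < v ∧ v < 3) (hv' : 1 < v' ∧ v' < 3) : m' ≤ m + 1 := by
  by_contra! hlt
  have h1 : D.ell m' ≤ D.ell (m + 1 + 1) := D.ell_anti hlt
  have h2 := D.ell_succ m
  have h3 := D.ell_succ (m + 1)
  have h4 := D.ell_pos m'
  nlinarith [D.ell_pos m]

lemma card_see_le (N : ℕ) (e : ℕ) (he : e = 0 ∨ e = 1) (y : E2) (T : Finset ℕ)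
    (hT : ∀ k ∈ T, k < N ∧ y ∈ D.See (k + e) (D.X N (k + 1))) : T.card ≤ 10 := by
  classical
  set A : Fin 2 → Finset ℕ := fun c =>
    T.filter fun k => 1 < D.tt (k + e) y c ∧ D.tt (k + e) y c < 3 with hA
  set B : Fin 2 → Finset ℕ := fun c => T.filter fun k =>
    1 < (nn (k + e) : ℝ) + 2 - D.tt (k + e) y c ∧ (nn (k + e) : ℝ) + 2 - D.tt (k + e) y c < 3
    with hB
  set U : Finset ℕ := T.filter fun k => ∃ x ∈ D.X N (k + 1),
    (∀ c, |x c - y c| ≤ 2 * D.ell (k + e)) ∧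
    (∀ c, 0 ≤ D.tt (k + 1) x c ∧ D.tt (k + 1) x c ≤ (nn (k + 1) : ℝ) + 2) with hU
  have hsub : T ⊆ (A 0 ∪ A 1) ∪ (B 0 ∪ B 1) ∪ U := by
    intro k hk
    obtain ⟨hkN, hsee⟩ := hT k hk
    simp only [See, mem_iUnion, exists_prop, Rel] at hsee
    obtain ⟨x, hx, i, hi, hy⟩ := hsee
    have hy2 := D.mem_W.1 hy
    have hi2 := D.mem_nb_tt.1 hi
    have hn := two_le_nn (k + e)
    by_cases hlow : ∃ c, i c < 1
    · obtain ⟨c, hc⟩ := hlow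
      have e1 : cl (k + e) i c = 1 := by simp only [cl]; omega
      have h3 := hy2 c
      rw [e1] at h3
      have : k ∈ A c := by
        simp only [hA, Finset.mem_filter]
        refine ⟨hk, ?_, ?_⟩
        · have := h3.1; push_cast at this; linarith
        · have := h3.2; push_cast at this; linarith
      fin_cases c
      · simp only [Finset.mem_union]; exact Or.inl (Or.inl (Or.inl this))
      · simp only [Finset.mem_union]; exact Or.inl (Or.inl (Or.inr this))
    by_cases hhigh : ∃ c, nn (k + e) - 1 < i c
    · obtain ⟨c, hc⟩ := hhigh
      have e1 : cl (k + e) i c = nn (k + e) - 1 := by simp only [cl]; omega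
      have h3 := hy2 c
      rw [e1] at h3
      have : k ∈ B c := by
        simp only [hB, Finset.mem_filter]
        refine ⟨hk, ?_, ?_⟩
        · have := h3.2; push_cast at this; linarith
        · have := h3.1; push_cast at this; linarith
      fin_cases c
      · simp only [Finset.mem_union]; exact Or.inl (Or.inr (Or.inl this))
      · simp only [Finset.mem_union]; exact Or.inl (Or.inr (Or.inr this))
    push Not at hlow hhigh
    refine Finset.mem_union.2 (Or.inr ?_)
    simp only [hU, Finset.mem_filter]
    refine ⟨hk, x, hx, fun c => ?_, fun c => ?_⟩
    · have e1 : cl (k + e) i c = i c := by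
        have := hlow c
        have := hhigh c
        simp only [cl]; omega
      have h3 := hy2 c
      have h4 := hi2 c
      rw [e1] at h3
      have e2 : x c - y c = D.ell (k + e) * (D.tt (k + e) x c - D.tt (k + e) y c) := by
        rw [mul_sub, ell_mul_tt, ell_mul_tt]; ring
      rw [e2, abs_mul, abs_of_pos (D.ell_pos _), mul_comm]
      have := D.ell_pos (k + e)
      have h5 : |D.tt (k + e) x c - D.tt (k + e) y c| ≤ 2 := by
        rw [abs_le]; constructor <;> linarith
      gcongr
    · have h4 := hi2 c
      have a1 : (1 : ℝ) ≤ i c := by exact_mod_cast hlow c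
      have a2 : (i c : ℝ) ≤ nn (k + e) - 1 := by exact_mod_cast hhigh c
      have hS : 0 ≤ D.tt (k + e) x c ∧ D.tt (k + e) x c ≤ (nn (k + e) : ℝ) + 2 := by
        constructor <;> linarith
      rcases he with rfl | rfl
      · rw [tt_succ, nn_succ]
        push_cast
        rw [add_zero] at hS
        constructor <;> linarith [hS.1, hS.2]
      · exact hS
  have cA : ∀ c, (A c).card ≤ 2 := fun c => card_le_two_of_close fun a ha b hb => by
    simp only [hA, Finset.mem_filter] at ha hb
    have := D.le_succ_of_ell (D.tt_scale (m := a + e) (m' := b + e) y c) ha.2 hb.2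
    omega
  have cB : ∀ c, (B c).card ≤ 2 := fun c => card_le_two_of_close fun a ha b hb => by
    simp only [hB, Finset.mem_filter] at ha hb
    have h := D.tt_scale (m := a + e) (m' := b + e) y c
    have h1 := D.ell_mul_nn (a + e)
    have h2 := D.ell_mul_nn (b + e)
    have := D.le_succ_of_ell (m := a + e) (m' := b + e) (by rw [mul_sub, mul_sub, h1, h2, h])
      ha.2 hb.2
    omega
  have cU : U.card ≤ 2 := card_le_two_of_close fun a ha b hb => by
    simp only [hU, Finset.mem_filter] at ha hb
    by_contra! hlt
    obtain ⟨haT, x, hx, hxy, hxS⟩ := ha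
    obtain ⟨hbT, x', hx', hxy', -⟩ := hb
    obtain ⟨i', hi'⟩ := hx'.1
    rw [mem_act] at hi'
    have hl : ∀ k, D.ell (k + e) ≤ 2 * D.ell (k + 1) := by
      intro k
      have := D.ell_pos (k + 1)
      rcases he with rfl | rfl
      · exact (D.ell_succ k).le
      · linarith
    have hd : ∀ c, |x c - x' c| ≤ 4 * D.ell (a + 1) + 4 * D.ell (b + 1) := fun c => by
      have h1 := abs_le.1 (hxy c)
      have h2 := abs_le.1 (hxy' c)
      have h3 := hl a
      have h4 := hl b
      rw [abs_le]
      constructor <;> linarith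
    obtain ⟨i, hi, hg⟩ := D.good_transfer (k := a + 1) (k' := b + 1) (by omega) (x := x) (x' := x')
      hi'.1 hi'.2 hd hxS
    have h0 := hx.2 (lt_of_lt_of_le hlt (by have := (hT b hbT).1; omega))
    have : i ∈ D.act (a + 1 + 1) x := D.mem_act.2 ⟨hg, hi⟩
    exact absurd (h0 ▸ this) (Finset.notMem_empty i)
  refine (Finset.card_le_card hsub).trans ?_
  have u1 := Finset.card_union_le ((A 0 ∪ A 1) ∪ (B 0 ∪ B 1)) U
  have u2 := Finset.card_union_le (A 0 ∪ A 1) (B 0 ∪ B 1)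
  have u3 := Finset.card_union_le (A 0) (A 1)
  have u4 := Finset.card_union_le (B 0) (B 1)
  have := cA 0
  have := cA 1
  have := cB 0
  have := cB 1
  omega

lemma sum_see_le (N : ℕ) (e : ℕ) (he : e = 0 ∨ e = 1) :
    ∑ k ∈ Finset.range N, ∫⁻ y in win D.z D.s,
      (D.See (k + e) (D.X N (k + 1))).indicator (gE D.u) y ≤ 10 * En D.u (win D.z D.s) := by
  classical
  have hgE : Measurable (gE D.u) := measurable_gE D.u
  rw [← lintegral_finsetSum _ fun k _ => hgE.indicator (D.isOpen_See _ _).measurableSet, En,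
    ← lintegral_const_mul _ hgE]
  refine lintegral_mono fun y => ?_
  simp only [indicator_apply]
  rw [← Finset.sum_filter, Finset.sum_const, nsmul_eq_mul]
  gcongr
  have h := D.card_see_le N e he y
    ((Finset.range N).filter fun k => y ∈ D.See (k + e) (D.X N (k + 1))) fun k hk => by
      simpa [Finset.mem_filter] using hk
  exact_mod_cast h

/-- The energy density of the windows, summed over the last active levels. -/
lemma sum_lintegral_Phi_le (N : ℕ) :
    ∑ k ∈ Finset.range N, ∫⁻ x in D.X N (k + 1), D.Phi k x / ENNReal.ofReal (D.ell (k + 1) ^ 2) ≤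
      20480 * En D.u (win D.z D.s) := by
  have key : ∀ e, e = 0 ∨ e = 1 → ∑ k ∈ Finset.range N, ∫⁻ x in D.X N (k + 1),
      En D.u (D.Rel (k + e) x) / ENNReal.ofReal (D.ell (k + 1) ^ 2) ≤
        1024 * (10 * En D.u (win D.z D.s)) := by
    intro e he
    refine le_trans ?_ (mul_le_mul_right (D.sum_see_le N e he) 1024)
    rw [Finset.mul_sum]
    refine Finset.sum_le_sum fun k _ => ?_
    have hℓ := D.ell_pos (k + 1)
    have hm : k + e = k ∨ k + e = k + 1 := by omega
    have h := D.lintegral_En_Rel_le (k + e) (D.measurableSet_X N (k + 1))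
      (ρ := 8 * D.ell (k + e)) (by have := D.ell_pos (k + e); positivity) (fun x hx y hy => by
        simp only [Rel, mem_iUnion, exists_prop] at hy
        obtain ⟨i, hi, hy⟩ := hy
        exact D.mem_cube_of_range hi (D.range_of_act hm hx.1 hi) hy)
    simp only [ENNReal.div_eq_inv_mul]
    rw [lintegral_const_mul']
    swap
    · exact ENNReal.inv_ne_top.2 (by simpa using hℓ.ne')
    rw [← ENNReal.div_eq_inv_mul]
    refine ENNReal.div_le_of_le_mul (h.trans ?_)
    rw [mul_right_comm]
    gcongr
    have e2 : (1024 : ℝ≥0∞) = ENNReal.ofReal 1024 := by simp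
    rw [e2, ← ENNReal.ofReal_mul (by norm_num)]
    apply ENNReal.ofReal_le_ofReal
    have h1 : D.ell (k + e) ≤ 2 * D.ell (k + 1) := by
      rcases he with rfl | rfl
      · exact (D.ell_succ k).le
      · linarith
    have h2 := D.ell_pos (k + e)
    nlinarith
  have hdiv : ∀ k x, D.Phi k x / ENNReal.ofReal (D.ell (k + 1) ^ 2) =
      En D.u (D.Rel (k + 1) x) / ENNReal.ofReal (D.ell (k + 1) ^ 2) +
        En D.u (D.Rel (k + 0) x) / ENNReal.ofReal (D.ell (k + 1) ^ 2) := fun k x => by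
    rw [Phi, ENNReal.add_div, add_zero]
  simp only [hdiv]
  have hadd : ∀ k, ∫⁻ x in D.X N (k + 1),
      (En D.u (D.Rel (k + 1) x) / ENNReal.ofReal (D.ell (k + 1) ^ 2) +
        En D.u (D.Rel (k + 0) x) / ENNReal.ofReal (D.ell (k + 1) ^ 2)) = _ := fun k =>
    lintegral_add_left ((D.measurable_En_Rel (k + 1)).div_const _) _
  simp only [hadd]
  rw [Finset.sum_add_distrib]
  refine (add_le_add (key 1 (Or.inr rfl)) (key 0 (Or.inl rfl))).trans (le_of_eq ?_)
  ring

end Setup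

end PiecewiseKorn

namespace PiecewiseKorn

/-- The Frobenius norm of a linear map. -/
def fN (L : E2 →L[ℝ] E2) : ℝ := matNorm fun i j => L (EuclideanSpace.single j (1 : ℝ)) i

lemma matNorm_mgrad (u : E2 → E2) (x : E2) : matNorm (mgrad u x) = fN (fderiv ℝ u x) := rfl

lemma fN_nonneg (L : E2 →L[ℝ] E2) : 0 ≤ fN L := Real.sqrt_nonneg _

lemma fN_sq (L : E2 →L[ℝ] E2) : fN L ^ 2 = L (EuclideanSpace.single 0 (1 : ℝ)) 0 ^ 2 +
    L (EuclideanSpace.single 1 (1 : ℝ)) 0 ^ 2 + L (EuclideanSpace.single 0 (1 : ℝ)) 1 ^ 2 +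
    L (EuclideanSpace.single 1 (1 : ℝ)) 1 ^ 2 := matNorm_sq _

lemma eN_le_fN (L : E2 →L[ℝ] E2) : eN L ≤ fN L := by
  refine abs_le_of_sq_le_sq' ?_ (fN_nonneg L) |>.2
  rw [eN_sq, fN_sq]
  nlinarith [sq_nonneg (L (EuclideanSpace.single 0 (1 : ℝ)) 1 -
    L (EuclideanSpace.single 1 (1 : ℝ)) 0)]

lemma fN_le_two_mul (L : E2 →L[ℝ] E2) : fN L ≤ 2 * ‖L‖ := by
  refine abs_le_of_sq_le_sq' ?_ (by positivity) |>.2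
  have h : ∀ j : Fin 2, L (EuclideanSpace.single j (1 : ℝ)) 0 ^ 2 +
      L (EuclideanSpace.single j (1 : ℝ)) 1 ^ 2 ≤ ‖L‖ ^ 2 := fun j => by
    rw [← norm_sq_eq]
    have := L.le_opNorm (EuclideanSpace.single j (1 : ℝ))
    rw [PiLp.norm_single, norm_one, mul_one] at this
    gcongr
  rw [fN_sq]
  nlinarith [h 0, h 1, sq_nonneg ‖L‖]

lemma eN_sub_rgD (L : E2 →L[ℝ] E2) (a : ℝ × E2) : eN (L - rgD a) = eN L := by
  have h : ∀ i j : Fin 2, ((L - rgD a) (EuclideanSpace.single j (1 : ℝ)) i +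
      (L - rgD a) (EuclideanSpace.single i (1 : ℝ)) j) / 2 =
      (L (EuclideanSpace.single j (1 : ℝ)) i + L (EuclideanSpace.single i (1 : ℝ)) j) / 2 := by
    intro i j
    fin_cases i <;> fin_cases j <;> simp [rgD]
  unfold eN
  simp only [h]

lemma eN_le_of_sub (L : E2 →L[ℝ] E2) (a : ℝ × E2) : eN L ≤ 2 * ‖L - rgD a‖ := by
  rw [← eN_sub_rgD L a]
  exact (eN_le_fN _).trans (fN_le_two_mul _)

lemma fN_add_le (L M : E2 →L[ℝ] E2) : fN (L + M) ^ 2 ≤ 2 * fN L ^ 2 + 2 * fN M ^ 2 := by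
  simp only [fN_sq, add_apply, PiLp.add_apply]
  have h : ∀ a b : ℝ, (a + b) ^ 2 ≤ 2 * a ^ 2 + 2 * b ^ 2 := fun a b => by
    nlinarith [sq_nonneg (a - b)]
  linarith [h (L (EuclideanSpace.single 0 (1 : ℝ)) 0) (M (EuclideanSpace.single 0 (1 : ℝ)) 0),
    h (L (EuclideanSpace.single 1 (1 : ℝ)) 0) (M (EuclideanSpace.single 1 (1 : ℝ)) 0),
    h (L (EuclideanSpace.single 0 (1 : ℝ)) 1) (M (EuclideanSpace.single 0 (1 : ℝ)) 1),
    h (L (EuclideanSpace.single 1 (1 : ℝ)) 1) (M (EuclideanSpace.single 1 (1 : ℝ)) 1)]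

section Korn

variable {f g : E2 → ℝ}

lemma continuous_fderiv_apply (hf : ContDiff ℝ 2 f) (v : E2) :
    Continuous fun x => fderiv ℝ f x v :=
  (hf.continuous_fderiv (by norm_num)).clm_apply continuous_const

lemma hasCompactSupport_fderiv_apply (hf : HasCompactSupport f) (v : E2) :
    HasCompactSupport fun x => fderiv ℝ f x v :=
  hf.fderiv_apply (𝕜 := ℝ) v

lemma contDiff_fderiv_apply (hf : ContDiff ℝ 2 f) (v : E2) :
    ContDiff ℝ 1 fun x => fderiv ℝ f x v :=
  (hf.fderiv_right (m := 1) (by norm_num)).clm_apply contDiff_const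

lemma fderiv_fderiv_comm (hf : ContDiff ℝ 2 f) (v w x : E2) :
    fderiv ℝ (fun y => fderiv ℝ f y v) x w = fderiv ℝ (fun y => fderiv ℝ f y w) x v := by
  have hd : DifferentiableAt ℝ (fderiv ℝ f) x :=
    (hf.fderiv_right (m := 1) (by norm_num)).differentiable (by norm_num) x
  have h : ∀ v, fderiv ℝ (fun y => fderiv ℝ f y v) x = (fderiv ℝ (fderiv ℝ f) x).flip v := by
    intro v
    have := (hd.hasFDerivAt.clm_apply (hasFDerivAt_const v x)).fderiv
    rw [this]; simp
  rw [h, h]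
  have hs : IsSymmSndFDerivAt ℝ f x := hf.contDiffAt.isSymmSndFDerivAt (by simp)
  exact hs.eq w v

lemma integral_fderiv_mul_comm (hf : ContDiff ℝ 2 f) (hg : ContDiff ℝ 2 g)
    (hfc : HasCompactSupport f) (hgc : HasCompactSupport g) (v w : E2) :
    ∫ x, fderiv ℝ f x v * fderiv ℝ g x w = ∫ x, fderiv ℝ f x w * fderiv ℝ g x v := by
  have key : ∀ v w : E2, ∫ x, fderiv ℝ f x v * fderiv ℝ g x w =
      - ∫ x, fderiv ℝ (fun y => fderiv ℝ f y v) x w * g x := by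
    intro v w
    have c1 := continuous_fderiv_apply hf v
    have c2 := continuous_fderiv_apply hg w
    have c3 : Continuous fun x => fderiv ℝ (fun y => fderiv ℝ f y v) x w :=
      ((contDiff_fderiv_apply hf v).continuous_fderiv (by norm_num)).clm_apply continuous_const
    refine integral_mul_fderiv_eq_neg_fderiv_mul_of_integrable ?_ ?_ ?_ ?_ ?_
    · exact (c3.mul hg.continuous).integrable_of_hasCompactSupport (hgc.mul_left)
    · exact (c1.mul c2).integrable_of_hasCompactSupport
        ((hasCompactSupport_fderiv_apply hfc v).mul_right)
    · exact (c1.mul hg.continuous).integrable_of_hasCompactSupport (hgc.mul_left)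
    · exact fun x _ => (contDiff_fderiv_apply hf v).differentiable (by norm_num) x
    · exact fun x _ => hg.differentiable (by norm_num) x
  rw [key v w, key w v]
  simp only [fderiv_fderiv_comm hf v w]

end Korn

lemma lintegral_fN_le {w : E2 → E2} (hw : ContDiff ℝ 2 w) (hc : HasCompactSupport w) :
    ∫⁻ x, ENNReal.ofReal (fN (fderiv ℝ w x) ^ 2) ≤ 2 * ∫⁻ x, gE w x := by
  have hcd : ∀ i : Fin 2, ContDiff ℝ 2 fun x => w x i := fun i =>
    (EuclideanSpace.proj i : E2 →L[ℝ] ℝ).contDiff.comp hw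
  have hcs : ∀ i : Fin 2, HasCompactSupport fun x => w x i := fun i =>
    hc.comp_left (g := fun y : E2 => y i) rfl
  have hfd : ∀ (x v : E2) (i : Fin 2), fderiv ℝ w x v i = fderiv ℝ (fun y => w y i) x v := by
    intro x v i
    have h := ((EuclideanSpace.proj i : E2 →L[ℝ] ℝ).hasFDerivAt (x := w x)).comp x
      (hw.differentiable (by norm_num) x).hasFDerivAt
    have e : fderiv ℝ (fun y => w y i) x =
      (EuclideanSpace.proj i : E2 →L[ℝ] ℝ).comp (fderiv ℝ w x) := h.fderiv
    rw [e]; rfl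
  set d : Fin 2 → Fin 2 → E2 → ℝ := fun i j x =>
    fderiv ℝ (fun y => w y i) x (EuclideanSpace.single j (1 : ℝ)) with hd
  have dc : ∀ i j, Continuous (d i j) := fun i j => continuous_fderiv_apply (hcd i) _
  have ds : ∀ i j, HasCompactSupport (d i j) := fun i j => hasCompactSupport_fderiv_apply (hcs i) _
  have dI : ∀ i j k l, Integrable fun x => d i j x * d k l x := fun i j k l =>
    ((dc i j).mul (dc k l)).integrable_of_hasCompactSupport ((ds i j).mul_right)
  have h0 : ∫ x, d 1 0 x * d 0 1 x = ∫ x, d 1 1 x * d 0 0 x :=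
    integral_fderiv_mul_comm (hcd 1) (hcd 0) (hcs 1) (hcs 0) _ _
  have e1 : ∀ x, fN (fderiv ℝ w x) ^ 2 =
      d 0 0 x * d 0 0 x + d 0 1 x * d 0 1 x + d 1 0 x * d 1 0 x + d 1 1 x * d 1 1 x := by
    intro x; rw [fN_sq]; simp only [hfd, hd]; ring
  have e2 : ∀ x, eN (fderiv ℝ w x) ^ 2 = d 0 0 x * d 0 0 x + (1 / 2) * (d 1 0 x * d 1 0 x) +
      (1 / 2) * (d 0 1 x * d 0 1 x) + d 1 0 x * d 0 1 x + d 1 1 x * d 1 1 x := by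
    intro x; rw [eN_sq]; simp only [hfd, hd]; ring
  have I1 : Integrable fun x => fN (fderiv ℝ w x) ^ 2 := by
    simp only [e1]
    exact (((dI _ _ _ _).add (dI _ _ _ _)).add (dI _ _ _ _)).add (dI _ _ _ _)
  have I2 : Integrable fun x => eN (fderiv ℝ w x) ^ 2 := by
    simp only [e2]
    exact ((((dI _ _ _ _).add ((dI _ _ _ _).const_mul _)).add ((dI _ _ _ _).const_mul _)).add
      (dI _ _ _ _)).add (dI _ _ _ _)
  have I3 : Integrable fun x => d 1 0 x * d 0 1 x - d 1 1 x * d 0 0 x :=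
    (dI _ _ _ _).sub (dI _ _ _ _)
  have h3 : ∫ x, (d 1 0 x * d 0 1 x - d 1 1 x * d 0 0 x) = 0 := by
    rw [integral_sub (dI _ _ _ _) (dI _ _ _ _), h0, sub_self]
  unfold gE
  rw [← ofReal_integral_eq_lintegral_ofReal I1 (Filter.Eventually.of_forall fun x => sq_nonneg _),
    ← ofReal_integral_eq_lintegral_ofReal I2 (Filter.Eventually.of_forall fun x => sq_nonneg _)]
  have hreal : ∫ x, fN (fderiv ℝ w x) ^ 2 ≤ 2 * ∫ x, eN (fderiv ℝ w x) ^ 2 := by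
    calc ∫ x, fN (fderiv ℝ w x) ^ 2
        ≤ ∫ x, (2 * eN (fderiv ℝ w x) ^ 2 - 2 * (d 1 0 x * d 0 1 x - d 1 1 x * d 0 0 x)) := by
          refine integral_mono I1 ((I2.const_mul 2).sub (I3.const_mul 2)) fun x => ?_
          simp only [e1, e2]
          nlinarith [sq_nonneg (d 0 0 x + d 1 1 x)]
      _ = 2 * ∫ x, eN (fderiv ℝ w x) ^ 2 := by
          rw [integral_sub (I2.const_mul 2) (I3.const_mul 2), integral_const_mul,
            integral_const_mul, h3]
          ring
  refine (ENNReal.ofReal_le_ofReal hreal).trans_eq ?_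
  rw [ENNReal.ofReal_mul zero_le_two, ENNReal.ofReal_ofNat]

namespace Setup

variable (D : Setup)

lemma hasCompactSupport_bump (z : E2) {ℓ : ℝ} (hℓ : 0 < ℓ) (i : Fin 2 → ℤ) :
    HasCompactSupport (bump z ℓ i) := by
  refine HasCompactSupport.of_support_subset_isCompact
    (isCompact_closedBall z (2 * (ℓ * (|(i 0 : ℝ)| + |(i 1 : ℝ)| + 2)))) fun x hx => ?_
  have hi : i ∈ nb z ℓ x := by
    by_contra h
    exact hx (bump_eq_zero h)
  rw [mem_nb] at hi
  rw [Metric.mem_closedBall, dist_eq_norm]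
  refine norm_le_coord _ fun c => ?_
  have e : (x - z) c = ℓ * ((x c - z c) / ℓ) := by
    rw [mul_div_cancel₀ _ hℓ.ne']; rfl
  rw [e, abs_mul, abs_of_pos hℓ]
  gcongr
  have h := hi c
  have h2 : |(x c - z c) / ℓ| ≤ |(i c : ℝ)| + 2 := by
    rw [abs_le]
    constructor <;> linarith [neg_abs_le (i c : ℝ), le_abs_self (i c : ℝ)]
  have h3 : |(i c : ℝ)| ≤ |(i 0 : ℝ)| + |(i 1 : ℝ)| := by
    fin_cases c
    · simp
    · simp
  linarith

lemma hasCompactSupport_V_sub (k : ℕ) : HasCompactSupport fun x => D.V k x - rg D.a0 x := by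
  induction k with
  | zero =>
    have e : (fun x => D.V 0 x - rg D.a0 x) = 0 := by funext x; exact sub_self _
    rw [e]
    exact HasCompactSupport.zero
  | succ k ih =>
    have h : ∀ G : Finset (Fin 2 → ℤ), HasCompactSupport fun x => ∑ i ∈ G,
        bump D.z (D.ell (k + 1)) i x • (rg (D.am (k + 1) i) x - D.V k x) := by
      intro G
      classical
      induction G using Finset.induction_on with
      | empty =>
        simp only [Finset.sum_empty]
        exact (HasCompactSupport.zero : HasCompactSupport (0 : E2 → E2))
      | insert i G hi ihG =>
        simp only [Finset.sum_insert hi]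
        exact ((hasCompactSupport_bump D.z (D.ell_pos (k + 1)) i).smul_right).add ihG
    have e : (fun x => D.V (k + 1) x - rg D.a0 x) = fun x => (D.V k x - rg D.a0 x) +
        ∑ i ∈ D.GG (k + 1), bump D.z (D.ell (k + 1)) i x •
          (rg (D.am (k + 1) i) x - D.V k x) := by
      funext x
      exact add_sub_right_comm _ _ _
    rw [e]
    exact ih.add (h _)

lemma fderiv_V_cases (N : ℕ) (x : E2) : fderiv ℝ (D.V N) x = rgD D.a0 ∨
    ∃ k < N, x ∈ D.X N (k + 1) ∧ fderiv ℝ (D.V N) x = fderiv ℝ (D.V (k + 1)) x := by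
  induction N with
  | zero => exact Or.inl (rg_hasFDerivAt _ _).fderiv
  | succ N ih =>
    by_cases h : D.act (N + 1) x = ∅
    · rw [D.fderiv_V_succ_of_empty h]
      rcases ih with ih | ⟨k, hk, hx, e⟩
      · exact Or.inl ih
      · refine Or.inr ⟨k, by omega, ⟨hx.1, fun h1 => ?_⟩, e⟩
        rcases Nat.lt_or_ge (k + 1) N with h2 | h2
        · exact hx.2 h2
        · obtain rfl : N = k + 1 := by omega
          exact h
    · exact Or.inr ⟨N, by omega, ⟨Finset.nonempty_iff_ne_empty.2 h, fun h1 => by omega⟩, rfl⟩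

/-- The constant in the gradient bound of the approximations. -/
def cV : ℝ := (2 * ((2 + 32 * cH) * (194 * cW))) ^ 2

lemma cV_pos : 0 < cV := by
  have := cH_pos
  have := cW_pos
  unfold cV; positivity

/-- The gradient of the approximations, measured against the local rigid motions. -/
lemma sq_fderiv_V_sub_le {k : ℕ} {x : E2} {i : Fin 2 → ℤ} (hi : i ∈ D.act (k + 1) x) :
    ENNReal.ofReal ((2 * ‖fderiv ℝ (D.V (k + 1)) x - rgD (D.am (k + 1) i)‖) ^ 2) ≤
      ENNReal.ofReal cV * (D.Phi k x / ENNReal.ofReal (D.ell (k + 1) ^ 2)) := by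
  have hℓ := D.ell_pos (k + 1)
  have h := D.fderiv_V_sub_le hi
  have hc := cH_pos
  have hw := cW_pos
  have hΦ : 0 ≤ (D.Phi k x).toReal := ENNReal.toReal_nonneg
  have e : D.Phi k x = ENNReal.ofReal (D.Phi k x).toReal :=
    (ENNReal.ofReal_toReal (D.Phi_ne_top k x)).symm
  rw [e, ← ENNReal.ofReal_div_of_pos (by positivity), ← ENNReal.ofReal_mul cV_pos.le]
  apply ENNReal.ofReal_le_ofReal
  have e2 : cV * ((D.Phi k x).toReal / D.ell (k + 1) ^ 2) =
      (2 * ((2 + 32 * cH) * D.del k x / D.ell (k + 1))) ^ 2 := by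
    unfold cV del
    rw [← Real.sq_sqrt hΦ]
    simp only [Real.sqrt_sq (Real.sqrt_nonneg _)]
    ring
  rw [e2]
  gcongr

lemma gE_V_le (N : ℕ) (x : E2) : gE (D.V N) x ≤ ∑ k ∈ Finset.range N,
    (D.X N (k + 1)).indicator (fun x => ENNReal.ofReal cV *
      (D.Phi k x / ENNReal.ofReal (D.ell (k + 1) ^ 2))) x := by
  rcases D.fderiv_V_cases N x with h | ⟨k, hk, hx, h⟩
  · have h1 : eN (rgD D.a0) = 0 := by
      have := eN_le_of_sub (rgD D.a0) D.a0
      rw [sub_self, norm_zero, mul_zero] at this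
      exact le_antisymm this (eN_nonneg _)
    rw [gE, h, h1]
    simp
  · refine le_trans ?_ (Finset.single_le_sum (fun _ _ => zero_le) (Finset.mem_range.2 hk))
    rw [indicator_of_mem hx, gE, h]
    obtain ⟨i, hi⟩ := hx.1
    refine le_trans (ENNReal.ofReal_le_ofReal ?_) (D.sq_fderiv_V_sub_le hi)
    have := eN_nonneg (fderiv ℝ (D.V (k + 1)) x)
    have := eN_le_of_sub (fderiv ℝ (D.V (k + 1)) x) (D.am (k + 1) i)
    gcongr

lemma measurable_Phi (k : ℕ) : Measurable fun x =>
    D.Phi k x / ENNReal.ofReal (D.ell (k + 1) ^ 2) :=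
  ((D.measurable_En_Rel (k + 1)).add (D.measurable_En_Rel k)).div_const _

lemma lintegral_gE_V_le (N : ℕ) :
    ∫⁻ x, gE (D.V N) x ≤ ENNReal.ofReal cV * (20480 * En D.u (win D.z D.s)) := by
  refine (lintegral_mono (D.gE_V_le N)).trans ?_
  rw [lintegral_finsetSum _ fun k _ =>
    ((D.measurable_Phi k).const_mul _).indicator (D.measurableSet_X N (k + 1))]
  simp only [lintegral_indicator (D.measurableSet_X N _),
    lintegral_const_mul _ (D.measurable_Phi _)]
  rw [← Finset.mul_sum]
  gcongr
  exact D.sum_lintegral_Phi_le N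

/-- The approximations are close to a single rigid motion. -/
lemma lintegral_fderiv_V_sub_le (N : ℕ) :
    ∫⁻ x, ENNReal.ofReal (fN (fderiv ℝ (D.V N) x - rgD D.a0) ^ 2) ≤
      2 * (ENNReal.ofReal cV * (20480 * En D.u (win D.z D.s))) := by
  have hd : ∀ x, fderiv ℝ (fun x => D.V N x - rg D.a0 x) x = fderiv ℝ (D.V N) x - rgD D.a0 :=
    fun x => ((D.differentiable_V N x).hasFDerivAt.sub (rg_hasFDerivAt _ _)).fderiv
  have h := lintegral_fN_le ((D.contDiff_V N).sub (contDiff_rg D.a0)) (D.hasCompactSupport_V_sub N)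
  simp only [gE, hd, eN_sub_rgD] at h
  refine h.trans ?_
  gcongr
  exact D.lintegral_gE_V_le N

end Setup

end PiecewiseKorn

namespace PiecewiseKorn

open Filter Topology

lemma Near.exists_pair {u : E2 → E2} {a : ℝ × E2} {m r : ℝ} {p : E2} (hr : 0 < r)
    (h : Near u a m p r) {v : E2} (hv : ∀ c, 0 ≤ v c ∧ v c ≤ r / 2) :
    ∃ y ∈ win p r, y + v ∈ win p r ∧ ‖u y - rg a y‖ ≤ m ∧ ‖u (y + v) - rg a (y + v)‖ ≤ m := by
  by_contra! hcon
  set B := {x | x ∈ win p r ∧ m < ‖u x - rg a x‖} with hB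
  have hsub : win p (r / 2) ⊆ B ∪ (fun y => y + v) ⁻¹' B := by
    intro y hy
    have h1 : y ∈ win p r := fun c => by
      have := hy c
      constructor <;> linarith
    have h2 : y + v ∈ win p r := fun c => by
      have h3 := hy c
      have h4 := hv c
      have e : (y + v) c = y c + v c := rfl
      rw [e]
      constructor <;> linarith
    by_cases h3 : ‖u y - rg a y‖ ≤ m
    · exact Or.inr ⟨h2, hcon y h1 h2 h3⟩
    · exact Or.inl ⟨h1, not_le.1 h3⟩
  have hle : volume (win p (r / 2)) ≤ volume B + volume ((fun y => y + v) ⁻¹' B) :=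
    (measure_mono hsub).trans (measure_union_le _ _)
  rw [measure_preimage_add_right, volume_win p (by positivity)] at hle
  have h5 := hle.trans (add_le_add h h)
  rw [← ENNReal.ofReal_add (by positivity) (by positivity),
    ENNReal.ofReal_le_ofReal_iff (by positivity)] at h5
  nlinarith [sq_pos_of_pos hr]

/-- The gradient at a point is close to that of an approximating rigid motion. -/
lemma fN_sub_rgD_le {u : E2 → E2} {a : ℝ × E2} {m r ε : ℝ} {p x : E2} {L : E2 →L[ℝ] E2}
    (hr : 0 < r) (h : Near u a m p r)
    (hL : ∀ y ∈ win p r, ‖u y - u x - L (y - x)‖ ≤ ε * r) :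
    fN (L - rgD a) ≤ 6 * (m / r + ε) := by
  have key : ∀ c : Fin 2, ‖(L - rgD a) (EuclideanSpace.single c (1 : ℝ))‖ ≤ 4 * (m / r + ε) := by
    intro c
    set e : E2 := EuclideanSpace.single c (1 : ℝ) with he
    have hv : ∀ c', 0 ≤ ((r / 2) • e) c' ∧ ((r / 2) • e) c' ≤ r / 2 := by
      intro c'
      have e1 : ((r / 2) • e) c' = r / 2 * e c' := rfl
      rw [e1, he, PiLp.single_apply]
      split_ifs <;> constructor <;> linarith
    obtain ⟨y, hy, hy', h1, h2⟩ := h.exists_pair hr hv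
    have h3 := hL y hy
    have h4 := hL _ hy'
    set y' := y + (r / 2) • e
    have e2 : (r / 2) • (L - rgD a) e = (u y' - rg a y' - (u y' - u x - L (y' - x))) -
        (u y - rg a y - (u y - u x - L (y - x))) := by
      have e3 : y' - y = (r / 2) • e := add_sub_cancel_left _ _
      have e4 : (r / 2) • (L - rgD a) e = L (y' - y) - rgD a (y' - y) := by
        rw [← ContinuousLinearMap.map_smul, ← e3]; rfl
      have e5 : L (y' - y) = L (y' - x) - L (y - x) := by rw [← map_sub]; congr 1; abel
      rw [e4, ← rg_sub_rg, e5]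
      abel
    have h5 : r / 2 * ‖(L - rgD a) e‖ ≤ (m + ε * r) + (m + ε * r) := by
      have h6 : ‖(r / 2) • (L - rgD a) e‖ = r / 2 * ‖(L - rgD a) e‖ := by
        rw [norm_smul, Real.norm_of_nonneg (by positivity)]
      rw [← h6, e2]
      refine (norm_sub_le _ _).trans (add_le_add ?_ ?_)
      · exact (norm_sub_le _ _).trans (add_le_add h2 h4)
      · exact (norm_sub_le _ _).trans (add_le_add h1 h3)
    have h7 : m / r * r = m := div_mul_cancel₀ _ hr.ne'
    refine le_of_mul_le_mul_left ?_ (half_pos hr)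
    nlinarith
  have h0 := key 0
  have h1 := key 1
  have hpos : 0 ≤ m / r + ε := by linarith [norm_nonneg ((L - rgD a) (EuclideanSpace.single 0 1))]
  refine abs_le_of_sq_le_sq' ?_ (by positivity) |>.2
  have e := fN_sq (L - rgD a)
  have n0 := norm_sq_eq ((L - rgD a) (EuclideanSpace.single 0 1))
  have n1 := norm_sq_eq ((L - rgD a) (EuclideanSpace.single 1 1))
  have s0 := pow_le_pow_left₀ (norm_nonneg _) h0 2
  have s1 := pow_le_pow_left₀ (norm_nonneg _) h1 2
  nlinarith [sq_nonneg (m / r + ε)]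

namespace Setup

variable (D : Setup)

lemma exists_mem_nb (k : ℕ) (x : E2) : ∃ i, i ∈ nb D.z (D.ell k) x := by
  refine ⟨fun c => ⌊D.tt k x c⌋, D.mem_nb_tt.2 fun c => ⟨Int.floor_le _, ?_⟩⟩
  linarith [Int.lt_floor_add_one (D.tt k x c)]

lemma dist_le_of_mem_W_cl {k : ℕ} {x y : E2} (hx : x ∈ win D.z D.s) {i : Fin 2 → ℤ}
    (hi : i ∈ nb D.z (D.ell k) x) (hy : y ∈ D.W k (cl k i)) : ‖y - x‖ ≤ 12 * D.ell k := by
  have h : ∀ c, |(y - x) c| ≤ 6 * D.ell k := by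
    intro c
    have h1 := D.mem_nb_tt.1 hi c
    have h2 := (D.mem_S k).1 hx c
    have h3 := D.mem_W.1 hy c
    have h4 : -2 < (i c : ℝ) ∧ (i c : ℝ) < nn k + 2 := by constructor <;> linarith
    have h5 : -2 < i c ∧ i c < nn k + 2 := by exact_mod_cast h4
    have h6 := two_le_nn k
    have h7 : |cl k i c - i c| ≤ 3 := by
      simp only [cl]
      rw [abs_le]
      omega
    have h8 : |(cl k i c : ℝ) - i c| ≤ 3 := by exact_mod_cast h7
    rw [abs_le] at h8
    have e : (y - x) c = D.ell k * (D.tt k y c - D.tt k x c) := by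
      rw [mul_sub, ell_mul_tt, ell_mul_tt]
      change y c - x c = _
      ring
    rw [e, abs_mul, abs_of_pos (D.ell_pos k), mul_comm]
    refine mul_le_mul_of_nonneg_right ?_ (D.ell_pos k).le
    rw [abs_le]
    constructor <;> linarith
  refine (norm_le_coord _ h).trans_eq ?_
  ring

lemma tendsto_ell : Tendsto D.ell atTop (𝓝 0) := by
  have h : Tendsto (fun k : ℕ => D.s / 4 * (1 / 2 : ℝ) ^ k) atTop (𝓝 (D.s / 4 * 0)) :=
    (tendsto_pow_atTop_nhds_zero_of_lt_one (by norm_num) (by norm_num)).const_mul _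
  rw [mul_zero] at h
  refine h.congr fun k => ?_
  rw [ell, pow_add, one_div_pow]
  field_simp
  norm_num

/-- The constant in the pointwise comparison of gradients. -/
def cF : ℝ := 4 * cV + 72 * cW ^ 2

lemma fN_sq_le {k : ℕ} {x : E2} {i : Fin 2 → ℤ} {L : E2 →L[ℝ] E2} {ε : ℝ}
    (hi : i ∈ D.act (k + 1) x)
    (hL : ∀ y ∈ D.W (k + 1) (cl (k + 1) i), ‖D.u y - D.u x - L (y - x)‖ ≤ ε * (2 * D.ell (k + 1))) :
    ENNReal.ofReal (fN (L - rgD D.a0) ^ 2) ≤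
      2 * ENNReal.ofReal (fN (fderiv ℝ (D.V (k + 1)) x - rgD D.a0) ^ 2) +
        ENNReal.ofReal cF * (D.Phi k x / ENNReal.ofReal (D.ell (k + 1) ^ 2)) +
        ENNReal.ofReal (288 * ε ^ 2) := by
  have hℓ := D.ell_pos (k + 1)
  have hg := D.mem_act.1 hi
  have h1 := fN_sub_rgD_le (by positivity) (D.near_mot_cl hg.1) hL
  have h2 : D.amp (k + 1) (cl (k + 1) i) ≤ cW * √(D.Phi k x).toReal := D.amp_le (Or.inr rfl) hg.2
  set P := (D.Phi k x).toReal with hP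
  have hP0 : 0 ≤ P := ENNReal.toReal_nonneg
  set F := fderiv ℝ (D.V (k + 1)) x
  set A := rgD (D.am (k + 1) i) with hA
  have h3 : fN (L - A) ≤ 6 * (cW * √P / (2 * D.ell (k + 1)) + ε) := by
    refine h1.trans ?_
    gcongr
  have h4 : fN (L - A) ^ 2 ≤ 18 * cW ^ 2 * (P / D.ell (k + 1) ^ 2) + 72 * ε ^ 2 := by
    refine (pow_le_pow_left₀ (fN_nonneg _) h3 2).trans ?_
    have e : (cW * √P / (2 * D.ell (k + 1))) ^ 2 = cW ^ 2 * (P / D.ell (k + 1) ^ 2) / 4 := by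
      rw [div_pow, mul_pow, Real.sq_sqrt hP0]
      field_simp
      norm_num
    nlinarith [sq_nonneg (cW * √P / (2 * D.ell (k + 1)) - ε)]
  have e1 : L - rgD D.a0 = (F - rgD D.a0) + ((L - A) + (A - F)) := by abel
  have h5 : fN (L - rgD D.a0) ^ 2 ≤ 2 * fN (F - rgD D.a0) ^ 2 +
      2 * (2 * fN (L - A) ^ 2 + 2 * fN (A - F) ^ 2) := by
    rw [e1]
    refine (fN_add_le _ _).trans ?_
    have := fN_add_le (L - A) (A - F)
    linarith
  have h6 : fN (A - F) ^ 2 ≤ (2 * ‖F - A‖) ^ 2 := by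
    rw [norm_sub_rev]
    exact pow_le_pow_left₀ (fN_nonneg _) (fN_le_two_mul _) 2
  have h7 := D.sq_fderiv_V_sub_le hi
  have e2 : D.Phi k x / ENNReal.ofReal (D.ell (k + 1) ^ 2) =
      ENNReal.ofReal (P / D.ell (k + 1) ^ 2) := by
    rw [ENNReal.ofReal_div_of_pos (by positivity), hP, ENNReal.ofReal_toReal (D.Phi_ne_top k x)]
  rw [e2, ← ENNReal.ofReal_mul cV_pos.le, ENNReal.ofReal_le_ofReal_iff
    (mul_nonneg cV_pos.le (by positivity))] at h7
  have e3 : ∀ t : ℝ, 2 * ENNReal.ofReal t = ENNReal.ofReal (2 * t) := fun t => by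
    rw [ENNReal.ofReal_mul zero_le_two, ENNReal.ofReal_ofNat]
  have hcF : 0 ≤ cF := by have := cV_pos; unfold cF; positivity
  rw [e2, ← ENNReal.ofReal_mul hcF, e3, ← ENNReal.ofReal_add (by positivity) (by positivity),
    ← ENNReal.ofReal_add (by positivity) (by positivity)]
  apply ENNReal.ofReal_le_ofReal
  unfold cF
  linarith

/-- The constant in Korn's inequality on the good part. -/
def cK : ℝ := 20480 * (4 * cV + cF)

lemma lintegral_fderiv_sub_le {A : Set E2} (hA : MeasurableSet A) (hAS : A ⊆ win D.z D.s)
    (hact : ∀ x ∈ A, ∀ k, (D.act k x).Nonempty) :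
    ∫⁻ x in A, ENNReal.ofReal (fN (fderiv ℝ D.u x - rgD D.a0) ^ 2) ≤
      ENNReal.ofReal cK * En D.u (win D.z D.s) := by
  set g : ℕ → E2 → ℝ≥0∞ := fun N x =>
    2 * ENNReal.ofReal (fN (fderiv ℝ (D.V (N + 1)) x - rgD D.a0) ^ 2) +
      ENNReal.ofReal cF * (D.Phi N x / ENNReal.ofReal (D.ell (N + 1) ^ 2)) with hg
  have hgm : ∀ N, Measurable (g N) := by
    intro N
    refine Measurable.add ?_ ((D.measurable_Phi N).const_mul _)
    refine Measurable.const_mul ?_ _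
    simp only [fN_sq]
    have hm := (measurable_fderiv ℝ (D.V (N + 1))).sub_const (rgD D.a0)
    have hij : ∀ i j : Fin 2, Measurable fun x => ((fderiv ℝ (D.V (N + 1)) x - rgD D.a0)
        (EuclideanSpace.single j (1 : ℝ))) i := fun i j =>
      ((EuclideanSpace.proj i : E2 →L[ℝ] ℝ).continuous.measurable).comp
        ((ContinuousLinearMap.apply ℝ E2
          (EuclideanSpace.single j (1 : ℝ))).continuous.measurable.comp hm)
    exact (((((hij 0 0).pow_const 2).add ((hij 0 1).pow_const 2)).add
      ((hij 1 0).pow_const 2)).add ((hij 1 1).pow_const 2)).ennreal_ofReal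
  have hdiff : ∀ᵐ x, x ∈ A → DifferentiableAt ℝ D.u x := by
    have h1 := ae_differentiableAt_of_lipAt D.lip
    have h2 : ∀ᵐ x, x ∉ D.Γ := measure_eq_zero_iff_ae_notMem.1 D.null
    filter_upwards [h1, h2] with x hx hx' hxA
    exact hx ⟨hAS hxA, hx'⟩
  have hpt : ∀ᵐ x, x ∈ A → ENNReal.ofReal (fN (fderiv ℝ D.u x - rgD D.a0) ^ 2) ≤
      liminf (fun N => g N x) atTop := by
    filter_upwards [hdiff] with x hx hxA
    have hd := (hx hxA).hasFDerivAt
    have hbig : ∀ ε : ℝ, 0 < ε → ENNReal.ofReal (fN (fderiv ℝ D.u x - rgD D.a0) ^ 2) ≤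
        liminf (fun N => g N x) atTop + ENNReal.ofReal (288 * (6 * ε) ^ 2) := by
      intro ε hε
      have h1 := hd.isLittleO.def hε
      rw [Metric.eventually_nhds_iff] at h1
      obtain ⟨δ, hδ, h1⟩ := h1
      have h2 : ∀ᶠ N in atTop, 12 * D.ell (N + 1) < δ := by
        have h3 := ((D.tendsto_ell.comp (tendsto_add_atTop_nat 1)).const_mul 12)
        rw [mul_zero] at h3
        exact h3.eventually (gt_mem_nhds hδ)
      rw [← tsub_le_iff_right]
      refine le_liminf_of_le (by isBoundedDefault) ?_
      filter_upwards [h2] with N hN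
      rw [tsub_le_iff_right]
      obtain ⟨i, hi⟩ := hact x hxA (N + 1)
      refine D.fN_sq_le hi fun y hy => ?_
      have h4 := D.dist_le_of_mem_W_cl (hAS hxA) (D.mem_act.1 hi).2 hy
      refine (h1 (by rw [dist_eq_norm]; linarith)).trans ?_
      nlinarith
    refine ENNReal.le_of_forall_pos_le_add fun η hη _ => ?_
    refine (hbig (√(η / 10368)) (Real.sqrt_pos.2 (by positivity))).trans ?_
    gcongr
    rw [mul_pow, Real.sq_sqrt (by positivity)]
    apply le_of_eq
    rw [← ENNReal.ofReal_coe_nnreal]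
    congr 1
    ring
  calc ∫⁻ x in A, ENNReal.ofReal (fN (fderiv ℝ D.u x - rgD D.a0) ^ 2)
      ≤ ∫⁻ x in A, liminf (fun N => g N x) atTop :=
        lintegral_mono_ae ((ae_restrict_iff' hA).2 hpt)
    _ ≤ liminf (fun N => ∫⁻ x in A, g N x) atTop := lintegral_liminf_le hgm
    _ ≤ ENNReal.ofReal cK * En D.u (win D.z D.s) := ?_
  refine liminf_le_of_le (by isBoundedDefault) fun b hb => ?_
  obtain ⟨N, hN⟩ := hb.exists
  refine hN.trans ?_
  have h1 : ∫⁻ x in A, g N x = 2 * (∫⁻ x in A,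
      ENNReal.ofReal (fN (fderiv ℝ (D.V (N + 1)) x - rgD D.a0) ^ 2)) + ENNReal.ofReal cF *
        ∫⁻ x in A, D.Phi N x / ENNReal.ofReal (D.ell (N + 1) ^ 2) := by
    rw [hg, lintegral_add_right _ ((D.measurable_Phi N).const_mul _),
      lintegral_const_mul' _ _ (by simp), lintegral_const_mul' _ _ ENNReal.ofReal_ne_top]
  have h2 : ∫⁻ x in A, D.Phi N x / ENNReal.ofReal (D.ell (N + 1) ^ 2) ≤
      20480 * En D.u (win D.z D.s) := by
    refine le_trans ?_ (D.sum_lintegral_Phi_le (N + 1))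
    refine le_trans ?_ (Finset.single_le_sum (f := fun k => ∫⁻ x in D.X (N + 1) (k + 1),
      D.Phi k x / ENNReal.ofReal (D.ell (k + 1) ^ 2)) (fun _ _ => zero_le)
      (Finset.mem_range.2 (Nat.lt_succ_self N)))
    exact lintegral_mono_set fun x hx => ⟨hact x hx _, fun h => absurd h (lt_irrefl _)⟩
  have h3 := (setLIntegral_le_lintegral A _).trans (D.lintegral_fderiv_V_sub_le (N + 1))
  rw [h1]
  refine (add_le_add (mul_le_mul_right h3 2) (mul_le_mul_right h2 _)).trans_eq ?_
  have e : ENNReal.ofReal cK = 20480 * (4 * ENNReal.ofReal cV + ENNReal.ofReal cF) := by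
    have hcF : 0 ≤ cF := by have := cV_pos; unfold cF; positivity
    have := cV_pos
    rw [cK, ENNReal.ofReal_mul (by norm_num), ENNReal.ofReal_add (by positivity) hcF,
      ENNReal.ofReal_mul (by norm_num)]
    simp only [ENNReal.ofReal_ofNat]
  rw [e]
  ring

end Setup

end PiecewiseKorn

namespace PiecewiseKorn

open Filter Topology

lemma hausdorffMeasure_slice_le (c : Fin 2) (t : ℝ) (p : E2) (r : ℝ) :
    μH[1] {x | x ∈ cube p r ∧ x c = t} ≤ ENNReal.ofReal (2 * r) := by
  set f : ℝ → E2 := fun s => WithLp.toLp 2 fun c' => if c' = c then t else s with hf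
  have hL : LipschitzWith 1 f := by
    refine LipschitzWith.of_dist_le_mul fun s s' => ?_
    rw [EuclideanSpace.dist_eq, Fin.sum_univ_two, NNReal.coe_one, one_mul]
    refine (Real.sqrt_le_sqrt (y := dist s s' ^ 2) ?_).trans_eq (Real.sqrt_sq dist_nonneg)
    fin_cases c <;> simp [hf]
  have hsub : {x | x ∈ cube p r ∧ x c = t} ⊆ f '' Icc (p (1 - c) - r) (p (1 - c) + r) := by
    rintro x ⟨hx, hxc⟩
    refine ⟨x (1 - c), ?_, ?_⟩
    · have := abs_le.1 (hx (1 - c))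
      constructor <;> linarith
    · ext c'
      fin_cases c <;> fin_cases c' <;> simp_all
  refine (measure_mono hsub).trans ((hL.hausdorffMeasure_image_le zero_le_one _).trans ?_)
  rw [hausdorffMeasure_real, Real.volume_Icc, ENNReal.coe_one, ENNReal.one_rpow, one_mul]
  apply le_of_eq; congr 1; ring

lemma closure_win_subset (p : E2) (r : ℝ) :
    closure (win p r) ⊆ {x | ∀ c, p c ≤ x c ∧ x c ≤ p c + r} := by
  refine closure_minimal (fun x hx c => ⟨(hx c).1.le, (hx c).2.le⟩) ?_
  have : {x : E2 | ∀ c, p c ≤ x c ∧ x c ≤ p c + r} =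
      ⋂ c, {x : E2 | p c ≤ x c ∧ x c ≤ p c + r} := by ext; simp
  rw [this]
  exact isClosed_iInter fun c => (isClosed_le continuous_const (continuous_coord c)).inter
    (isClosed_le (continuous_coord c) continuous_const)

lemma frontier_win_subset (p : E2) (r : ℝ) :
    frontier (win p r) ⊆ {x | ∃ c, x c = p c ∨ x c = p c + r} := by
  intro x hx
  rw [(isOpen_win p r).frontier_eq] at hx
  have h := closure_win_subset p r hx.1
  by_contra! hcon
  simp only [mem_ofPred_eq, not_exists, not_or] at hcon
  exact hx.2 fun c => ⟨lt_of_le_of_ne (h c).1 (Ne.symm (hcon c).1), lt_of_le_of_ne (h c).2 (hcon c).2⟩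

lemma frontier_cube_subset (p : E2) (r : ℝ) :
    frontier (cube p r) ⊆ {x | x ∈ cube p r ∧ ∃ c, x c = p c - r ∨ x c = p c + r} := by
  intro x hx
  rw [(isClosed_cube p r).frontier_eq] at hx
  refine ⟨hx.1, ?_⟩
  by_contra! hcon
  refine hx.2 (mem_interior.2 ⟨win (p - WithLp.toLp 2 fun _ => r) (2 * r), ?_, isOpen_win _ _, ?_⟩)
  · intro y hy c
    have h := hy c
    have e : (p - WithLp.toLp 2 fun _ => r : E2) c = p c - r := rfl
    rw [e] at h
    rw [abs_le]
    constructor <;> linarith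
  · intro c
    have h := abs_le.1 (hx.1 c)
    have h1 := lt_of_le_of_ne (by linarith : p c - r ≤ x c) (Ne.symm (hcon c).1)
    have h2 := lt_of_le_of_ne (by linarith : x c ≤ p c + r) (hcon c).2
    have e : (p - WithLp.toLp 2 fun _ => r : E2) c = p c - r := rfl
    rw [e]
    constructor <;> linarith

lemma hausdorffMeasure_frontier_inter_le (z p : E2) (s r : ℝ) :
    μH[1] (frontier (win z s ∩ cube p r)) ≤ ENNReal.ofReal (16 * r) := by
  set sl : Fin 2 → ℝ → Set E2 := fun c t => {x | x ∈ cube p r ∧ x c = t} with hsl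
  have hsub : frontier (win z s ∩ cube p r) ⊆
      ⋃ c, ((sl c (z c) ∪ sl c (z c + s)) ∪ (sl c (p c - r) ∪ sl c (p c + r))) := by
    refine (frontier_inter_subset _ _).trans (union_subset ?_ ?_)
    · rintro x ⟨h1, h2⟩
      rw [(isClosed_cube p r).closure_eq] at h2
      obtain ⟨c, h | h⟩ := frontier_win_subset z s h1
      · exact mem_iUnion.2 ⟨c, Or.inl (Or.inl ⟨h2, h⟩)⟩
      · exact mem_iUnion.2 ⟨c, Or.inl (Or.inr ⟨h2, h⟩)⟩
    · rintro x ⟨-, h1⟩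
      obtain ⟨h2, c, h | h⟩ := frontier_cube_subset p r h1
      · exact mem_iUnion.2 ⟨c, Or.inr (Or.inl ⟨h2, h⟩)⟩
      · exact mem_iUnion.2 ⟨c, Or.inr (Or.inr ⟨h2, h⟩)⟩
  have hS : ∀ c t, μH[1] (sl c t) ≤ ENNReal.ofReal (2 * r) := fun c t =>
    hausdorffMeasure_slice_le c t p r
  refine (measure_mono hsub).trans ((measure_iUnion_fintype_le _ _).trans ?_)
  have h4 : ∀ c, μH[1] ((sl c (z c) ∪ sl c (z c + s)) ∪ (sl c (p c - r) ∪ sl c (p c + r))) ≤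
      4 * ENNReal.ofReal (2 * r) := by
    intro c
    refine (measure_union_le _ _).trans ((add_le_add (measure_union_le _ _)
      (measure_union_le _ _)).trans ((add_le_add (add_le_add (hS _ _) (hS _ _))
        (add_le_add (hS _ _) (hS _ _))).trans_eq ?_))
    ring
  rw [Fin.sum_univ_two]
  refine (add_le_add (h4 0) (h4 1)).trans_eq ?_
  rw [← two_mul, ← mul_assoc]
  have e : (16 : ℝ) * r = 8 * (2 * r) := by ring
  rw [e, ENNReal.ofReal_mul (by norm_num : (0 : ℝ) ≤ 8), ENNReal.ofReal_ofNat]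
  norm_num

lemma frontier_biUnion_finset_subset {ι : Type*} (s : Finset ι) (f : ι → Set E2) :
    frontier (⋃ i ∈ s, f i) ⊆ ⋃ i ∈ s, frontier (f i) := by
  classical
  induction s using Finset.induction_on with
  | empty => simp
  | insert a s ha ih =>
    rw [Finset.set_biUnion_insert, Finset.set_biUnion_insert]
    exact (frontier_union_subset _ _).trans
      (union_subset_union inter_subset_left (inter_subset_right.trans ih))

/-- Almost every point of a finite union of segments lies in a piece of definite length. -/
lemma exists_segment_of_mem {Γ S : Set E2} (hΓ : FinSegUnion Γ) (hS : Convex ℝ S) :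
    ∃ δ > 0, ∃ Z : Set E2, μH[1] Z = 0 ∧
      ∀ y ∈ Γ ∩ S, y ∉ Z → ∃ w, segment ℝ y w ⊆ Γ ∩ S ∧ δ ≤ dist y w := by
  obtain ⟨n, a, b, rfl⟩ := hΓ
  have hi : ∀ i, ∃ δ > 0, ∃ Z : Set E2, μH[1] Z = 0 ∧ ∀ y ∈ segment ℝ (a i) (b i) ∩ S, y ∉ Z →
      ∃ w ∈ segment ℝ (a i) (b i) ∩ S, δ ≤ dist y w := by
    intro i
    set K := segment ℝ (a i) (b i) ∩ S
    by_cases h : K.Subsingleton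
    · refine ⟨1, one_pos, K, ?_, fun y hy hyZ => absurd hy hyZ⟩
      have := Measure.nullSingletonClass_hausdorff E2 (zero_lt_one (α := ℝ))
      exact h.measure_zero _
    · rw [Set.not_subsingleton_iff] at h
      obtain ⟨p, hp, q, hq, hpq⟩ := h
      have hd := dist_pos.2 hpq
      refine ⟨dist p q / 2, by positivity, ∅, measure_empty, fun y _ _ => ?_⟩
      by_cases h1 : dist p q / 2 ≤ dist y p
      · exact ⟨p, hp, h1⟩
      · refine ⟨q, hq, ?_⟩
        have := dist_triangle_left p q y
        linarith
  choose δ hδ Z hZ hw using hi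
  have hev : ∀ᶠ d in 𝓝[>] (0 : ℝ), ∀ i, d ≤ δ i := by
    rw [eventually_all]
    intro i
    exact Filter.Eventually.filter_mono nhdsWithin_le_nhds
      ((gt_mem_nhds (hδ i)).mono fun _ => le_of_lt)
  obtain ⟨d, hd, hd0⟩ := (hev.and self_mem_nhdsWithin).exists
  refine ⟨d, hd0, ⋃ i, Z i, measure_iUnion_null hZ, ?_⟩
  rintro y ⟨hy, hyS⟩ hyZ
  obtain ⟨i, hi⟩ := mem_iUnion.1 hy
  obtain ⟨w, hwK, hdw⟩ := hw i y ⟨hi, hyS⟩ fun h => hyZ (mem_iUnion.2 ⟨i, h⟩)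
  refine ⟨w, ?_, (hd i).trans hdw⟩
  have hc : Convex ℝ (segment ℝ (a i) (b i) ∩ S) := (convex_segment _ _).inter hS
  exact (hc.segment_subset ⟨hi, hyS⟩ hwK).trans
    (inter_subset_inter_left _ (subset_iUnion (fun i => segment ℝ (a i) (b i)) i))

namespace Setup

variable (D : Setup)

/-- Very fine bad windows are close to a bad window of a fixed scale. -/
lemma exists_bad_coarse (hseg : FinSegUnion D.Γ) : ∃ N, ∀ j b, D.Bad j b →
    ∃ b', D.Bad N b' ∧ (D.W j b ∩ D.W N b').Nonempty := by
  obtain ⟨δ, hδ, Z, hZ, hw⟩ := exists_segment_of_mem hseg (convex_win D.z D.s)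
  obtain ⟨N, hN⟩ := (D.tendsto_ell.eventually (gt_mem_nhds hδ)).exists
  refine ⟨N, fun j b hb => ?_⟩
  have hℓ := D.ell_pos N
  have hex : ∃ y ∈ D.Γ ∩ D.W j b, y ∉ Z := by
    by_contra! hcon
    have h0 : μH[1] (D.Γ ∩ D.W j b) = 0 := measure_mono_null hcon hZ
    have := hb.2
    rw [h0] at this
    exact absurd this not_lt_zero
  obtain ⟨y, ⟨hyΓ, hyW⟩, hyZ⟩ := hex
  have hyS : y ∈ win D.z D.s := D.W_subset hb.1 hyW
  obtain ⟨w, hseg', hdw⟩ := hw y ⟨hyΓ, hyS⟩ hyZ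
  set b' : Fin 2 → ℤ := fun c => max 0 (min (⌊D.tt N y c - 1 / 2⌋) (nn N)) with hb'
  have hnn := two_le_nn N
  have hr : ∀ c, 0 ≤ b' c ∧ b' c ≤ nn N := fun c => by simp only [hb']; omega
  have hnear : ∀ y' ∈ win D.z D.s, ‖y' - y‖ ≤ D.ell N / 4 → y' ∈ D.W N b' := by
    intro y' hy' hd
    rw [mem_W]
    intro c
    have h1 := (D.mem_S N).1 hy' c
    have h2 := (D.mem_S N).1 hyS c
    have h3 : |D.tt N y' c - D.tt N y c| ≤ 1 / 4 := by
      have h4 : D.ell N * (D.tt N y' c - D.tt N y c) = (y' - y) c := by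
        rw [mul_sub, ell_mul_tt, ell_mul_tt]
        change _ = y' c - y c
        ring
      have h5 := (abs_coord_le (y' - y) c).trans hd
      rw [← h4, abs_mul, abs_of_pos hℓ] at h5
      exact le_of_mul_le_mul_left (by linarith) hℓ
    rw [abs_le] at h3
    have h6 := Int.floor_le (D.tt N y c - 1 / 2)
    have h7 := Int.lt_floor_add_one (D.tt N y c - 1 / 2)
    set f := ⌊D.tt N y c - 1 / 2⌋
    have h8 : b' c = 0 ∧ f ≤ 0 ∨ b' c = nn N ∧ nn N ≤ f ∨ b' c = f := by
      simp only [hb']; omega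
    rcases h8 with ⟨h9, h10⟩ | ⟨h9, h10⟩ | h9
    · have h11 : (f : ℝ) ≤ 0 := by exact_mod_cast h10
      rw [h9]
      push_cast
      constructor <;> linarith
    · have h11 : (nn N : ℝ) ≤ f := by exact_mod_cast h10
      rw [h9]
      constructor <;> linarith
    · rw [h9]
      constructor <;> linarith
  refine ⟨b', ⟨hr, ?_⟩, ⟨y, hyW, hnear y hyS (by simp; positivity)⟩⟩
  set t : ℝ := D.ell N / 4 / dist y w with ht
  have hdpos : 0 < dist y w := hδ.trans_le hdw
  have ht0 : 0 ≤ t := by positivity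
  have ht1 : t ≤ 1 := by rw [ht, div_le_one hdpos]; linarith
  set w' := AffineMap.lineMap y w t with hw'
  have hdist : dist y w' = D.ell N / 4 := by
    rw [hw', dist_left_lineMap, Real.norm_of_nonneg ht0, ht, div_mul_cancel₀ _ hdpos.ne']
  have hsub1 : segment ℝ y w' ⊆ segment ℝ y w :=
    (convex_segment y w).segment_subset (left_mem_segment _ _ _)
      (by rw [segment_eq_image_lineMap]; exact ⟨t, ⟨ht0, ht1⟩, rfl⟩)
  have hsub2 : segment ℝ y w' ⊆ D.Γ ∩ D.W N b' := by
    intro y' hy'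
    have h1 := hseg' (hsub1 hy')
    refine ⟨h1.1, hnear y' h1.2 ?_⟩
    have h2 : y' ∈ Metric.closedBall y (D.ell N / 4) :=
      (convex_closedBall y _).segment_subset (Metric.mem_closedBall_self (by positivity))
        (by rw [Metric.mem_closedBall, dist_comm, hdist]) hy'
    rwa [Metric.mem_closedBall, dist_eq_norm] at h2
  refine lt_of_lt_of_le ?_ (measure_mono hsub2)
  rw [hausdorffMeasure_segment, edist_dist, hdist]
  refine (ENNReal.ofReal_lt_ofReal_iff (by positivity)).2 ?_
  rw [etaW]
  linarith

end Setup

end PiecewiseKorn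

namespace PiecewiseKorn

/-- The constant in the bounds for the exceptional set. -/
def cE : ℝ := (2240 / etaW) ^ 2

namespace Setup

variable (D : Setup)

lemma abs_pos_sub_le {j j' : ℕ} {b b' : Fin 2 → ℤ} (h : (D.W j b ∩ D.W j' b').Nonempty) {m : ℝ}
    (hm : D.ell j ≤ m) (hm' : D.ell j' ≤ m) (c : Fin 2) :
    |D.pos j b c - D.pos j' b' c| ≤ 2 * m := by
  obtain ⟨y, h1, h2⟩ := h
  have h1 := h1 c
  have h2 := h2 c
  rw [abs_le]
  constructor <;> linarith

lemma act_nonempty {x : E2} (hx : x ∈ win D.z D.s) {k : ℕ}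
    (h : ∀ j b, D.Bad j b → ∃ c, 66 * D.ell j < |x c - D.pos j b c|) : (D.act k x).Nonempty := by
  obtain ⟨i, hi⟩ := D.exists_mem_nb k x
  refine ⟨i, D.mem_act.2 ⟨⟨fun c => ?_, fun j hj b hb => ?_⟩, hi⟩⟩
  · have h1 := D.mem_nb_tt.1 hi c
    have h2 := (D.mem_S k).1 hx c
    have h4 : -2 < (i c : ℝ) ∧ (i c : ℝ) < nn k + 2 := by constructor <;> linarith
    have h5 : -2 < i c ∧ i c < nn k + 2 := by exact_mod_cast h4
    omega
  · obtain ⟨c, hc⟩ := h j b hb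
    refine ⟨c, ?_⟩
    have h1 := D.mem_nb_tt.1 hi c
    have hk := D.ell_pos k
    have hjk := D.ell_anti hj
    have e : D.ell k * D.tt k x c = x c - D.z c := D.ell_mul_tt k x c
    have h2 : D.ell k * i c ≤ x c - D.z c := by rw [← e]; exact mul_le_mul_of_nonneg_left h1.1 hk.le
    have h3 : x c - D.z c < D.ell k * i c + 2 * D.ell k := by
      rw [← e]
      have := mul_lt_mul_of_pos_left h1.2 hk
      linarith
    have h4 : |x c - D.pos j b c| ≤ |D.ell k * i c - D.ell j * b c| + 2 * D.ell k := by
      have e2 : x c - D.pos j b c = (D.ell k * i c - D.ell j * b c) +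
          (x c - D.z c - D.ell k * i c) := by
        have : D.pos j b c = D.z c + D.ell j * b c := rfl
        rw [this]; ring
      rw [e2]
      refine (abs_add_le _ _).trans (add_le_add_right ?_ _)
      rw [abs_le]
      constructor <;> linarith
    linarith

/-- Away from an exceptional set of controlled size every level is active. -/
lemma exists_exceptional (hseg : FinSegUnion D.Γ) : ∃ E ⊆ win D.z D.s, MeasurableSet E ∧
    volume E ≤ ENNReal.ofReal (cE * (μH[1] (D.Γ ∩ win D.z D.s)).toReal ^ 2) ∧
    μH[1] (frontier E) ≤ ENNReal.ofReal (cE * (μH[1] (D.Γ ∩ win D.z D.s)).toReal) ∧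
    ∀ x ∈ win D.z D.s, x ∉ E → ∀ k, (D.act k x).Nonempty := by
  classical
  obtain ⟨N, hN⟩ := D.exists_bad_coarse hseg
  set t : Set (ℕ × (Fin 2 → ℤ)) := {q | q.1 ≤ N ∧ D.Bad q.1 q.2} with ht
  have htfin : t.Finite := by
    refine ((Finset.range (N + 1)) ×ˢ
      (Fintype.piFinset fun _ : Fin 2 => Finset.Icc 0 (nn N))).finite_toSet.subset ?_
    rintro ⟨j, b⟩ ⟨hj, hb⟩
    simp only [Finset.coe_product, mem_prod, Finset.mem_coe, Finset.mem_range,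
      Fintype.mem_piFinset, Finset.mem_Icc]
    refine ⟨Nat.lt_succ_of_le hj, fun c => ⟨(hb.1 c).1, (hb.1 c).2.trans ?_⟩⟩
    simp only [nn]
    have : (2 : ℤ) ^ (j + 2) ≤ 2 ^ (N + 2) := pow_le_pow_right₀ (by norm_num) (by omega)
    omega
  obtain ⟨w, hwt, hdisj, hcov⟩ := Vitali.exists_disjoint_subfamily_covering_enlargement
    (fun q : ℕ × (Fin 2 → ℤ) => D.W q.1 q.2) t (fun q => D.ell q.1) 2 one_lt_two
    (fun q _ => (D.ell_pos _).le) (D.ell 0) (fun q _ => D.ell_anti (Nat.zero_le _))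
    (fun q hq => by
      refine nonempty_iff_ne_empty.2 fun h0 => ?_
      have h1 := hq.2.2
      rw [h0, inter_empty, measure_empty] at h1
      exact not_lt_zero h1)
  have hwfin := htfin.subset hwt
  set v := hwfin.toFinset with hv
  have hvw : ∀ q ∈ v, D.Bad q.1 q.2 := fun q hq => (hwt (hwfin.mem_toFinset.1 hq)).2
  have hη : (0 : ℝ) < etaW := by rw [etaW]; norm_num
  set H := μH[1] (D.Γ ∩ win D.z D.s) with hH
  have hHtop : H ≠ ⊤ := ne_top_of_le_ne_top ENNReal.ofReal_ne_top D.small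
  have hsum : etaW * (2 * ∑ q ∈ v, D.ell q.1) ≤ H.toReal := by
    refine (ENNReal.ofReal_le_iff_le_toReal hHtop).1 ?_
    have h1 : ∑ q ∈ v, μH[1] (D.Γ ∩ D.W q.1 q.2) ≤ H := by
      have hdis : PairwiseDisjoint (v : Set (ℕ × (Fin 2 → ℤ)))
          fun q => D.Γ ∩ D.W q.1 q.2 := by
        intro q hq q' hq' hne
        refine (hdisj (hwfin.mem_toFinset.1 hq) (hwfin.mem_toFinset.1 hq') hne).mono ?_ ?_ <;>
          exact inter_subset_right
      rw [← measure_biUnion_finset hdis fun q _ =>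
        D.closed.measurableSet.inter (D.measurableSet_W _ _)]
      exact measure_mono (iUnion₂_subset fun q hq =>
        inter_subset_inter_right _ (D.W_subset (hvw q hq).1))
    refine le_trans ?_ h1
    rw [Finset.mul_sum, Finset.mul_sum, ENNReal.ofReal_sum_of_nonneg fun q _ => by
      have := D.ell_pos q.1; positivity]
    exact Finset.sum_le_sum fun q hq => (hvw q hq).2.le
  have hS0 : 0 ≤ ∑ q ∈ v, D.ell q.1 := Finset.sum_nonneg fun q _ => (D.ell_pos _).le
  have hS1 : 2240 * ∑ q ∈ v, D.ell q.1 ≤ 1120 / etaW * H.toReal := by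
    rw [div_mul_eq_mul_div, le_div_iff₀ hη]
    linarith
  have hH0 : 0 ≤ H.toReal := ENNReal.toReal_nonneg
  have hc1 : 1 ≤ 2240 / etaW := by
    rw [le_div_iff₀ hη, etaW]; norm_num
  refine ⟨⋃ q ∈ v, win D.z D.s ∩ cube (D.pos q.1 q.2) (140 * D.ell q.1),
    iUnion₂_subset fun q _ => inter_subset_left,
    Finset.measurableSet_biUnion _ fun q _ =>
      (isOpen_win _ _).measurableSet.inter (isClosed_cube _ _).measurableSet, ?_, ?_, ?_⟩
  · refine (measure_biUnion_finset_le _ _).trans ?_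
    refine (Finset.sum_le_sum fun q _ => (measure_mono inter_subset_right).trans_eq
      (volume_cube _ (by have := D.ell_pos q.1; positivity))).trans ?_
    rw [← ENNReal.ofReal_sum_of_nonneg fun q _ => by positivity]
    apply ENNReal.ofReal_le_ofReal
    have h1 : ∑ q ∈ v, 4 * (140 * D.ell q.1) ^ 2 = 280 ^ 2 * ∑ q ∈ v, D.ell q.1 ^ 2 := by
      rw [Finset.mul_sum]
      exact Finset.sum_congr rfl fun q _ => by ring
    have h2 := Finset.sum_sq_le_sq_sum_of_nonneg (s := v) (f := fun q => D.ell q.1)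
      fun q _ => (D.ell_pos _).le
    have h3 : (2240 * ∑ q ∈ v, D.ell q.1) ^ 2 ≤ (2240 / etaW * H.toReal) ^ 2 := by
      refine pow_le_pow_left₀ (by positivity) (hS1.trans ?_) 2
      gcongr
      norm_num
    rw [mul_pow, mul_pow] at h3
    rw [h1, cE]
    nlinarith [sq_nonneg (∑ q ∈ v, D.ell q.1)]
  · refine (measure_mono (frontier_biUnion_finset_subset _ _)).trans ?_
    refine (measure_biUnion_finset_le _ _).trans ?_
    refine (Finset.sum_le_sum fun q _ => hausdorffMeasure_frontier_inter_le _ _ _ _).trans ?_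
    rw [← ENNReal.ofReal_sum_of_nonneg fun q _ => by have := D.ell_pos q.1; positivity]
    apply ENNReal.ofReal_le_ofReal
    have h1 : ∑ q ∈ v, 16 * (140 * D.ell q.1) = 2240 * ∑ q ∈ v, D.ell q.1 := by
      rw [Finset.mul_sum]
      exact Finset.sum_congr rfl fun q _ => by ring
    rw [h1]
    refine hS1.trans (mul_le_mul_of_nonneg_right ?_ hH0)
    have h2 : 1120 / etaW ≤ 2240 / etaW := by gcongr; norm_num
    rw [cE]
    nlinarith
  · intro x hx hxE k
    refine D.act_nonempty hx fun j b hb => ?_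
    have hex : ∃ q ∈ v, D.ell j ≤ 2 * D.ell q.1 ∧
        ∀ c, |D.pos j b c - D.pos q.1 q.2 c| ≤ 8 * D.ell q.1 := by
      by_cases hj : j ≤ N
      · obtain ⟨q, hq, hne, hle⟩ := hcov (j, b) ⟨hj, hb⟩
        refine ⟨q, hwfin.mem_toFinset.2 hq, hle, fun c => ?_⟩
        have hq0 := D.ell_pos q.1
        have := D.abs_pos_sub_le hne hle (by linarith) c
        linarith
      · obtain ⟨b', hb', hne'⟩ := hN j b hb
        obtain ⟨q, hq, hne, hle⟩ := hcov (N, b') ⟨le_rfl, hb'⟩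
        have hq0 := D.ell_pos q.1
        have hjN : D.ell j ≤ D.ell N := D.ell_anti (by omega)
        refine ⟨q, hwfin.mem_toFinset.2 hq, hjN.trans hle, fun c => ?_⟩
        have h1 := D.abs_pos_sub_le hne hle (by linarith) c
        have h2 := D.abs_pos_sub_le hne' (hjN.trans hle) hle c
        have h3 := abs_sub_le (D.pos j b c) (D.pos N b' c) (D.pos q.1 q.2 c)
        linarith
    obtain ⟨q, hq, hle, hpos⟩ := hex
    have hxq : x ∉ cube (D.pos q.1 q.2) (140 * D.ell q.1) := fun h =>
      hxE (mem_iUnion₂.2 ⟨q, hq, hx, h⟩)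
    simp only [cube, mem_ofPred_eq, not_forall, not_le] at hxq
    obtain ⟨c, hc⟩ := hxq
    refine ⟨c, ?_⟩
    have h1 := hpos c
    have h2 := abs_sub_le (x c) (D.pos j b c) (D.pos q.1 q.2 c)
    linarith

end Setup

end PiecewiseKorn

namespace PiecewiseKorn

lemma volume_segment (a b : E2) : volume (segment ℝ a b) = 0 := by
  have hsub : segment ℝ a b ⊆ (affineSpan ℝ {a, b} : Set E2) := by
    rintro _ hx
    rw [segment_eq_image_lineMap] at hx
    obtain ⟨t, -, rfl⟩ := hx
    exact AffineMap.lineMap_mem_affineSpan_pair t a b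
  refine measure_mono_null hsub (Measure.addHaar_affineSubspace volume _ fun h => ?_)
  have h1 := (collinear_pair ℝ a b).finrank_le_one
  rw [← direction_affineSpan, h, AffineSubspace.direction_top, finrank_top,
    finrank_euclideanSpace, Fintype.card_fin] at h1
  omega

lemma isCompact_segment (a b : E2) : IsCompact (segment ℝ a b) := by
  rw [segment_eq_image_lineMap]
  exact isCompact_Icc.image AffineMap.lineMap_continuous

lemma isCompact_of_finSegUnion {Γ : Set E2} (h : FinSegUnion Γ) : IsCompact Γ := by
  obtain ⟨n, a, b, rfl⟩ := h
  exact isCompact_iUnion fun i => isCompact_segment _ _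

lemma volume_of_finSegUnion {Γ : Set E2} (h : FinSegUnion Γ) : volume Γ = 0 := by
  obtain ⟨n, a, b, rfl⟩ := h
  exact measure_iUnion_null fun i => volume_segment _ _

/-- A bound on the function is inherited by approximating rigid motions. -/
lemma Near.norm_le {u : E2 → E2} {a : ℝ × E2} {m M s : ℝ} {p z : E2} (hs : 0 < s) (hM : 0 ≤ M)
    (h : Near u a m p (s / 2)) (hsub : win p (s / 2) ⊆ win z s)
    (hu : ∀ᵐ x, x ∈ win z s → ‖u x‖ ≤ M) :
    |a.1| ≤ 8 * (M + m) / s ∧ ∀ x ∈ win z s, ‖rg a x‖ ≤ 17 * (M + m) := by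
  classical
  set u' : E2 → E2 := fun x => if ‖u x‖ ≤ M then u x else 0 with hu'
  have hb : ∀ x, ‖u' x‖ ≤ M := by
    intro x
    simp only [hu']
    split_ifs with h1
    · exact h1
    · simpa using hM
  have h' : Near u' a m p (s / 2) := by
    refine le_trans (measure_mono_ae ?_) h
    filter_upwards [hu] with x hx hx'
    have h1 := hx (hsub hx'.1)
    refine ⟨hx'.1, ?_⟩
    have h2 := hx'.2
    simp only [hu', if_pos h1] at h2
    exact h2
  set v : E2 := (s / 4) • EuclideanSpace.single 0 (1 : ℝ) with hv
  have hv' : ∀ c, 0 ≤ v c ∧ v c ≤ s / 2 / 2 := by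
    intro c
    have e1 : v c = s / 4 * (EuclideanSpace.single 0 (1 : ℝ) : E2) c := rfl
    rw [e1, PiLp.single_apply]
    split_ifs <;> constructor <;> linarith
  obtain ⟨y, hy, hy', h1, h2⟩ := h'.exists_pair (by positivity) hv'
  have hn : ∀ y, ‖u' y - rg a y‖ ≤ m → ‖rg a y‖ ≤ M + m := by
    intro y hy
    have := norm_sub_norm_le (rg a y) (u' y)
    rw [norm_sub_rev] at this
    linarith [hb y]
  have h1' := hn _ h1
  have h2' := hn _ h2
  have hα : |a.1| ≤ 8 * (M + m) / s := by
    have h3 : ‖rgD a v‖ ≤ (M + m) + (M + m) := by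
      have e : rgD a v = rg a (y + v) - rg a y := by rw [rg_sub_rg, add_sub_cancel_left]
      rw [e]
      exact (norm_sub_le _ _).trans (add_le_add h2' h1')
    have h4 : ‖v‖ = s / 4 := by
      rw [hv, norm_smul, Real.norm_of_nonneg (by positivity), PiLp.norm_single]
      simp
    rw [norm_rgD_apply, h4] at h3
    rw [le_div_iff₀ hs]
    linarith
  refine ⟨hα, fun x hx => ?_⟩
  have hxy : ‖x - y‖ ≤ 2 * s := by
    refine norm_le_coord _ fun c => ?_
    have h3 := hx c
    have h4 := hsub hy c
    change |x c - y c| ≤ s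
    rw [abs_le]
    constructor <;> linarith
  have e : rg a x = rg a y + rgD a (x - y) := by rw [← rg_sub_rg]; abel
  rw [e]
  refine (norm_add_le _ _).trans ?_
  rw [norm_rgD_apply]
  have h5 : |a.1| * ‖x - y‖ ≤ 8 * (M + m) / s * (2 * s) :=
    mul_le_mul hα hxy (norm_nonneg _) ((abs_nonneg _).trans hα)
  have h6 : 8 * (M + m) / s * (2 * s) = 16 * (M + m) := by field_simp; ring
  linarith

/-- The constant in the supremum bound. -/
def cL : ℝ := 17 * (1 + cW)

/-- The constant in Korn's inequality for functions with small jump set. -/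
def cG : ℝ := 2 * Setup.cK + 2 * (16 * (1 + cW)) ^ 2

/-- Korn's inequality up to an exceptional set, for functions with small jump set. -/
theorem korn_small_jump {u : E2 → E2} {Γ : Set E2} {z : E2} {s M : ℝ} (hs : 0 < s) (hM : 0 ≤ M)
    (hseg : FinSegUnion Γ) (hlip : ∀ x ∈ win z s \ Γ, LipAt u x) (hfin : En u (win z s) ≠ ⊤)
    (hsmall : μH[1] (Γ ∩ win z s) ≤ ENNReal.ofReal (etaW * (s / 2)))
    (hu : ∀ᵐ x, x ∈ win z s → ‖u x‖ ≤ M) :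
    ∃ E ⊆ win z s, MeasurableSet E ∧
      volume E ≤ ENNReal.ofReal (cE * (μH[1] (Γ ∩ win z s)).toReal ^ 2) ∧
      μH[1] (frontier E) ≤ ENNReal.ofReal (cE * (μH[1] (Γ ∩ win z s)).toReal) ∧
      ∃ a, (∀ x ∈ win z s, ‖rg a x‖ ≤ cL * M) ∧
        ∫⁻ x in win z s \ E, ENNReal.ofReal (fN (fderiv ℝ u x - rgD a) ^ 2) ≤
          ENNReal.ofReal cG * En u (win z s) := by
  set D : Setup := ⟨u, Γ, z, s, hs, (isCompact_of_finSegUnion hseg).isClosed,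
    volume_of_finSegUnion hseg, hlip, hfin, hsmall⟩ with hD
  obtain ⟨E, hES, hEm, hEv, hEf, hact⟩ := D.exists_exceptional hseg
  refine ⟨E, hES, hEm, hEv, hEf, ?_⟩
  have hSm : MeasurableSet (win z s) := (isOpen_win z s).measurableSet
  have hK : ∫⁻ x in win z s \ E, ENNReal.ofReal (fN (fderiv ℝ u x - rgD D.a0) ^ 2) ≤
      ENNReal.ofReal Setup.cK * En u (win z s) :=
    D.lintegral_fderiv_sub_le (hSm.diff hEm) sdiff_subset fun x hx => hact x hx.1 hx.2
  have hr : ∀ c : Fin 2, (0 : ℤ) ≤ (fun _ => 1 : Fin 2 → ℤ) c ∧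
      (fun _ => 1 : Fin 2 → ℤ) c ≤ Setup.nn 0 := fun c => by norm_num [Setup.nn]
  have hnear := D.near_mot hr (D.not_bad_zero _)
  have hsub := D.W_subset hr
  set m := D.amp 0 fun _ => 1 with hm
  have e0 : 2 * D.ell 0 = s / 2 := by rw [Setup.ell_zero]; ring
  rw [Setup.W] at hsub
  rw [e0] at hnear hsub
  obtain ⟨hα, hrg⟩ := hnear.norm_le hs hM hsub hu
  set G := (En u (win z s)).toReal with hG
  have hG0 : 0 ≤ G := ENNReal.toReal_nonneg
  have hmG : m ≤ cW * √G := by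
    rw [hm, Setup.amp]
    have := Setup.cW_pos
    gcongr
    exact ENNReal.toReal_mono hfin (Setup.En_mono (D.W_subset hr))
  have hGe : En u (win z s) = ENNReal.ofReal G := (ENNReal.ofReal_toReal hfin).symm
  have hcK : 0 ≤ Setup.cK := by
    have := Setup.cV_pos
    unfold Setup.cK Setup.cF; positivity
  have hcW := Setup.cW_pos
  by_cases hc : √G ≤ M
  · refine ⟨D.a0, fun x hx => (hrg x hx).trans ?_, hK.trans ?_⟩
    · rw [cL]
      nlinarith
    · gcongr
      rw [cG]
      nlinarith [sq_nonneg (16 * (1 + cW))]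
  · push Not at hc
    refine ⟨0, fun x hx => ?_, ?_⟩
    · have : rg 0 x = 0 := by simp [rg]
      rw [this, norm_zero]
      rw [cL]; positivity
    · have e1 : rgD 0 = 0 := by
        refine ContinuousLinearMap.ext fun x => ?_
        change (0 : ℝ) • rot x = 0
        exact zero_smul ℝ _
      have hA : fN (rgD D.a0) ^ 2 * s ^ 2 ≤ (16 * (1 + cW)) ^ 2 * G := by
        have h1 : fN (rgD D.a0) ≤ 2 * (8 * (M + m) / s) :=
          (fN_le_two_mul _).trans (mul_le_mul_of_nonneg_left ((norm_rgD_le _).trans hα) zero_le_two)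
        have h2 : fN (rgD D.a0) * s ≤ 16 * (1 + cW) * √G := by
          refine (mul_le_mul_of_nonneg_right h1 hs.le).trans ?_
          have : 2 * (8 * (M + m) / s) * s = 16 * (M + m) := by field_simp; ring
          rw [this]
          linarith
        have h3 := pow_le_pow_left₀ (mul_nonneg (fN_nonneg _) hs.le) h2 2
        rwa [mul_pow, mul_pow _ √G, Real.sq_sqrt hG0] at h3
      have hpt : ∀ x, ENNReal.ofReal (fN (fderiv ℝ u x - rgD 0) ^ 2) ≤
          2 * ENNReal.ofReal (fN (fderiv ℝ u x - rgD D.a0) ^ 2) +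
            ENNReal.ofReal (2 * fN (rgD D.a0) ^ 2) := by
        intro x
        have e3 : ∀ t : ℝ, 2 * ENNReal.ofReal t = ENNReal.ofReal (2 * t) := fun t => by
          rw [ENNReal.ofReal_mul zero_le_two, ENNReal.ofReal_ofNat]
        rw [e3, ← ENNReal.ofReal_add (by positivity) (by positivity)]
        apply ENNReal.ofReal_le_ofReal
        have e2 : fderiv ℝ u x - rgD 0 = (fderiv ℝ u x - rgD D.a0) + rgD D.a0 := by
          rw [e1, sub_add_cancel, sub_zero]
        rw [e2]
        exact fN_add_le _ _
      refine (lintegral_mono hpt).trans ?_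
      rw [lintegral_add_right _ measurable_const, lintegral_const_mul' _ _ (by simp),
        lintegral_const, Measure.restrict_apply MeasurableSet.univ, univ_inter]
      have hvol : volume (win z s \ E) ≤ ENNReal.ofReal (s ^ 2) :=
        (measure_mono sdiff_subset).trans_eq (volume_win z hs.le)
      refine (add_le_add (mul_le_mul_right hK 2) (mul_le_mul_right hvol _)).trans ?_
      have e3 : 2 * (ENNReal.ofReal Setup.cK * En u (win z s)) =
          ENNReal.ofReal (2 * (Setup.cK * G)) := by
        rw [ENNReal.ofReal_mul zero_le_two, ENNReal.ofReal_mul hcK, ENNReal.ofReal_ofNat, hGe]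
      have hcG : 0 ≤ cG := by unfold cG; positivity
      rw [e3, hGe, ← ENNReal.ofReal_mul (by positivity), ← ENNReal.ofReal_mul hcG,
        ← ENNReal.ofReal_add (by positivity) (by positivity)]
      apply ENNReal.ofReal_le_ofReal
      rw [cG]
      nlinarith

end PiecewiseKorn

namespace PiecewiseKorn

lemma cL_pos : 0 < cL := by
  have := Setup.cW_pos
  unfold cL; positivity

lemma Qsq_eq_win (μ : ℝ) : Qsq μ = win (WithLp.toLp 2 fun _ => -μ) (2 * μ) := by
  ext x
  refine forall_congr' fun c => ?_
  change |x c| < μ ↔ -μ < x c ∧ x c < -μ + 2 * μ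
  rw [abs_lt]
  constructor <;> rintro ⟨h1, h2⟩ <;> constructor <;> linarith

lemma isOpen_Qsq (μ : ℝ) : IsOpen (Qsq μ) := Qsq_eq_win μ ▸ isOpen_win _ _

lemma volume_Qsq {μ : ℝ} (hμ : 0 ≤ μ) : volume (Qsq μ) = ENNReal.ofReal ((2 * μ) ^ 2) := by
  rw [Qsq_eq_win, volume_win _ (by positivity)]

variable {μ : ℝ} {u : E2 → E2} {Γ : Set E2}

lemma En_ne_top_of_isW (hμ : 0 ≤ μ) (h : IsW μ u Γ) : En u (Qsq μ) ≠ ⊤ := by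
  obtain ⟨-, hΓ, -, K, hK⟩ := h
  have hb : En u (Qsq μ) ≤ ∫⁻ _ in Qsq μ, ENNReal.ofReal (K ^ 2) := by
    refine setLIntegral_mono_ae measurable_const.aemeasurable ?_
    filter_upwards [hK, measure_eq_zero_iff_ae_notMem.1 (volume_of_finSegUnion hΓ)]
      with x hx hxΓ hxQ
    have h1 := hx ⟨hxQ, hxΓ⟩
    rw [matNorm_mgrad] at h1
    exact ENNReal.ofReal_le_ofReal (pow_le_pow_left₀ (eN_nonneg _) ((eN_le_fN _).trans h1) 2)
  refine ne_top_of_le_ne_top ?_ hb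
  rw [setLIntegral_const, volume_Qsq hμ]
  exact ENNReal.mul_ne_top ENNReal.ofReal_ne_top ENNReal.ofReal_ne_top

lemma eLpNorm_top_ne_top_of_isW (h : IsW μ u Γ) :
    eLpNorm u ⊤ (volume.restrict (Qsq μ)) ≠ ⊤ := by
  obtain ⟨⟨M, hM⟩, -⟩ := h
  rw [eLpNorm_exponent_top]
  refine ne_top_of_le_ne_top (ENNReal.ofReal_ne_top (r := M)) (eLpNormEssSup_le_of_ae_bound ?_)
  exact (ae_restrict_iff' (isOpen_Qsq μ).measurableSet).2 (Filter.Eventually.of_forall hM)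

lemma ae_norm_le_of_isW (h : IsW μ u Γ) : ∀ᵐ x, x ∈ Qsq μ →
    ‖u x‖ ≤ (eLpNorm u ⊤ (volume.restrict (Qsq μ))).toReal := by
  have ht := eLpNorm_top_ne_top_of_isW h
  refine (ae_restrict_iff' (isOpen_Qsq μ).measurableSet).1 ?_
  rw [eLpNorm_exponent_top] at ht ⊢
  filter_upwards [ae_le_eLpNormEssSup (f := u) (μ := volume.restrict (Qsq μ))] with x hx
  rw [← toReal_enorm]
  exact ENNReal.toReal_mono ht hx

lemma ae_differentiableAt_of_isW (h : IsW μ u Γ) : ∀ᵐ x, x ∈ Qsq μ → DifferentiableAt ℝ u x := by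
  obtain ⟨-, hΓ, hL, -⟩ := h
  filter_upwards [ae_differentiableAt_of_lipAt hL,
    measure_eq_zero_iff_ae_notMem.1 (volume_of_finSegUnion hΓ)] with x h1 h2 hx
  exact h1 ⟨hx, h2⟩

lemma sum_indicator_of_mem {n : ℕ} {P : Fin n → Set E2} (hd : Pairwise (Function.onFun Disjoint P))
    (f : Fin n → E2 → E2) {j : Fin n} {x : E2} (hx : x ∈ P j) :
    ∑ i, (P i).indicator (f i) x = f j x := by
  rw [Finset.sum_eq_single j, indicator_of_mem hx]
  · intro i _ hij
    exact indicator_of_notMem (fun hi => disjoint_left.1 (hd hij) hi hx) _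
  · simp

section Pieces

variable {n : ℕ} {P : Fin n → Set E2} {E : Set E2} {a : Fin n → ℝ × E2}

lemma lintegral_fderiv_pieces_le (h : IsW μ u Γ) (hE : MeasurableSet E)
    (hopen : ∀ j, IsOpen (P j)) (hsub : ∀ j, P j ⊆ Qsq μ)
    (hd : Pairwise (Function.onFun Disjoint P)) (hcov : volume (Qsq μ \ ⋃ j, P j) = 0) {κ : ℝ}
    (hG : ∀ j, ∫⁻ x in P j \ E, ENNReal.ofReal (fN (fderiv ℝ u x - rgD (a j)) ^ 2) ≤
      ENNReal.ofReal κ * En u (P j)) :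
    ∫⁻ x in Qsq μ \ E, ENNReal.ofReal
        (fN (fderiv ℝ (fun y => u y - ∑ j, (P j).indicator (rg (a j)) y) x) ^ 2) ≤
      ENNReal.ofReal κ * En u (Qsq μ) := by
  set v : E2 → E2 := fun y => u y - ∑ j, (P j).indicator (rg (a j)) y with hv
  have hfd : ∀ᵐ x, ∀ j, x ∈ P j → fderiv ℝ v x = fderiv ℝ u x - rgD (a j) := by
    filter_upwards [ae_differentiableAt_of_isW h] with x hx j hxj
    have h1 : v =ᶠ[nhds x] fun y => u y - rg (a j) y := by
      filter_upwards [(hopen j).mem_nhds hxj] with y hy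
      rw [hv]
      simp only [sum_indicator_of_mem hd _ hy]
    rw [h1.fderiv_eq]
    exact ((hx (hsub j hxj)).hasFDerivAt.sub (rg_hasFDerivAt (a j) x)).fderiv
  have hle : ∀ᵐ x, x ∈ Qsq μ \ E → x ∈ ⋃ j, P j \ E := by
    filter_upwards [measure_eq_zero_iff_ae_notMem.1 hcov] with x hx hxQ
    obtain ⟨j, hj⟩ := mem_iUnion.1 (by_contra fun hn => hx ⟨hxQ.1, hn⟩)
    exact mem_iUnion.2 ⟨j, hj, hxQ.2⟩
  calc ∫⁻ x in Qsq μ \ E, ENNReal.ofReal (fN (fderiv ℝ v x) ^ 2)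
      ≤ ∫⁻ x in ⋃ j, P j \ E, ENNReal.ofReal (fN (fderiv ℝ v x) ^ 2) :=
        lintegral_mono' (Measure.restrict_mono' hle le_rfl) le_rfl
    _ ≤ ∑' j, ∫⁻ x in P j \ E, ENNReal.ofReal (fN (fderiv ℝ v x) ^ 2) := lintegral_iUnion_le _ _
    _ = ∑ j, ∫⁻ x in P j \ E, ENNReal.ofReal (fN (fderiv ℝ u x - rgD (a j)) ^ 2) := by
        rw [tsum_fintype]
        refine Finset.sum_congr rfl fun j _ => ?_
        refine setLIntegral_congr_fun_ae ((hopen j).measurableSet.diff hE) ?_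
        filter_upwards [hfd] with x hx hxj
        rw [hx j hxj.1]
    _ ≤ ∑ j, ENNReal.ofReal κ * En u (P j) := Finset.sum_le_sum fun j _ => hG j
    _ = ENNReal.ofReal κ * ∫⁻ x in ⋃ j, P j, gE u x := by
        rw [← Finset.mul_sum, lintegral_iUnion (fun j => (hopen j).measurableSet) hd, tsum_fintype]
        rfl
    _ ≤ ENNReal.ofReal κ * En u (Qsq μ) := by
        gcongr
        exact lintegral_mono_set (iUnion_subset hsub)

lemma eLpNorm_top_pieces_le (h : IsW μ u Γ) (hd : Pairwise (Function.onFun Disjoint P))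
    (hb : ∀ j, ∀ x ∈ P j,
      ‖rg (a j) x‖ ≤ cL * (eLpNorm u ⊤ (volume.restrict (Qsq μ))).toReal) :
    eLpNorm (fun y => u y - ∑ j, (P j).indicator (rg (a j)) y) ⊤ (volume.restrict (Qsq μ)) ≤
      ENNReal.ofReal (1 + cL) * eLpNorm u ⊤ (volume.restrict (Qsq μ)) := by
  set M := (eLpNorm u ⊤ (volume.restrict (Qsq μ))).toReal with hM
  have hM0 : 0 ≤ M := ENNReal.toReal_nonneg
  have hcL := cL_pos
  have e : eLpNorm u ⊤ (volume.restrict (Qsq μ)) = ENNReal.ofReal M :=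
    (ENNReal.ofReal_toReal (eLpNorm_top_ne_top_of_isW h)).symm
  rw [e, ← ENNReal.ofReal_mul (by positivity), eLpNorm_exponent_top]
  refine eLpNormEssSup_le_of_ae_bound ?_
  rw [ae_restrict_iff' (isOpen_Qsq μ).measurableSet]
  filter_upwards [ae_norm_le_of_isW h] with x hx hxQ
  have h1 : ‖∑ j, (P j).indicator (rg (a j)) x‖ ≤ cL * M := by
    by_cases hj : ∃ j, x ∈ P j
    · obtain ⟨j, hj⟩ := hj
      rw [sum_indicator_of_mem hd _ hj]
      exact hb j x hj
    · push Not at hj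
      rw [Finset.sum_eq_zero fun j _ => indicator_of_notMem (hj j) _, norm_zero]
      positivity
  have h2 := norm_sub_le (u x) (∑ j, (P j).indicator (rg (a j)) x)
  linarith [hx hxQ]

end Pieces

lemma eLpNorm_two_eq {f : E2 → ℝ} {S : Set E2} :
    eLpNorm f 2 (volume.restrict S) =
      (∫⁻ x in S, ENNReal.ofReal (f x ^ 2)) ^ (1 / 2 : ℝ) := by
  rw [eLpNorm_eq_lintegral_rpow_enorm_toReal two_ne_zero ENNReal.ofNat_ne_top]
  simp only [ENNReal.toReal_ofNat, ENNReal.rpow_ofNat]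
  congr 1
  refine lintegral_congr fun x => ?_
  rw [← enorm_pow, Real.enorm_of_nonneg (sq_nonneg _)]

lemma eLpNorm_le_of_sq_le {p κ : ℝ} (hp : 1 ≤ p) (hp2 : p < 2) (hμ : 0 < μ) (hκ : 0 ≤ κ)
    {f g : E2 → ℝ} {S : Set E2} (hf : Measurable f) (hS : S ⊆ Qsq μ)
    (hfg : ∫⁻ x in S, ENNReal.ofReal (f x ^ 2) ≤
      ENNReal.ofReal κ * ∫⁻ x in Qsq μ, ENNReal.ofReal (g x ^ 2)) :
    eLpNorm f (ENNReal.ofReal p) (volume.restrict S) ≤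
      ENNReal.ofReal (2 * √κ * μ ^ (2 / p - 1)) * eLpNorm g 2 (volume.restrict (Qsq μ)) := by
  have hp0 : 0 < p := by linarith
  have hpq : ENNReal.ofReal p ≤ 2 := by
    rw [← ENNReal.ofReal_ofNat]; exact ENNReal.ofReal_le_ofReal hp2.le
  have h1 := eLpNorm_le_eLpNorm_mul_rpow_measure_univ (μ := volume.restrict S) hpq
    hf.aestronglyMeasurable
  rw [Measure.restrict_apply_univ, ENNReal.toReal_ofReal hp0.le, ENNReal.toReal_ofNat] at h1
  have hexp : 0 ≤ 1 / p - 1 / 2 := by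
    have := one_div_le_one_div_of_le hp0 hp2.le
    linarith
  have hexp' : 1 / p - 1 / 2 ≤ 1 / 2 := by
    have := one_div_le_one_div_of_le one_pos hp
    linarith
  have h2 : volume S ^ (1 / p - 1 / 2) ≤ ENNReal.ofReal (2 * μ ^ (2 / p - 1)) := by
    refine (ENNReal.rpow_le_rpow (measure_mono hS) hexp).trans ?_
    rw [volume_Qsq hμ.le, ENNReal.ofReal_rpow_of_pos (by positivity)]
    refine ENNReal.ofReal_le_ofReal ?_
    rw [mul_pow, Real.mul_rpow (by positivity) (by positivity), ← Real.rpow_natCast μ 2,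
      ← Real.rpow_mul hμ.le]
    have e : ((2 : ℕ) : ℝ) * (1 / p - 1 / 2) = 2 / p - 1 := by push_cast; ring
    rw [e]
    gcongr
    calc ((2 : ℝ) ^ 2) ^ (1 / p - 1 / 2) ≤ ((2 : ℝ) ^ 2) ^ (1 / 2 : ℝ) :=
          Real.rpow_le_rpow_of_exponent_le (by norm_num) hexp'
      _ = 2 := by rw [← Real.sqrt_eq_rpow, Real.sqrt_sq zero_le_two]
  have h3 : eLpNorm f 2 (volume.restrict S) ≤
      ENNReal.ofReal √κ * eLpNorm g 2 (volume.restrict (Qsq μ)) := by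
    rw [eLpNorm_two_eq, eLpNorm_two_eq]
    refine (ENNReal.rpow_le_rpow hfg (by norm_num)).trans_eq ?_
    rw [ENNReal.mul_rpow_of_nonneg _ _ (by norm_num),
      ENNReal.ofReal_rpow_of_nonneg hκ (by norm_num), ← Real.sqrt_eq_rpow]
  refine h1.trans ((mul_le_mul' h3 h2).trans_eq ?_)
  rw [mul_right_comm, ← ENNReal.ofReal_mul (Real.sqrt_nonneg _)]
  congr 2
  ring

/-- The skew-symmetric matrix with angular velocity `t`. -/
def skew (t : ℝ) : Matrix (Fin 2) (Fin 2) ℝ := !![0, -t; t, 0]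

lemma transpose_skew (t : ℝ) : Matrix.transpose (skew t) = -skew t := by
  ext i j; fin_cases i <;> fin_cases j <;> simp [skew]

lemma rigid_skew (a : ℝ × E2) : rigid (skew a.1) a.2 = rg a := by
  funext x
  ext i
  fin_cases i <;> simp [rigid, rg, skew, Matrix.toLpLin_apply, dotProduct,
    Fin.sum_univ_two]

end PiecewiseKorn

namespace PiecewiseKorn

lemma etaW_pos : 0 < etaW := by norm_num [etaW]

lemma cE_nonneg : 0 ≤ cE := sq_nonneg _

/-- The constant in the area bound for the exceptional set. -/
def cA : ℝ := cE * etaW / 2 + 2 / etaW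

/-- The constant in the perimeter bound for the exceptional set. -/
def cP : ℝ := cE + 16 / etaW

lemma cA_pos : 0 < cA := by
  have h1 := etaW_pos
  have h2 := cE_nonneg
  unfold cA; positivity

lemma cP_pos : 0 < cP := by
  have h1 := etaW_pos
  have h2 := cE_nonneg
  unfold cP; positivity

lemma hausdorffMeasure_frontier_win_le (z : E2) (s : ℝ) :
    μH[1] (frontier (win z s)) ≤ ENNReal.ofReal (8 * s) := by
  have h := hausdorffMeasure_frontier_inter_le z (z + WithLp.toLp 2 fun _ => s / 2) s (s / 2)
  have e : win z s ∩ cube (z + WithLp.toLp 2 fun _ => s / 2) (s / 2) = win z s := by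
    refine inter_eq_left.2 fun x hx c => ?_
    have h1 := hx c
    change |x c - (z c + s / 2)| ≤ s / 2
    rw [abs_le]
    constructor <;> linarith
  rw [e] at h
  refine h.trans_eq ?_
  congr 1
  ring

variable {μ : ℝ} {u : E2 → E2} {Γ : Set E2}

lemma square_of_small (h : IsW μ u Γ) (hμ : 0 < μ) {z : E2} {s t : ℝ} (ht : 0 < t) (hts : t ≤ s)
    (hq : win z s ⊆ Qsq μ) (hsm : μH[1] (Γ ∩ win z s) ≤ ENNReal.ofReal (etaW * (t / 2))) :
    ∃ E ⊆ win z s, MeasurableSet E ∧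
      volume E ≤ ENNReal.ofReal (cA * t) * μH[1] (Γ ∩ win z s) ∧
      μH[1] (frontier E) ≤ ENNReal.ofReal cP * μH[1] (Γ ∩ win z s) ∧
      ∃ a : ℝ × E2, (∀ x ∈ win z s,
        ‖rg a x‖ ≤ cL * (eLpNorm u ⊤ (volume.restrict (Qsq μ))).toReal) ∧
      ∫⁻ x in win z s \ E, ENNReal.ofReal (fN (fderiv ℝ u x - rgD a) ^ 2) ≤
        ENNReal.ofReal cG * En u (win z s) := by
  have hη := etaW_pos
  have hE := cE_nonneg
  obtain ⟨E, hEs, hEm, hv, hf, a, hb, hG⟩ := korn_small_jump (z := z) (s := s) (u := u) (Γ := Γ)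
    (ht.trans_le hts) ENNReal.toReal_nonneg h.2.1
    (fun x hx => h.2.2.1 x ⟨hq hx.1, hx.2⟩)
    (ne_top_of_le_ne_top (En_ne_top_of_isW hμ.le h) (lintegral_mono_set hq))
    (hsm.trans (ENNReal.ofReal_le_ofReal (by gcongr)))
    ((ae_norm_le_of_isW h).mono fun x hx hxz => hx (hq hxz))
  have hfin : μH[1] (Γ ∩ win z s) ≠ ⊤ := ne_top_of_le_ne_top ENNReal.ofReal_ne_top hsm
  set H := (μH[1] (Γ ∩ win z s)).toReal with hH
  have hH0 : 0 ≤ H := ENNReal.toReal_nonneg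
  have eH : μH[1] (Γ ∩ win z s) = ENNReal.ofReal H := (ENNReal.ofReal_toReal hfin).symm
  have hHle : H ≤ etaW * (t / 2) := ENNReal.toReal_le_of_le_ofReal (by positivity) hsm
  refine ⟨E, hEs, hEm, hv.trans ?_, hf.trans ?_, a, hb, hG⟩
  · have hA := cA_pos
    rw [eH, ← ENNReal.ofReal_mul (by positivity)]
    refine ENNReal.ofReal_le_ofReal ?_
    have h1 : cE * H ^ 2 ≤ cE * (etaW * (t / 2) * H) := by
      rw [sq]; gcongr
    have h2 : 0 ≤ 2 / etaW * t * H := by positivity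
    unfold cA
    linarith
  · rw [eH, ← ENNReal.ofReal_mul cP_pos.le]
    refine ENNReal.ofReal_le_ofReal ?_
    have h2 : 0 ≤ 16 / etaW * H := by positivity
    unfold cP
    linarith

lemma ofReal_le_mul_of_lt {s A B : ℝ} {H : ℝ≥0∞} (hA : 0 ≤ A)
    (h : ENNReal.ofReal s < H) (hB : B ≤ A * s) : ENNReal.ofReal B ≤ ENNReal.ofReal A * H := by
  refine (ENNReal.ofReal_le_ofReal hB).trans ?_
  rw [ENNReal.ofReal_mul hA]
  gcongr

lemma square (h : IsW μ u Γ) (hμ : 0 < μ) {z : E2} {s : ℝ} (hs : 0 < s) (hq : win z s ⊆ Qsq μ) :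
    ∃ E ⊆ win z s, MeasurableSet E ∧
      volume E ≤ ENNReal.ofReal (cA * s) * μH[1] (Γ ∩ win z s) ∧
      μH[1] (frontier E) ≤ ENNReal.ofReal cP * μH[1] (Γ ∩ win z s) ∧
      ∃ a : ℝ × E2, (∀ x ∈ win z s,
        ‖rg a x‖ ≤ cL * (eLpNorm u ⊤ (volume.restrict (Qsq μ))).toReal) ∧
      ∫⁻ x in win z s \ E, ENNReal.ofReal (fN (fderiv ℝ u x - rgD a) ^ 2) ≤
        ENNReal.ofReal cG * En u (win z s) := by
  have hη := etaW_pos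
  have hE := cE_nonneg
  have hL := cL_pos
  rcases le_or_gt (μH[1] (Γ ∩ win z s)) (ENNReal.ofReal (etaW * (s / 2))) with hsm | hlg
  · exact square_of_small h hμ hs le_rfl hq hsm
  · refine ⟨win z s, Subset.rfl, (isOpen_win z s).measurableSet, ?_, ?_, 0, fun x _ => ?_, ?_⟩
    · have hA := cA_pos
      rw [volume_win _ hs.le]
      refine ofReal_le_mul_of_lt (by positivity) hlg ?_
      have e : cA * s * (etaW * (s / 2)) = s ^ 2 + cE * etaW ^ 2 / 4 * s ^ 2 := by
        unfold cA; field_simp; ring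
      rw [e]
      have : 0 ≤ cE * etaW ^ 2 / 4 * s ^ 2 := by positivity
      linarith
    · refine (hausdorffMeasure_frontier_win_le z s).trans
        (ofReal_le_mul_of_lt cP_pos.le hlg ?_)
      have e : cP * (etaW * (s / 2)) = 8 * s + cE * etaW / 2 * s := by
        unfold cP; field_simp; ring
      rw [e]
      have : 0 ≤ cE * etaW / 2 * s := by positivity
      linarith
    · have e : rg 0 x = 0 := by simp [rg]
      rw [e, norm_zero]
      positivity
    · simp

lemma exists_grid (hμ : 0 < μ) {m : ℕ} (hm : 0 < m) : ∃ z : Fin (m ^ 2) → E2,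
    (∀ j, win (z j) (2 * μ / m) ⊆ Qsq μ) ∧
    Pairwise (Function.onFun Disjoint fun j => win (z j) (2 * μ / m)) ∧
    volume (Qsq μ \ ⋃ j, win (z j) (2 * μ / m)) = 0 := by
  have hm' : (0 : ℝ) < m := by exact_mod_cast hm
  set s := 2 * μ / m with hs
  have hs0 : 0 < s := by positivity
  have hsm : s * m = 2 * μ := by rw [hs]; field_simp
  set k : Fin (m ^ 2) → Fin 2 → Fin m := fun j => finFunctionFinEquiv.symm j with hk
  set z : Fin (m ^ 2) → E2 := fun j => WithLp.toLp 2 fun c => -μ + s * (k j c : ℕ) with hz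
  have hzc : ∀ j c, z j c = -μ + s * (k j c : ℕ) := fun _ _ => rfl
  have hsub : ∀ j, win (z j) s ⊆ Qsq μ := by
    intro j x hx c
    have h1 := hx c
    rw [hzc] at h1
    have h2 : ((k j c : ℕ) : ℝ) + 1 ≤ m := by exact_mod_cast (k j c).isLt
    have h3 : s * ((k j c : ℕ) + 1) ≤ s * m := by gcongr
    have h4 : 0 ≤ s * ((k j c : ℕ) : ℝ) := by positivity
    rw [abs_lt]
    constructor <;> linarith
  have hd : Pairwise (Function.onFun Disjoint fun j => win (z j) s) := by
    intro i j hij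
    refine disjoint_left.2 fun x hi hj => hij ?_
    refine finFunctionFinEquiv.symm.injective (funext fun c => ?_)
    have h1 := hi c
    have h2 := hj c
    rw [hzc] at h1 h2
    have h3 : ((k i c : ℕ) : ℝ) < (k j c : ℕ) + 1 := by
      refine lt_of_mul_lt_mul_left ?_ hs0.le
      linarith
    have h4 : ((k j c : ℕ) : ℝ) < (k i c : ℕ) + 1 := by
      refine lt_of_mul_lt_mul_left ?_ hs0.le
      linarith
    have h3' : (k i c : ℕ) < (k j c : ℕ) + 1 := by exact_mod_cast h3
    have h4' : (k j c : ℕ) < (k i c : ℕ) + 1 := by exact_mod_cast h4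
    exact Fin.ext (by change (k i c : ℕ) = (k j c : ℕ); omega)
  refine ⟨z, hsub, hd, ?_⟩
  have hmeas : ∀ j, MeasurableSet (win (z j) s) := fun j => (isOpen_win _ _).measurableSet
  have hU : volume (⋃ j, win (z j) s) = volume (Qsq μ) := by
    rw [measure_iUnion hd hmeas, tsum_fintype]
    simp only [volume_win _ hs0.le]
    rw [Finset.sum_const, Finset.card_univ, Fintype.card_fin, nsmul_eq_mul, volume_Qsq hμ.le,
      ← ENNReal.ofReal_natCast, ← ENNReal.ofReal_mul (by positivity), ← hsm]
    congr 1
    push_cast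
    ring
  rw [measure_sdiff (iUnion_subset hsub) (MeasurableSet.iUnion hmeas).nullMeasurableSet, hU,
    tsub_self]
  rw [hU, volume_Qsq hμ.le]
  exact ENNReal.ofReal_ne_top

lemma inter_subset_iUnion_frontier {n : ℕ} {P : Fin n → Set E2} (hopen : ∀ j, IsOpen (P j))
    (hcov : volume (Qsq μ \ ⋃ j, P j) = 0) (hΓ : ∀ j, Disjoint (P j) Γ) :
    Γ ∩ Qsq μ ⊆ (⋃ j, frontier (P j)) ∩ Γ := by
  rintro x ⟨hxΓ, hxQ⟩
  refine ⟨?_, hxΓ⟩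
  have hcl : x ∈ closure (⋃ j, P j) := by
    by_contra hx
    have ho : IsOpen (Qsq μ ∩ (closure (⋃ j, P j))ᶜ) :=
      (isOpen_Qsq μ).inter isClosed_closure.isOpen_compl
    refine (ho.measure_pos volume ⟨x, hxQ, hx⟩).ne' (measure_mono_null ?_ hcov)
    exact fun y hy => ⟨hy.1, fun hy' => hy.2 (subset_closure hy')⟩
  rw [closure_iUnion_of_finite] at hcl
  obtain ⟨j, hj⟩ := mem_iUnion.1 hcl
  refine mem_iUnion.2 ⟨j, ?_⟩
  rw [(hopen j).frontier_eq]
  exact ⟨hj, fun hxj => disjoint_left.1 (hΓ j) hxj hxΓ⟩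

lemma frontier_sdiff_subset {S : Set E2} (hΓ : IsClosed Γ) : frontier (S \ Γ) ⊆ frontier S ∪ Γ := by
  rw [sdiff_eq]
  refine (frontier_inter_subset _ _).trans (union_subset ?_ ?_)
  · exact inter_subset_left.trans subset_union_left
  · rw [frontier_compl]
    exact inter_subset_right.trans (hΓ.frontier_subset.trans subset_union_right)

lemma exists_pieces (h : IsW μ u Γ) (hμ : 0 < μ) {m : ℕ} (hm : 0 < m) :
    ∃ (E : Set E2) (n : ℕ) (P : Fin n → Set E2) (a : Fin n → ℝ × E2),
      MeasurableSet E ∧ E ⊆ Qsq μ ∧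
      volume E ≤ ENNReal.ofReal (cA * (2 * μ / m)) * μH[1] Γ ∧
      μH[1] (frontier E) ≤ ENNReal.ofReal cP * μH[1] Γ ∧
      (∀ j, IsOpen (P j)) ∧ (∀ j, P j ⊆ Qsq μ) ∧
      Pairwise (Function.onFun Disjoint P) ∧ volume (Qsq μ \ ⋃ j, P j) = 0 ∧
      (∀ j, ∀ x ∈ P j, ‖rg (a j) x‖ ≤ cL * (eLpNorm u ⊤ (volume.restrict (Qsq μ))).toReal) ∧
      (∀ j, ∫⁻ x in P j \ E, ENNReal.ofReal (fN (fderiv ℝ u x - rgD (a j)) ^ 2) ≤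
        ENNReal.ofReal cG * En u (P j)) ∧
      μH[1] ((⋃ j, frontier (P j)) ∩ Qsq μ) ≤
        ENNReal.ofReal (1 + m ^ 2 * (16 / etaW)) * μH[1] ((⋃ j, frontier (P j)) ∩ Γ) := by
  have hη := etaW_pos
  have hm1 : (1 : ℝ) ≤ m := by exact_mod_cast hm
  have hm' : (0 : ℝ) < m := by linarith
  set s := 2 * μ / m with hs
  have hs0 : 0 < s := by positivity
  have hs2 : s ≤ 2 * μ := div_le_self (by positivity) hm1
  have hΓc : IsClosed Γ := (isCompact_of_finSegUnion h.2.1).isClosed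
  have hΓ0 : volume Γ = 0 := volume_of_finSegUnion h.2.1
  rcases le_or_gt (μH[1] (Γ ∩ Qsq μ)) (ENNReal.ofReal (etaW * (s / 2))) with hsm | hlg
  · rw [Qsq_eq_win] at hsm
    obtain ⟨E, hEs, hEm, hv, hf, a, hb, hG⟩ :=
      square_of_small h hμ hs0 hs2 (Qsq_eq_win μ).ge hsm
    rw [← Qsq_eq_win] at hEs hv hf hb hG
    refine ⟨E, 1, fun _ => Qsq μ, fun _ => a, hEm, hEs, hv.trans ?_, hf.trans ?_,
      fun _ => isOpen_Qsq μ, fun _ => Subset.rfl, ?_, ?_, fun _ => hb, fun _ => hG, ?_⟩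
    · gcongr; exact inter_subset_left
    · gcongr; exact inter_subset_left
    · exact fun i j hij => (hij (Subsingleton.elim i j)).elim
    · rw [iUnion_const, sdiff_self]; exact measure_empty
    · rw [iUnion_const, (isOpen_Qsq μ).frontier_eq, sdiff_inter_self, measure_empty]
      exact zero_le
  · obtain ⟨z, hsub, hd, hcov⟩ := exists_grid hμ hm
    rw [← hs] at hsub hd hcov
    choose E hEs hEm hv hf a hb hG using fun j => square h hμ hs0 (hsub j)
    have hP0 : ∀ j, (win (z j) s \ Γ : Set E2) =ᵐ[volume] win (z j) s :=
      fun j => sdiff_null_ae_eq_self hΓ0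
    have hopen : ∀ j, IsOpen (win (z j) s \ Γ) := fun j => (isOpen_win _ _).sdiff hΓc
    have hcov' : volume (Qsq μ \ ⋃ j, win (z j) s \ Γ) = 0 := by
      refine measure_mono_null (t := (Qsq μ \ ⋃ j, win (z j) s) ∪ Γ) ?_
        (measure_union_null hcov hΓ0)
      rintro x ⟨hx, hxn⟩
      by_cases hxΓ : x ∈ Γ
      · exact Or.inr hxΓ
      · refine Or.inl ⟨hx, fun hx' => hxn ?_⟩
        obtain ⟨j, hj⟩ := mem_iUnion.1 hx'
        exact mem_iUnion.2 ⟨j, hj, hxΓ⟩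
    have hsum : ∑ j, μH[1] (Γ ∩ win (z j) s) ≤ μH[1] Γ := by
      rw [← tsum_fintype (L := .unconditional _), ← measure_iUnion]
      · exact measure_mono (iUnion_subset fun _ => inter_subset_left)
      · exact fun i j hij => (hd hij).mono inter_subset_right inter_subset_right
      · exact fun j => hΓc.measurableSet.inter (isOpen_win _ _).measurableSet
    refine ⟨⋃ j, E j, m ^ 2, fun j => win (z j) s \ Γ, a, MeasurableSet.iUnion hEm,
      iUnion_subset fun j => (hEs j).trans (hsub j), ?_, ?_, hopen,
      fun j => sdiff_subset.trans (hsub j),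
      fun i j hij => (hd hij).mono sdiff_subset sdiff_subset, hcov',
      fun j x hx => hb j x hx.1, fun j => ?_, ?_⟩
    · calc volume (⋃ j, E j) ≤ ∑ j, volume (E j) := measure_iUnion_fintype_le _ _
        _ ≤ ∑ j, ENNReal.ofReal (cA * s) * μH[1] (Γ ∩ win (z j) s) :=
          Finset.sum_le_sum fun j _ => hv j
        _ ≤ _ := by rw [← Finset.mul_sum]; gcongr
    · have hfr : frontier (⋃ j, E j) ⊆ ⋃ j, frontier (E j) := by
        simpa using frontier_biUnion_finset_subset Finset.univ E
      calc μH[1] (frontier (⋃ j, E j)) ≤ μH[1] (⋃ j, frontier (E j)) := measure_mono hfr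
        _ ≤ ∑ j, μH[1] (frontier (E j)) := measure_iUnion_fintype_le _ _
        _ ≤ ∑ j, ENNReal.ofReal cP * μH[1] (Γ ∩ win (z j) s) :=
          Finset.sum_le_sum fun j _ => hf j
        _ ≤ _ := by rw [← Finset.mul_sum]; gcongr
    · have e : En u (win (z j) s \ Γ) = En u (win (z j) s) := setLIntegral_congr (hP0 j)
      rw [e]
      refine (lintegral_mono_set ?_).trans (hG j)
      exact fun x hx => ⟨hx.1.1, fun hxE => hx.2 (mem_iUnion.2 ⟨j, hxE⟩)⟩
    · set H := μH[1] ((⋃ j, frontier (win (z j) s \ Γ)) ∩ Γ) with hH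
      have hΓH : μH[1] (Γ ∩ Qsq μ) ≤ H :=
        measure_mono (inter_subset_iUnion_frontier hopen hcov' fun j => disjoint_sdiff_left)
      have h8 : ENNReal.ofReal (8 * s) ≤ ENNReal.ofReal (16 / etaW) * H :=
        ofReal_le_mul_of_lt (by positivity) (hlg.trans_le hΓH)
          (le_of_eq (by field_simp; norm_num))
      have hss : (⋃ j, frontier (win (z j) s \ Γ)) ∩ Qsq μ ⊆
          (Γ ∩ Qsq μ) ∪ ⋃ j, frontier (win (z j) s) := by
        rintro x ⟨hx, hxQ⟩
        obtain ⟨j, hj⟩ := mem_iUnion.1 hx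
        rcases frontier_sdiff_subset hΓc hj with h1 | h1
        · exact Or.inr (mem_iUnion.2 ⟨j, h1⟩)
        · exact Or.inl ⟨h1, hxQ⟩
      calc μH[1] ((⋃ j, frontier (win (z j) s \ Γ)) ∩ Qsq μ)
          ≤ μH[1] (Γ ∩ Qsq μ) + μH[1] (⋃ j, frontier (win (z j) s)) :=
            (measure_mono hss).trans (measure_union_le _ _)
        _ ≤ H + ∑ j : Fin (m ^ 2), ENNReal.ofReal (16 / etaW) * H := by
            refine add_le_add hΓH ((measure_iUnion_fintype_le _ _).trans ?_)
            exact Finset.sum_le_sum fun j _ => (hausdorffMeasure_frontier_win_le _ _).trans h8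
        _ = ENNReal.ofReal (1 + m ^ 2 * (16 / etaW)) * H := by
            rw [Finset.sum_const, Finset.card_univ, Fintype.card_fin, nsmul_eq_mul,
              ENNReal.ofReal_add zero_le_one (by positivity), ENNReal.ofReal_one, add_mul, one_mul,
              ENNReal.ofReal_mul (by positivity), mul_assoc]
            congr 2
            rw [← Nat.cast_pow, ENNReal.ofReal_natCast]

end PiecewiseKorn

open PiecewiseKorn

/-- **Piecewise Korn inequality up to a small exceptional set** (Theorem 4.1). -/
theorem piecewise_korn_small_exceptional_set :
    ∃ c : ℝ, 0 < c ∧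
    ∀ p : ℝ, 1 ≤ p → p < 2 → ∀ θ : ℝ, 0 < θ →
    ∃ C : ℝ, 0 < C ∧
    ∀ μ : ℝ, 0 < μ → ∀ (u : E2 → E2) (Γ : Set E2), IsW μ u Γ →
      ∃ (E : Set E2) (n : ℕ) (P : Fin n → Set E2)
        (A : Fin n → Matrix (Fin 2) (Fin 2) ℝ) (b : Fin n → E2) (v : E2 → E2),
        MeasurableSet E ∧ E ⊆ Qsq μ ∧
        volume E ≤ ENNReal.ofReal (c * μ * θ ^ 2) * μH[1] Γ ∧
        μH[1] (frontier E) ≤ ENNReal.ofReal C * μH[1] Γ ∧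
        (∀ j, IsOpen (P j)) ∧ (∀ j, P j ⊆ Qsq μ) ∧
        Pairwise (Function.onFun Disjoint P) ∧
        volume (Qsq μ \ ⋃ j, P j) = 0 ∧
        (∀ j, Matrix.transpose (A j) = -(A j)) ∧
        (∀ x, v x = u x - ∑ j : Fin n, (P j).indicator (rigid (A j) (b j)) x) ∧
        μH[1] ((⋃ j, frontier (P j)) ∩ Qsq μ) ≤
          ENNReal.ofReal C * μH[1] ((⋃ j, frontier (P j)) ∩ Γ) ∧
        eLpNorm (fun x => matNorm (mgrad v x)) (ENNReal.ofReal p)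
            (volume.restrict (Qsq μ \ E)) ≤
          ENNReal.ofReal (C * μ ^ (2 / p - 1)) *
            eLpNorm (fun x => matNorm (symGrad u x)) 2 (volume.restrict (Qsq μ)) ∧
        eLpNorm v ⊤ (volume.restrict (Qsq μ)) ≤
          ENNReal.ofReal C * eLpNorm u ⊤ (volume.restrict (Qsq μ)) := by
  refine ⟨cA, cA_pos, fun p hp hp2 θ hθ => ?_⟩
  have hη := etaW_pos
  have hP := cP_pos
  have hL := cL_pos
  obtain ⟨m, hm⟩ := exists_nat_ge (2 / θ ^ 2)
  have hm0 : 0 < m := by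
    have : (0 : ℝ) < m := lt_of_lt_of_le (by positivity) hm
    exact_mod_cast this
  have hm0' : (0 : ℝ) < m := by exact_mod_cast hm0
  set C : ℝ := cP + (1 + m ^ 2 * (16 / etaW)) + 2 * √cG + (1 + cL) with hC
  have h1 : 0 ≤ m ^ 2 * (16 / etaW) := by positivity
  have h2 : 0 ≤ 2 * √cG := by positivity
  refine ⟨C, by linarith, fun μ hμ u Γ h => ?_⟩
  obtain ⟨E, n, P, a, hEm, hEs, hv, hf, hopen, hsub, hd, hcov, hb, hG, hfr⟩ :=
    exists_pieces h hμ hm0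
  refine ⟨E, n, P, fun j => skew (a j).1, fun j => (a j).2,
    fun y => u y - ∑ j, (P j).indicator (rg (a j)) y, hEm, hEs, hv.trans ?_, hf.trans ?_,
    hopen, hsub, hd, hcov, fun j => transpose_skew _, fun x => ?_, hfr.trans ?_, ?_,
    (eLpNorm_top_pieces_le h hd hb).trans ?_⟩
  · refine mul_le_mul' (ENNReal.ofReal_le_ofReal ?_) le_rfl
    have h3 : 2 * μ / m ≤ μ * θ ^ 2 := by
      rw [div_le_iff₀ (by positivity)] at hm ⊢
      nlinarith
    have := mul_le_mul_of_nonneg_left h3 cA_pos.le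
    linarith
  · gcongr; linarith
  · simp only [rigid_skew]
  · gcongr; linarith
  · have hmeas : Measurable fun x =>
        fN (fderiv ℝ (fun y => u y - ∑ j, (P j).indicator (rg (a j)) y) x) := by
      refine Real.continuous_sqrt.measurable.comp ?_
      refine Finset.measurable_sum _ fun i _ => Finset.measurable_sum _ fun j _ => ?_
      exact (measurable_mgrad _ i j).pow_const 2
    have hcG : 0 ≤ cG := by
      have := Setup.cV_pos
      unfold cG Setup.cK Setup.cF; positivity
    refine (eLpNorm_le_of_sq_le hp hp2 hμ hcG hmeas sdiff_subset
      (lintegral_fderiv_pieces_le h hEm hopen hsub hd hcov hG)).trans ?_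
    refine mul_le_mul' (ENNReal.ofReal_le_ofReal ?_) le_rfl
    gcongr
    linarith
  · gcongr; linarith
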